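/- Let I:[0,∞)→[0,1] be a nondecreasing, absolutely continuous function satisfying I'(y) ≤ C·y^{−β} for a.e. y>0, for some constants C>0 and 0<β<1. Then there exists δ>0 (depending on θ0, α, c, C, β) such that, if I(0) ≥ 1−δ, the optimal solution of problem (OP2) is unique. -/

import Mathlib

open Real MeasureTheory

/-- `G(θ,u) = (1 − e^{−u/cos(θ−θ0)})·cos(θ−θ0)`. -/
noncomputable def G2 (θ0 θ u : ℝ) : ℝ :=
  (1 - Real.exp (-u / Real.cos (θ - θ0))) * Real.cos (θ - θ0)

/-- Admissible controls for problem (OP2). -/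
def Adm2 (θ0 : ℝ) (θ u : ℝ → ℝ) : Prop :=
  Measurable θ ∧ Measurable u ∧
    (∀ t, θ t ∈ Set.Icc θ0 (π / 2)) ∧ (∀ t, 0 ≤ u t) ∧ IntegrableOn u (Set.Ioi 0)

/-- The payoff of (OP2). -/
noncomputable def Payoff (θ0 α c : ℝ) (I : ℝ → ℝ) (θ u : ℝ → ℝ) : ℝ :=
  ∫ t in Set.Ioi (0 : ℝ),
    (I (∫ s in (0 : ℝ)..t, Real.sin (θ s)) * G2 θ0 (θ t) (u t) -
      c * (∫ s in Set.Ioi t, u s) ^ α)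

namespace OP2

/-! ### The angle and density laws along an extremal -/

/-- The sine of the angle whose cosine is `ρ cos θ0`. -/
noncomputable def sinOf (θ0 ρ : ℝ) : ℝ := √(1 - ρ ^ 2 * cos θ0 ^ 2)

/-- The cosine of the deviation from `θ0` of the angle whose cosine is `ρ cos θ0`. -/
noncomputable def cosOf (θ0 ρ : ℝ) : ℝ := ρ * cos θ0 ^ 2 + sin θ0 * sinOf θ0 ρ

/-- The positive part of `log (x / s)`. -/
noncomputable def ell (x s : ℝ) : ℝ := max 0 (log (x / s))

/-- The maximum over `p ≥ 0` of `x (1 - exp (-p)) - s p`. -/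
noncomputable def capt (x s : ℝ) : ℝ := max x s - s - s * log (max x s / s)

/-- `min 1 (A / E)` for positive `E`. -/
noncomputable def ratio (A E : ℝ) : ℝ := min E A / E

section Trig

variable {θ0 ρ ρ' ε : ℝ}

lemma sq_sinOf (h0 : 0 ≤ ρ) (h1 : ρ ≤ 1) : sinOf θ0 ρ ^ 2 = 1 - ρ ^ 2 * cos θ0 ^ 2 := by
  refine sq_sqrt ?_
  have := sin_sq_add_cos_sq θ0
  nlinarith [mul_nonneg h0 h0, sq_nonneg (sin θ0), sq_nonneg (cos θ0),
    mul_nonneg (sub_nonneg.2 h1) (sq_nonneg (cos θ0)), mul_nonneg h0 (sq_nonneg (cos θ0)),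
    mul_nonneg (mul_nonneg h0 (sub_nonneg.2 h1)) (sq_nonneg (cos θ0))]

lemma sinOf_nonneg : 0 ≤ sinOf θ0 ρ := sqrt_nonneg _

lemma sinOf_le_one : sinOf θ0 ρ ≤ 1 := by
  rw [sinOf, sqrt_le_one]
  nlinarith [mul_nonneg (sq_nonneg ρ) (sq_nonneg (cos θ0))]

lemma le_sinOf (h0 : 0 ≤ ρ) (h1 : ρ ≤ 1) : sin θ0 ≤ sinOf θ0 ρ := by
  refine le_sqrt_of_sq_le ?_
  have := sin_sq_add_cos_sq θ0
  nlinarith [mul_nonneg (sub_nonneg.2 h1) (sq_nonneg (cos θ0)),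
    mul_nonneg (mul_nonneg h0 (sub_nonneg.2 h1)) (sq_nonneg (cos θ0))]

lemma cosOf_le_one (h0 : 0 ≤ ρ) (h1 : ρ ≤ 1) : cosOf θ0 ρ ≤ 1 := by
  have h2 := sin_sq_add_cos_sq θ0
  have h3 := sq_sinOf (θ0 := θ0) h0 h1
  unfold cosOf
  nlinarith [sq_nonneg (ρ * cos θ0 - cos θ0), sq_nonneg (sinOf θ0 ρ - sin θ0)]

lemma le_cosOf (h0 : 0 ≤ ρ) (h1 : ρ ≤ 1) : sin θ0 ≤ cosOf θ0 ρ := by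
  have h3 := sq_sinOf (θ0 := θ0) h0 h1
  have h4 := sinOf_nonneg (θ0 := θ0) (ρ := ρ)
  have h5 := sinOf_le_one (θ0 := θ0) (ρ := ρ)
  have h6 := sin_le_one θ0
  have h7 : 1 - sinOf θ0 ρ ≤ ρ ^ 2 * cos θ0 ^ 2 := by nlinarith
  have h8 : sin θ0 * (1 - sinOf θ0 ρ) ≤ 1 * (ρ ^ 2 * cos θ0 ^ 2) :=
    mul_le_mul h6 h7 (by linarith) zero_le_one
  unfold cosOf
  nlinarith [mul_nonneg (mul_nonneg h0 (sub_nonneg.2 h1)) (sq_nonneg (cos θ0))]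

lemma abs_sinOf_sub_le (hθ : 0 < sin θ0) (h0 : 0 ≤ ρ) (h1 : ρ ≤ 1) (h0' : 0 ≤ ρ')
    (h1' : ρ' ≤ 1) : |sinOf θ0 ρ - sinOf θ0 ρ'| ≤ 1 / sin θ0 * |ρ - ρ'| := by
  have h3 := sq_sinOf (θ0 := θ0) h0 h1
  have h3' := sq_sinOf (θ0 := θ0) h0' h1'
  have h4 := le_sinOf (θ0 := θ0) h0 h1
  have h4' := le_sinOf (θ0 := θ0) h0' h1'
  have hk : cos θ0 ^ 2 ≤ 1 := by nlinarith [sin_sq_add_cos_sq θ0, sq_nonneg (sin θ0)]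
  rw [one_div, ← div_eq_inv_mul, le_div_iff₀ hθ]
  have key : (sinOf θ0 ρ - sinOf θ0 ρ') * (sinOf θ0 ρ + sinOf θ0 ρ')
      = -((ρ - ρ') * ((ρ + ρ') * cos θ0 ^ 2)) := by linear_combination h3 - h3'
  have key2 : |sinOf θ0 ρ - sinOf θ0 ρ'| * (sinOf θ0 ρ + sinOf θ0 ρ')
      = |ρ - ρ'| * ((ρ + ρ') * cos θ0 ^ 2) := by
    have := congrArg abs key
    rwa [abs_neg, abs_mul, abs_mul, abs_of_nonneg (by linarith : 0 ≤ sinOf θ0 ρ + sinOf θ0 ρ'),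
      abs_of_nonneg (by positivity : 0 ≤ (ρ + ρ') * cos θ0 ^ 2)] at this
  have h5 : (ρ + ρ') * cos θ0 ^ 2 ≤ 2 := by nlinarith [sq_nonneg (cos θ0)]
  have h6 : |ρ - ρ'| * ((ρ + ρ') * cos θ0 ^ 2) ≤ |ρ - ρ'| * 2 :=
    mul_le_mul_of_nonneg_left h5 (abs_nonneg _)
  have h7 : |sinOf θ0 ρ - sinOf θ0 ρ'| * (2 * sin θ0)
      ≤ |sinOf θ0 ρ - sinOf θ0 ρ'| * (sinOf θ0 ρ + sinOf θ0 ρ') :=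
    mul_le_mul_of_nonneg_left (by linarith) (abs_nonneg _)
  linarith

lemma abs_cosOf_sub_le (hθ : 0 < sin θ0) (h0 : 0 ≤ ρ) (h1 : ρ ≤ 1) (h0' : 0 ≤ ρ')
    (h1' : ρ' ≤ 1) (he : 1 - ρ ≤ ε) (he' : 1 - ρ' ≤ ε) :
    |cosOf θ0 ρ - cosOf θ0 ρ'| ≤ 2 * ε / sin θ0 ^ 2 * |ρ - ρ'| := by
  have h3 := sq_sinOf (θ0 := θ0) h0 h1
  have h3' := sq_sinOf (θ0 := θ0) h0' h1'
  have h4 := le_sinOf (θ0 := θ0) h0 h1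
  have h4' := le_sinOf (θ0 := θ0) h0' h1'
  have hsc := sin_sq_add_cos_sq θ0
  have hk : cos θ0 ^ 2 ≤ 1 := by nlinarith [sq_nonneg (sin θ0)]
  set S := sinOf θ0 ρ
  set S' := sinOf θ0 ρ'
  set σ := sin θ0
  set k := cos θ0
  have hb : ∀ {T r : ℝ}, 0 ≤ r → r ≤ 1 → T ^ 2 = 1 - r ^ 2 * k ^ 2 → σ ≤ T → 1 - r ≤ ε →
      0 ≤ T - σ * r ∧ (T - σ * r) * σ ≤ 2 * ε := by
    intro T r hr0 hr1 hT hT' hr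
    have e : (T - σ * r) * (T + σ * r) = 1 - r ^ 2 := by
      linear_combination hT - r ^ 2 * hsc
    have p : 0 < T + σ * r := by have := mul_nonneg hθ.le hr0; linarith
    have q : 0 ≤ T - σ * r := by
      nlinarith [mul_nonneg hθ.le (sub_nonneg.2 hr1)]
    refine ⟨q, ?_⟩
    have : (T - σ * r) * σ ≤ (T - σ * r) * (T + σ * r) :=
      mul_le_mul_of_nonneg_left (by nlinarith) q
    nlinarith
  obtain ⟨a1, a2⟩ := hb h0 h1 h3 h4 he
  obtain ⟨b1, b2⟩ := hb h0' h1' h3' h4' he'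
  have key : (cosOf θ0 ρ - cosOf θ0 ρ') * (S + S')
      = (ρ - ρ') * (k ^ 2 * ((S - σ * ρ) + (S' - σ * ρ'))) := by
    simp only [cosOf]
    linear_combination σ * h3 - σ * h3'
  have hp : 0 < S + S' := by linarith
  have key2 : |cosOf θ0 ρ - cosOf θ0 ρ'| * (S + S')
      = |ρ - ρ'| * (k ^ 2 * ((S - σ * ρ) + (S' - σ * ρ'))) := by
    have := congrArg abs key
    rwa [abs_mul, abs_mul, abs_of_pos hp, abs_of_nonneg
      (by positivity : 0 ≤ k ^ 2 * ((S - σ * ρ) + (S' - σ * ρ')))] at this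
  have h5 : k ^ 2 * ((S - σ * ρ) + (S' - σ * ρ')) ≤ (S - σ * ρ) + (S' - σ * ρ') := by
    nlinarith
  rw [div_mul_eq_mul_div, le_div_iff₀ (by positivity)]
  have h6 : |cosOf θ0 ρ - cosOf θ0 ρ'| * (2 * σ) ≤
      |ρ - ρ'| * ((S - σ * ρ) + (S' - σ * ρ')) := by
    calc _ ≤ |cosOf θ0 ρ - cosOf θ0 ρ'| * (S + S') :=
          mul_le_mul_of_nonneg_left (by linarith) (abs_nonneg _)
      _ ≤ _ := by rw [key2]; exact mul_le_mul_of_nonneg_left h5 (abs_nonneg _)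
  have h7 : |ρ - ρ'| * (((S - σ * ρ) + (S' - σ * ρ')) * σ) ≤ |ρ - ρ'| * (4 * ε) :=
    mul_le_mul_of_nonneg_left (by linarith) (abs_nonneg _)
  nlinarith

end Trig

section Ratio

variable {A A' E E' : ℝ}

lemma ratio_nonneg (hA : 0 ≤ A) (hE : 0 ≤ E) : 0 ≤ ratio A E :=
  div_nonneg (le_min hE hA) hE

lemma ratio_le_one (hE : 0 ≤ E) : ratio A E ≤ 1 :=
  div_le_one_of_le₀ (min_le_left _ _) hE

lemma one_sub_ratio_le (hE : 0 < E) {b : ℝ} (hb : 0 ≤ b) (h : E - A ≤ b) :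
    1 - ratio A E ≤ b / E := by
  rw [ratio, one_sub_div hE.ne']
  gcongr
  rcases min_cases E A with h' | h' <;> linarith

lemma abs_ratio_sub_le (hA : 0 ≤ A) (hE : 0 < E) (hE' : 0 < E') :
    |ratio A E - ratio A' E'| ≤ (|A - A'| + 2 * |E - E'|) / E' := by
  have e : ratio A E - ratio A' E'
      = ((min E A - min E' A') + ratio A E * (E' - E)) / E' := by
    unfold ratio; field_simp; ring
  rw [e, abs_div, abs_of_pos hE']
  gcongr
  have h1 : |min E A - min E' A'| ≤ |E - E'| + |A - A'| :=
    (abs_min_sub_min_le_max _ _ _ _).trans (max_le_add_of_nonneg (abs_nonneg _) (abs_nonneg _))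
  have h2 : |ratio A E * (E' - E)| ≤ |E - E'| := by
    rw [abs_mul, abs_sub_comm E' E, abs_of_nonneg (ratio_nonneg hA hE.le)]
    exact mul_le_of_le_one_left (abs_nonneg _) (ratio_le_one hE.le)
  linarith [abs_add_le (min E A - min E' A') (ratio A E * (E' - E))]

end Ratio

section Capt

variable {x x' s : ℝ}

lemma ell_nonneg : 0 ≤ ell x s := le_max_left _ _

lemma ell_eq_zero (hs : 0 < s) (hx : 0 ≤ x) (h : x ≤ s) : ell x s = 0 :=
  max_eq_left (log_nonpos (by positivity) (div_le_one_of_le₀ h hs.le))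

lemma le_ell (hx : 0 < x) (hs : 0 < s) (hx1 : x ≤ 1) : x - s ≤ ell x s := by
  rcases le_or_gt x s with h | h
  · exact (sub_nonpos.2 h).trans ell_nonneg
  refine le_trans ?_ (le_max_right _ _)
  have := one_sub_inv_le_log_of_pos (div_pos hx hs)
  rw [inv_div] at this
  refine le_trans ?_ this
  have h2 : s / x ≤ 1 := div_le_one_of_le₀ h.le hx.le
  have : x - s = x * (1 - s / x) := by field_simp
  rw [this]
  exact mul_le_of_le_one_left (by linarith) hx1

lemma ell_mono (hs : 0 < s) (hx : 0 < x) (h : x ≤ x') : ell x s ≤ ell x' s :=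
  max_le_max le_rfl (log_le_log (by positivity) (by gcongr))

lemma abs_ell_sub_le (hs : 0 < s) (hx : 1 / 2 ≤ x) (hx' : 1 / 2 ≤ x') :
    |ell x s - ell x' s| ≤ 2 * |x - x'| := by
  have key : ∀ {a b : ℝ}, 1 / 2 ≤ a → a ≤ b → |ell b s - ell a s| ≤ 2 * |b - a| := by
    intro a b ha hab
    have ha0 : 0 < a := by linarith
    have hb0 : 0 < b := by linarith
    refine (abs_max_sub_max_le_max _ _ _ _).trans (max_le (by simp) ?_)
    rw [log_div hb0.ne' hs.ne', log_div ha0.ne' hs.ne', sub_sub_sub_cancel_right,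
      ← log_div hb0.ne' ha0.ne',
      abs_of_nonneg (log_nonneg ((one_le_div ha0).2 hab)), abs_of_nonneg (sub_nonneg.2 hab)]
    have := log_le_sub_one_of_pos (div_pos hb0 ha0)
    refine this.trans ?_
    rw [div_sub_one ha0.ne', div_le_iff₀ ha0]
    nlinarith
  rcases le_total x x' with h | h
  · rw [abs_sub_comm, abs_sub_comm x]; exact key hx h
  · exact key hx' h

lemma capt_sub_capt_le (hs : 0 < s) (h : x ≤ x') :
    capt x' s - capt x s ≤ (1 - s / max x' s) * (x' - x) ∧ 0 ≤ capt x' s - capt x s := by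
  have hm : s ≤ max x s := le_max_right _ _
  have hm' : max x s ≤ max x' s := max_le_max h le_rfl
  have hmx : max x' s - max x s ≤ x' - x := by
    rcases max_cases x s with ⟨a, b⟩ | ⟨a, b⟩ <;> rcases max_cases x' s with ⟨c, d⟩ | ⟨c, d⟩ <;>
      linarith
  have hs' : s ≤ max x' s := le_max_right _ _
  unfold capt
  set m := max x s
  set m' := max x' s
  have h0 : 0 < m := by linarith
  have h0' : 0 < m' := by linarith
  have e : m' - s - s * log (m' / s) - (m - s - s * log (m / s))
      = (m' - m) - s * log (m' / m) := by
    rw [log_div h0'.ne' hs.ne', log_div h0.ne' hs.ne', log_div h0'.ne' h0.ne']; ring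
  rw [e]
  have l1 := one_sub_inv_le_log_of_pos (div_pos h0' h0)
  have l2 := log_le_sub_one_of_pos (div_pos h0' h0)
  rw [inv_div] at l1
  constructor
  · have h1 : s * (1 - m / m') ≤ s * log (m' / m) := mul_le_mul_of_nonneg_left l1 hs.le
    have h2 : s * (1 - m / m') = s / m' * (m' - m) := by field_simp
    have h3 : 0 ≤ 1 - s / m' := sub_nonneg.2 (div_le_one_of_le₀ hs' h0'.le)
    nlinarith [mul_le_mul_of_nonneg_left hmx h3]
  · have h1 : s * log (m' / m) ≤ s * (m' / m - 1) := mul_le_mul_of_nonneg_left l2 hs.le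
    have h2 : s * (m' / m - 1) = s / m * (m' - m) := by field_simp
    have h3 : s / m ≤ 1 := div_le_one_of_le₀ hm h0.le
    nlinarith [mul_le_mul_of_nonneg_right h3 (sub_nonneg.2 hm')]

lemma capt_self (hs : 0 < s) : capt s s = 0 := by simp [capt, hs.ne']

lemma capt_eq_zero (hs : 0 < s) (h : x ≤ s) : capt x s = 0 := by
  simp [capt, max_eq_right h, hs.ne']

lemma capt_nonneg (hs : 0 < s) : 0 ≤ capt x s := by
  rcases le_total x s with h | h
  · rw [capt_eq_zero hs h]
  · have := (capt_sub_capt_le hs h).2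
    rwa [capt_self hs, sub_zero] at this

lemma abs_capt_sub_le (hs : 0 < s) {w : ℝ} (hw : 1 / 2 ≤ w) (hsw : s ≤ w) (hx : x ≤ w)
    (hx' : x' ≤ w) : |capt x s - capt x' s| ≤ 2 * (w - s) * |x - x'| := by
  have key : ∀ {a b : ℝ}, b ≤ w → a ≤ b → |capt b s - capt a s| ≤ 2 * (w - s) * |b - a| := by
    intro a b hb hab
    obtain ⟨h1, h2⟩ := capt_sub_capt_le hs hab
    rw [abs_of_nonneg h2, abs_of_nonneg (sub_nonneg.2 hab)]
    refine h1.trans (mul_le_mul_of_nonneg_right ?_ (sub_nonneg.2 hab))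
    have h3 : s / w ≤ s / max b s := by
      have : max b s ≤ w := max_le hb hsw
      have : 0 < max b s := lt_max_of_lt_right hs
      gcongr
    have h4 : 1 - s / w ≤ 2 * (w - s) := by
      rw [one_sub_div (by linarith), div_le_iff₀ (by linarith)]
      nlinarith
    linarith
  rcases le_total x x' with h | h
  · rw [abs_sub_comm, abs_sub_comm x]; exact key hx' h
  · exact key hx h

lemma capt_le_sq (hs : 0 < s) (hx : 1 / 2 ≤ x) (hsx : s ≤ x) : capt x s ≤ 2 * (x - s) ^ 2 := by
  have := abs_capt_sub_le hs hx hsx le_rfl hsx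
  rw [capt_self hs, sub_zero, abs_of_nonneg (capt_nonneg hs),
    abs_of_nonneg (sub_nonneg.2 hsx)] at this
  linarith

lemma integral_ell {w : ℝ} (hs : 0 < s) (hsw : s ≤ w) :
    ∫ r in s..w, ell w r = capt w s := by
  have hw : 0 < w := hs.trans_le hsw
  have : ∫ r in s..w, ell w r = ∫ r in s..w, (log w - log r) := by
    refine intervalIntegral.integral_congr fun r hr => ?_
    rw [Set.uIcc_of_le hsw] at hr
    have hr0 : 0 < r := hs.trans_le hr.1
    simp only [ell]
    rw [max_eq_right (log_nonneg ((one_le_div hr0).2 hr.2)), log_div hw.ne' hr0.ne']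
  rw [this, intervalIntegral.integral_sub (by simp) (by simp), integral_log,
    intervalIntegral.integral_const, capt, max_eq_left hsw, log_div hw.ne' hs.ne', smul_eq_mul]
  ring

lemma ell_le_rpow {ν : ℝ} (hν : 0 < ν) (hs : 0 < s) (hx : 0 < x) (hx1 : x ≤ 1) {w : ℝ}
    (hxw : x ≤ w) (hw : 3 / 4 ≤ w) (hsw : s ≤ w) (hs1 : s ≤ 1) :
    ell x s ≤ (4 + 2 / ν) * (w - s) * s ^ (-ν) := by
  have h1 : 1 ≤ s ^ (-ν) := one_le_rpow_of_pos_of_le_one_of_nonpos hs hs1 (by linarith)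
  have hk : 0 ≤ 2 / ν := by positivity
  refine max_le (by have := sub_nonneg.2 hsw; positivity) ?_
  rcases le_or_gt (1 / 4) s with h | h
  · have h2 : log (x / s) ≤ 4 * (w - s) := by
      refine (log_le_sub_one_of_pos (by positivity)).trans ?_
      rw [div_sub_one hs.ne', div_le_iff₀ hs]
      nlinarith
    have h3 : 0 ≤ (w - s) := sub_nonneg.2 hsw
    calc log (x / s) ≤ 4 * (w - s) * 1 := by linarith
      _ ≤ (4 + 2 / ν) * (w - s) * s ^ (-ν) := by gcongr; linarith
  · have h2 : log (x / s) ≤ s ^ (-ν) / ν := by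
      calc log (x / s) ≤ log s⁻¹ := by
            refine log_le_log (by positivity) ?_
            rw [inv_eq_one_div]; gcongr
        _ ≤ s⁻¹ ^ ν / ν := log_le_rpow_div (by positivity) hν
        _ = s ^ (-ν) / ν := by rw [rpow_neg hs.le, inv_rpow hs.le]
    refine h2.trans ?_
    have h3 : 1 / ν ≤ (4 + 2 / ν) * (w - s) := by
      have e : 2 / ν = 2 * (1 / ν) := by ring
      have : 0 < 1 / ν := by positivity
      rw [e]; nlinarith
    calc s ^ (-ν) / ν = 1 / ν * s ^ (-ν) := by ring
      _ ≤ _ := by gcongr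

end Capt

open Set

/-! ### Solutions of the optimality system -/

section

/-- A bounded monotone light intensity, close to `1`, with slope at most `C y ^ (-β)`. -/
structure Light (C β δ : ℝ) (I : ℝ → ℝ) : Prop where
  mono : Monotone I
  cont : Continuous I
  le_one : ∀ y, I y ≤ 1
  ge : ∀ y, 1 - δ ≤ I y
  slope : ∀ a b, 0 < a → a ≤ b → I b - I a ≤ C * a ^ (-β) * (b - a)

/-- The optimality system, with the multiplier as independent variable: `y` is the height and
`E` the transport cost at the point where the multiplier equals `s`. -/
structure Profile (θ0 κ γ : ℝ) (I y E : ℝ → ℝ) : Prop where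
  E_nonneg : ∀ s ∈ Icc (0 : ℝ) 1, 0 ≤ E s
  y_cont : ContinuousOn y (Icc 0 1)
  y_int : IntervalIntegrable
    (fun r => κ * sinOf θ0 (ratio (capt (I (y r)) r) (E r)) * E r ^ γ) volume 0 1
  E_int : IntervalIntegrable
    (fun r => cosOf θ0 (ratio (capt (I (y r)) r) (E r)) * ell (I (y r)) r) volume 0 1
  y_eq : ∀ s ∈ Icc (0 : ℝ) 1,
    y s = ∫ r in (0 : ℝ)..s, κ * sinOf θ0 (ratio (capt (I (y r)) r) (E r)) * E r ^ γ
  E_eq : ∀ s ∈ Icc (0 : ℝ) 1,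
    E s = ∫ r in s..1, cosOf θ0 (ratio (capt (I (y r)) r) (E r)) * ell (I (y r)) r

/-- The ranges of the parameters. -/
structure Params (θ0 κ γ C β : ℝ) : Prop where
  sin_pos : 0 < sin θ0
  κ_pos : 0 < κ
  γ_pos : 0 < γ
  C_pos : 0 < C
  β_pos : 0 < β
  β_lt : β < 1

lemma _root_.IntervalIntegrable.mono_Icc {f : ℝ → ℝ} {a b c d : ℝ}
    (h : IntervalIntegrable f volume a b) (hab : a ≤ b) (hc : c ∈ Icc a b) (hd : d ∈ Icc a b) :
    IntervalIntegrable f volume c d :=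
  h.mono_set (by rw [uIcc_of_le hab]; exact uIcc_subset_Icc hc hd)

namespace Profile

variable {θ0 κ γ C β δ s r : ℝ} {I y E : ℝ → ℝ}

lemma ratio_mem (h : Profile θ0 κ γ I y E) (hs : 0 < s) (hs1 : s ≤ 1) :
    0 ≤ ratio (capt (I (y s)) s) (E s) ∧ ratio (capt (I (y s)) s) (E s) ≤ 1 :=
  ⟨ratio_nonneg (capt_nonneg hs) (h.E_nonneg s ⟨hs.le, hs1⟩),
    ratio_le_one (h.E_nonneg s ⟨hs.le, hs1⟩)⟩

lemma y_sub (h : Profile θ0 κ γ I y E) (hr : r ∈ Icc (0 : ℝ) 1) (hs : s ∈ Icc (0 : ℝ) 1) :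
    y s - y r = ∫ t in r..s, κ * sinOf θ0 (ratio (capt (I (y t)) t) (E t)) * E t ^ γ := by
  have z : (0 : ℝ) ∈ Icc (0 : ℝ) 1 := by simp
  rw [h.y_eq s hs, h.y_eq r hr, intervalIntegral.integral_interval_sub_left]
  · exact h.y_int.mono_Icc zero_le_one z hs
  · exact h.y_int.mono_Icc zero_le_one z hr

lemma y_slope (h : Profile θ0 κ γ I y E) (P : Params θ0 κ γ C β) {e : ℝ} (he : 0 ≤ e)
    (hr : 0 ≤ r) (hrs : r ≤ s) (hs : s ≤ 1) (hE : ∀ t ∈ Icc r s, e ≤ E t) :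
    κ * sin θ0 * e ^ γ * (s - r) ≤ y s - y r := by
  rw [h.y_sub ⟨hr, hrs.trans hs⟩ ⟨hr.trans hrs, hs⟩]
  have : ∫ t in r..s, κ * sin θ0 * e ^ γ = κ * sin θ0 * e ^ γ * (s - r) := by simp; ring
  rw [← this]
  refine intervalIntegral.integral_mono_on_of_le_Ioo hrs (by simp)
    (h.y_int.mono_Icc zero_le_one ⟨hr, hrs.trans hs⟩ ⟨hr.trans hrs, hs⟩) fun t ht => ?_
  have ht0 : 0 < t := hr.trans_lt ht.1
  have ht1 : t ≤ 1 := ht.2.le.trans hs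
  obtain ⟨h0, h1⟩ := h.ratio_mem ht0 ht1
  have := P.κ_pos
  have := P.sin_pos
  have := P.γ_pos
  have := le_sinOf (θ0 := θ0) h0 h1
  have := hE t ⟨ht.1.le, ht.2.le⟩
  have := mul_nonneg P.κ_pos.le (sinOf_nonneg (θ0 := θ0) (ρ := ratio (capt (I (y t)) t) (E t)))
  gcongr

lemma y_mono (h : Profile θ0 κ γ I y E) (P : Params θ0 κ γ C β) (hr : 0 ≤ r) (hrs : r ≤ s)
    (hs : s ≤ 1) : y r ≤ y s := by
  have := h.y_slope P le_rfl hr hrs hs fun t ht => h.E_nonneg t ⟨hr.trans ht.1, ht.2.trans hs⟩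
  rw [zero_rpow P.γ_pos.ne'] at this
  linarith

lemma E_le_of_le (h : Profile θ0 κ γ I y E) (P : Params θ0 κ γ C β) {v : ℝ} (hr : 0 ≤ r)
    (hrs : r ≤ s) (hs : s ≤ 1) (hv : s ≤ v) (hv1 : v ≤ 1)
    (hL : ∀ t ∈ Ioo s v, v ≤ I (y t)) (hI0 : ∀ t, 0 < I t) (hI : ∀ t, I t ≤ 1) :
    sin θ0 / 2 * (v - s) ^ 2 ≤ E r := by
  have hs0 := hr.trans hrs
  have hF0 : ∀ t, 0 < t → t ≤ 1 →
      0 ≤ cosOf θ0 (ratio (capt (I (y t)) t) (E t)) * ell (I (y t)) t := fun t h0 h1 =>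
    mul_nonneg (P.sin_pos.le.trans (le_cosOf (h.ratio_mem h0 h1).1 (h.ratio_mem h0 h1).2))
      ell_nonneg
  have i1 := h.E_int.mono_Icc zero_le_one ⟨hr, hrs.trans hs⟩ ⟨hs0, hs⟩
  have i2 := h.E_int.mono_Icc zero_le_one ⟨hs0, hs⟩ ⟨hs0.trans hv, hv1⟩
  have i3 := h.E_int.mono_Icc zero_le_one ⟨hs0.trans hv, hv1⟩ ⟨zero_le_one, le_rfl⟩
  rw [h.E_eq r ⟨hr, hrs.trans hs⟩,
    ← intervalIntegral.integral_add_adjacent_intervals (i1.trans i2) i3,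
    ← intervalIntegral.integral_add_adjacent_intervals i1 i2]
  have j1 : 0 ≤ ∫ t in r..s, cosOf θ0 (ratio (capt (I (y t)) t) (E t)) * ell (I (y t)) t := by
    have := intervalIntegral.integral_mono_on_of_le_Ioo hrs (f := fun _ => (0 : ℝ)) (by simp) i1
      fun t ht => hF0 t (hr.trans_lt ht.1) (ht.2.le.trans hs)
    simpa using this
  have j3 : 0 ≤ ∫ t in v..1, cosOf θ0 (ratio (capt (I (y t)) t) (E t)) * ell (I (y t)) t := by
    have := intervalIntegral.integral_mono_on_of_le_Ioo hv1 (f := fun _ => (0 : ℝ)) (by simp) i3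
      fun t ht => hF0 t ((hs0.trans hv).trans_lt ht.1) ht.2.le
    simpa using this
  have j2 : ∫ t in s..v, sin θ0 * (v - t) = sin θ0 / 2 * (v - s) ^ 2 := by
    rw [intervalIntegral.integral_const_mul, intervalIntegral.integral_sub (by simp) (by simp)]
    simp; ring
  have j4 : ∫ t in s..v, sin θ0 * (v - t) ≤
      ∫ t in s..v, cosOf θ0 (ratio (capt (I (y t)) t) (E t)) * ell (I (y t)) t := by
    refine intervalIntegral.integral_mono_on_of_le_Ioo hv
      (Continuous.intervalIntegrable (by fun_prop) _ _) i2 fun t ht => ?_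
    have ht0 : 0 < t := hs0.trans_lt ht.1
    have ht1 : t ≤ 1 := ht.2.le.trans hv1
    have a1 := hL t ht
    have a2 := le_ell (hI0 (y t)) ht0 (hI (y t))
    have a3 := le_cosOf (θ0 := θ0) (h.ratio_mem ht0 ht1).1 (h.ratio_mem ht0 ht1).2
    have := P.sin_pos
    have : 0 ≤ v - t := by linarith [ht.2]
    have : v - t ≤ ell (I (y t)) t := by linarith
    have := P.sin_pos.le.trans a3
    gcongr
  linarith

variable (h : Profile θ0 κ γ I y E) (P : Params θ0 κ γ C β) (L : Light C β δ I)
include h P L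

lemma I_le (hs : s ∈ Icc (0 : ℝ) 1) : I (y s) ≤ I (y 1) := L.mono (h.y_mono P hs.1 hs.2 le_rfl)

lemma E_le_capt (hδ : δ ≤ 1 / 4) (hs : 0 < s) (hsw : s ≤ I (y 1)) :
    E s ≤ capt (I (y 1)) s := by
  have hw := L.ge (y 1)
  have hw1 := L.le_one (y 1)
  have hw0 : 0 < I (y 1) := by linarith
  have key : ∀ t, 0 < t → t ≤ 1 →
      cosOf θ0 (ratio (capt (I (y t)) t) (E t)) * ell (I (y t)) t ≤ ell (I (y 1)) t := by
    intro t h0 h1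
    have a1 := cosOf_le_one (θ0 := θ0) (h.ratio_mem h0 h1).1 (h.ratio_mem h0 h1).2
    have a2 : ell (I (y t)) t ≤ ell (I (y 1)) t :=
      ell_mono h0 (by linarith [L.ge (y t)]) (h.I_le P L ⟨h0.le, h1⟩)
    calc _ ≤ 1 * ell (I (y t)) t := by gcongr; exact ell_nonneg
      _ ≤ _ := by linarith
  have hI : IntervalIntegrable (fun t => ell (I (y 1)) t) volume s 1 := by
    refine ContinuousOn.intervalIntegrable_of_Icc (hsw.trans hw1) fun t ht => ?_
    have : 0 < t := hs.trans_le ht.1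
    have h1 : I (y 1) / t ≠ 0 := by positivity
    have : ContinuousAt (fun t => ell (I (y 1)) t) t := by
      unfold ell
      have : ContinuousAt (fun t => I (y 1) / t) t :=
        continuousAt_const.div continuousAt_id this.ne'
      exact continuousAt_const.max (this.log h1)
    exact this.continuousWithinAt
  rw [h.E_eq s ⟨hs.le, hsw.trans hw1⟩, ← integral_ell hs hsw]
  have e2 : ∫ t in I (y 1)..1, ell (I (y 1)) t = 0 := by
    rw [intervalIntegral.integral_congr (g := fun _ => (0 : ℝ))]
    · simp
    intro t ht
    rw [uIcc_of_le hw1] at ht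
    exact ell_eq_zero (hw0.trans_le ht.1) hw0.le ht.1
  have : ∫ t in s..1, ell (I (y 1)) t = ∫ t in s..I (y 1), ell (I (y 1)) t := by
    rw [← intervalIntegral.integral_add_adjacent_intervals (b := I (y 1)), e2, add_zero]
    · exact hI.mono_Icc (hsw.trans hw1) ⟨le_rfl, hsw.trans hw1⟩ ⟨hsw, hw1⟩
    · exact hI.mono_Icc (hsw.trans hw1) ⟨hsw, hw1⟩ ⟨hsw.trans hw1, le_rfl⟩
  rw [← this]
  exact intervalIntegral.integral_mono_on_of_le_Ioo (hsw.trans hw1)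
    (h.E_int.mono_Icc zero_le_one ⟨hs.le, hsw.trans hw1⟩ ⟨zero_le_one, le_rfl⟩) hI
    fun t ht => key t (hs.trans ht.1) ht.2.le

lemma E_eq_zero (hδ : δ ≤ 1 / 4) (hsw : I (y 1) ≤ s) (hs1 : s ≤ 1) : E s = 0 := by
  have hw := L.ge (y 1)
  have hs : 0 < s := by linarith
  rw [h.E_eq s ⟨hs.le, hs1⟩, intervalIntegral.integral_congr (g := fun _ => (0 : ℝ))]
  · simp
  intro t ht
  rw [uIcc_of_le hs1] at ht
  have ht0 := hs.trans_le ht.1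
  have := h.I_le P L ⟨ht0.le, ht.2⟩
  simp only
  rw [ell_eq_zero ht0 (by linarith [L.ge (y t)]) (by linarith [ht.1]), mul_zero]

lemma E_le_sq (hδ : δ ≤ 1 / 4) (hs : 0 < s) (hsw : s ≤ I (y 1)) :
    E s ≤ 2 * (I (y 1) - s) ^ 2 :=
  (h.E_le_capt P L hδ hs hsw).trans (capt_le_sq hs (by linarith [L.ge (y 1)]) hsw)

lemma le_E (hδ : δ ≤ 1 / 4) {v : ℝ} (hr : 0 ≤ r) (hrs : r ≤ s) (hv : s ≤ v)
    (hv1 : v ≤ I (y s)) : sin θ0 / 2 * (v - s) ^ 2 ≤ E r := by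
  have := L.le_one (y s)
  exact h.E_le_of_le P hr hrs (by linarith) hv (by linarith)
    (fun t ht => hv1.trans (L.mono (h.y_mono P (hr.trans hrs) ht.1.le (by linarith [ht.2]))))
    (fun t => by linarith [L.ge t]) L.le_one

lemma le_E_of_le_quarter (hδ : δ ≤ 1 / 4) (hr : 0 ≤ r) (hr' : r ≤ 1 / 4) : sin θ0 / 8 ≤ E r := by
  have := h.le_E P L hδ (v := 3 / 4) hr hr' (by norm_num) (by linarith [L.ge (y (1 / 4))])
  linarith

lemma le_y (hδ : δ ≤ 1 / 4) (hs : s ∈ Icc (0 : ℝ) 1) :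
    κ * sin θ0 * (sin θ0 / 8) ^ γ / 4 * s ≤ y s := by
  have hK : 0 ≤ κ * sin θ0 * (sin θ0 / 8) ^ γ := by
    have := P.κ_pos; have := P.sin_pos; positivity
  have y0 : y 0 = 0 := by rw [h.y_eq 0 (by simp)]; simp
  have key : ∀ t ∈ Icc (0 : ℝ) (1 / 4), κ * sin θ0 * (sin θ0 / 8) ^ γ * t ≤ y t := by
    intro t ht
    have := h.y_slope P (by have := P.sin_pos; positivity) le_rfl ht.1 (by linarith [ht.2])
      fun t' ht' => h.le_E_of_le_quarter P L hδ ht'.1 (ht'.2.trans ht.2)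
    simpa [y0] using this
  rcases le_total s (1 / 4) with hs' | hs'
  · refine le_trans ?_ (key s ⟨hs.1, hs'⟩)
    nlinarith [mul_nonneg hK hs.1]
  · have a1 := key (1 / 4) ⟨by norm_num, le_rfl⟩
    have a2 := h.y_mono P (by norm_num) hs' hs.2
    nlinarith [mul_nonneg hK (sub_nonneg.2 hs.2)]

end Profile

end

/-! ### The light deficit near the tip -/

section

lemma integral_abs_sub_comp_le {f y₁ y₂ : ℝ → ℝ} {lo δ m η S : ℝ} (hf : Monotone f)
    (hlo : ∀ t, lo ≤ f t) (hhi : ∀ t, f t ≤ lo + δ) (hm : 0 < m) (hη : 0 ≤ η) (hS : 0 ≤ S)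
    (hy : ∀ r s, 0 ≤ r → r ≤ s → s ≤ S → m * (s - r) ≤ y₁ s - y₁ r)
    (hd : ∀ s ∈ Icc 0 S, |y₁ s - y₂ s| ≤ η)
    (hi : IntervalIntegrable (fun s => |f (y₁ s) - f (y₂ s)|) volume 0 S) :
    ∫ s in (0 : ℝ)..S, |f (y₁ s) - f (y₂ s)| ≤ 2 * (η / m) * δ := by
  set a := η / m with ha
  have ha0 : 0 ≤ a := by positivity
  have ham : m * a = η := by rw [ha]; field_simp
  set F : ℝ → ℝ := fun s => if s < 0 then lo else if s ≤ S then f (y₁ s) else lo + δ with hF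
  have hFlo : ∀ s, lo ≤ F s := by
    intro s; simp only [hF]; split_ifs <;> linarith [hlo (y₁ s), hhi (y₁ s)]
  have hFhi : ∀ s, F s ≤ lo + δ := by
    intro s; simp only [hF]; split_ifs <;> linarith [hlo (y₁ s), hhi (y₁ s)]
  have hFm : Monotone F := by
    intro r s hrs
    rcases lt_or_ge r 0 with h0 | h0
    · have : F r = lo := by simp [hF, h0]
      rw [this]; exact hFlo s
    rcases le_or_gt s S with h1 | h1
    · have e1 : F r = f (y₁ r) := by simp [hF, h0.not_gt, hrs.trans h1]
      have e2 : F s = f (y₁ s) := by simp [hF, (h0.trans hrs).not_gt, h1]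
      rw [e1, e2]
      apply hf
      have := hy r s h0 hrs h1
      have := mul_nonneg hm.le (sub_nonneg.2 hrs)
      linarith
    · have : F s = lo + δ := by simp [hF, h1.not_ge, (h0.trans hrs).not_gt]
      rw [this]; exact hFhi r
  have hup : ∀ s ∈ Icc 0 S, ∀ t, t ≤ y₁ s + η → f t ≤ F (s + a) := by
    intro s hs t ht
    rcases le_or_gt (s + a) S with h1 | h1
    · have h0 : 0 ≤ s + a := by linarith [hs.1]
      have e : F (s + a) = f (y₁ (s + a)) := by simp [hF, h0.not_gt, h1]
      rw [e]
      apply hf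
      have := hy s (s + a) hs.1 (by linarith) h1
      rw [add_sub_cancel_left, ham] at this
      linarith
    · have h0 : 0 ≤ s + a := by linarith
      have : F (s + a) = lo + δ := by simp [hF, h1.not_ge, h0.not_gt]
      rw [this]; exact hhi t
  have hdn : ∀ s ∈ Icc 0 S, ∀ t, y₁ s - η ≤ t → F (s - a) ≤ f t := by
    intro s hs t ht
    rcases lt_or_ge (s - a) 0 with h1 | h1
    · have : F (s - a) = lo := by simp [hF, h1]
      rw [this]; exact hlo t
    · have h2 : s - a ≤ S := by linarith [hs.2]
      have e : F (s - a) = f (y₁ (s - a)) := by simp [hF, h1.not_gt, h2]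
      rw [e]
      apply hf
      have := hy (s - a) s h1 (by linarith) hs.2
      rw [sub_sub_cancel, ham] at this
      linarith
  have hFi : ∀ p q, IntervalIntegrable F volume p q := fun p q => hFm.intervalIntegrable
  have hF1 : IntervalIntegrable (fun s => F (s + a)) volume 0 S :=
    (hFm.comp (monotone_id.add_const a)).intervalIntegrable
  have hF2 : IntervalIntegrable (fun s => F (s - a)) volume 0 S :=
    Monotone.intervalIntegrable fun r s hrs => hFm (by linarith)
  have step : ∫ s in (0 : ℝ)..S, |f (y₁ s) - f (y₂ s)| ≤
      ∫ s in (0 : ℝ)..S, (F (s + a) - F (s - a)) := by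
    refine intervalIntegral.integral_mono_on hS hi (hF1.sub hF2) fun s hs => ?_
    have h := abs_le.1 (hd s hs)
    have a1 := hup s hs (y₁ s) (by linarith)
    have a2 := hup s hs (y₂ s) (by linarith [h.1])
    have a3 := hdn s hs (y₁ s) (by linarith)
    have a4 := hdn s hs (y₂ s) (by linarith [h.2])
    exact abs_le.2 ⟨by linarith, by linarith⟩
  refine step.trans ?_
  rw [intervalIntegral.integral_sub hF1 hF2, intervalIntegral.integral_comp_add_right,
    intervalIntegral.integral_comp_sub_right,
    intervalIntegral.integral_interval_sub_interval_comm' (hFi _ _) (hFi _ _) (hFi _ _)]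
  have b1 : ∫ s in (S - a)..(S + a), F s ≤ ∫ s in (S - a)..(S + a), (lo + δ) :=
    intervalIntegral.integral_mono_on (by linarith) (hFi _ _) (by simp) fun s _ => hFhi s
  have b2 : ∫ s in (0 - a)..(0 + a), lo ≤ ∫ s in (0 - a)..(0 + a), F s :=
    intervalIntegral.integral_mono_on (by linarith) (by simp) (hFi _ _) fun s _ => hFlo s
  simp only [intervalIntegral.integral_const, smul_eq_mul] at b1 b2
  linarith

namespace Profile

variable {θ0 κ γ C β : ℝ}

/-- Near the end of the profile the intensity is almost maximal. -/
lemma exists_deficit_le (P : Params θ0 κ γ C β) : ∃ K > 0, ∀ (δ : ℝ) (I y E : ℝ → ℝ),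
    δ ≤ 1 / 4 → Light C β δ I → Profile θ0 κ γ I y E → ∀ s, 1 / 4 ≤ s → s ≤ I (y 1) →
      I (y 1) - I (y s) ≤ K * ((I (y 1) - s) ^ (2 * γ) * (I (y 1) - s)) := by
  obtain ⟨hs0, hκ, hγ, hC, hβ, hβ1⟩ := P
  have P : Params θ0 κ γ C β := ⟨hs0, hκ, hγ, hC, hβ, hβ1⟩
  set b := κ * sin θ0 * (sin θ0 / 8) ^ γ / 4 * (1 / 4) with hb
  have hb0 : 0 < b := by positivity
  refine ⟨C * b ^ (-β) * (κ * 2 ^ γ), by positivity, fun δ I y E hδ L h s hs hsw => ?_⟩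
  have hw1 := L.le_one (y 1)
  have hs1 : s ≤ 1 := hsw.trans hw1
  have hs00 : 0 < s := by linarith
  have hbs : b ≤ y s := by
    refine le_trans ?_ (h.le_y P L hδ ⟨hs00.le, hs1⟩)
    rw [hb]; gcongr
  have hym := h.y_mono P hs00.le hs1 le_rfl
  have h1 := L.slope (y s) (y 1) (hb0.trans_le hbs) hym
  have h2 : (y s) ^ (-β) ≤ b ^ (-β) := rpow_le_rpow_of_nonpos hb0 hbs (by linarith)
  set x := I (y 1) - s with hx
  have hx0 : 0 ≤ x := by linarith
  have h3 : y 1 - y s ≤ κ * 2 ^ γ * (x ^ (2 * γ) * x) := by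
    rw [h.y_sub ⟨hs00.le, hs1⟩ (by simp)]
    have i1 := h.y_int.mono_Icc zero_le_one ⟨hs00.le, hs1⟩ ⟨hs00.le.trans hsw, hw1⟩
    have i2 := h.y_int.mono_Icc zero_le_one ⟨hs00.le.trans hsw, hw1⟩ ⟨zero_le_one, le_rfl⟩
    rw [← intervalIntegral.integral_add_adjacent_intervals i1 i2]
    have e2 : ∫ r in I (y 1)..1, κ * sinOf θ0 (ratio (capt (I (y r)) r) (E r)) * E r ^ γ = 0 := by
      rw [intervalIntegral.integral_congr (g := fun _ => (0 : ℝ))]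
      · simp
      intro t ht
      rw [uIcc_of_le hw1] at ht
      simp only
      rw [h.E_eq_zero P L hδ ht.1 ht.2, zero_rpow hγ.ne', mul_zero]
    rw [e2, add_zero]
    have e1 : ∫ r in s..I (y 1), κ * 2 ^ γ * x ^ (2 * γ) = κ * 2 ^ γ * (x ^ (2 * γ) * x) := by
      rw [intervalIntegral.integral_const, smul_eq_mul, ← hx]; ring
    rw [← e1]
    refine intervalIntegral.integral_mono_on hsw i1 (by simp) fun t ht => ?_
    have ht0 : 0 < t := hs00.trans_le ht.1
    have a1 := h.E_le_sq P L hδ ht0 ht.2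
    have a2 := h.E_nonneg t ⟨ht0.le, ht.2.trans hw1⟩
    have a3 : E t ^ γ ≤ 2 ^ γ * x ^ (2 * γ) := by
      have : E t ≤ 2 * x ^ 2 := a1.trans (by
        have := sub_nonneg.2 ht.2
        rw [hx]; gcongr; exact ht.1)
      calc E t ^ γ ≤ (2 * x ^ 2) ^ γ := by gcongr
        _ = _ := by
            rw [mul_rpow (by norm_num) (by positivity), ← rpow_natCast, ← rpow_mul hx0]
            norm_num
    have a4 := sinOf_le_one (θ0 := θ0) (ρ := ratio (capt (I (y t)) t) (E t))
    calc _ ≤ κ * 1 * (2 ^ γ * x ^ (2 * γ)) := by gcongr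
      _ = _ := by ring
  calc _ ≤ C * (y s) ^ (-β) * (y 1 - y s) := h1
    _ ≤ C * b ^ (-β) * (κ * 2 ^ γ * (x ^ (2 * γ) * x)) := by
      have := sub_nonneg.2 hym
      gcongr
    _ = _ := by ring

lemma deficit_le {δ μ K : ℝ} {I y : ℝ → ℝ} (P : Params θ0 κ γ C β) (L : Light C β δ I)
    (hK : 0 < K) (hμ : 0 < μ) (hμ1 : μ ≤ 1 / 4) (hδ : δ ≤ μ ^ 2)
    (hd : ∀ s, 1 / 4 ≤ s → s ≤ I (y 1) →
      I (y 1) - I (y s) ≤ K * ((I (y 1) - s) ^ (2 * γ) * (I (y 1) - s)))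
    {s : ℝ} (hsw : s ≤ I (y 1)) :
    I (y 1) - I (y s) ≤ (μ + K * μ ^ (2 * γ)) * (I (y 1) - s) := by
  have hx0 : 0 ≤ I (y 1) - s := by linarith
  have hγ := P.γ_pos
  rcases le_or_gt μ (I (y 1) - s) with h1 | h1
  · have := L.le_one (y 1)
    have := L.ge (y s)
    have : 0 ≤ K * μ ^ (2 * γ) * (I (y 1) - s) := by positivity
    nlinarith
  · have := hd s (by nlinarith [L.ge (y 1)]) hsw
    have h2 : (I (y 1) - s) ^ (2 * γ) ≤ μ ^ (2 * γ) := by gcongr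
    have h3 : K * ((I (y 1) - s) ^ (2 * γ) * (I (y 1) - s)) ≤
      K * (μ ^ (2 * γ) * (I (y 1) - s)) := by gcongr
    nlinarith [mul_nonneg hμ.le hx0]

variable {δ s r ω : ℝ} {I y E : ℝ → ℝ} (h : Profile θ0 κ γ I y E) (P : Params θ0 κ γ C β)
  (L : Light C β δ I) (hδ : δ ≤ 1 / 4)
  (hω : ∀ s, s ≤ I (y 1) → I (y 1) - I (y s) ≤ ω * (I (y 1) - s)) (hω2 : ω ≤ 1 / 2)
include h P L hδ hω hω2

lemma sq_le_E (hs : 0 ≤ s) (hsw : s ≤ I (y 1)) : sin θ0 / 8 * (I (y 1) - s) ^ 2 ≤ E s := by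
  have hx0 : 0 ≤ I (y 1) - s := by linarith
  have h1 := hω s hsw
  have h2 : ω * (I (y 1) - s) ≤ 1 / 2 * (I (y 1) - s) := by gcongr
  have := h.le_E P L hδ (v := s + (I (y 1) - s) / 2) hs le_rfl (by linarith) (by linarith)
  linarith

lemma one_sub_ratio_le (hs : 0 < s) (hsw : s < I (y 1)) :
    1 - ratio (capt (I (y s)) s) (E s) ≤ 16 / sin θ0 * ω := by
  have hx0 : 0 < I (y 1) - s := by linarith
  have hs0 := P.sin_pos
  have hE := h.sq_le_E P L hδ hω hω2 hs.le hsw.le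
  have hE0 : 0 < E s := lt_of_lt_of_le (by positivity) hE
  have hw := L.ge (y 1)
  have h0 : 0 ≤ I (y 1) - I (y s) :=
    sub_nonneg.2 (h.I_le P L ⟨hs.le, hsw.le.trans (L.le_one _)⟩)
  have h3 := abs_capt_sub_le hs (w := I (y 1)) (x := I (y 1)) (x' := I (y s)) (by linarith) hsw.le
    le_rfl (by linarith)
  rw [abs_of_nonneg h0] at h3
  have h1 := hω s hsw.le
  have hb : E s - capt (I (y s)) s ≤ 2 * (I (y 1) - s) * (ω * (I (y 1) - s)) := by
    have := h.E_le_capt P L hδ hs hsw.le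
    have := le_abs_self (capt (I (y 1)) s - capt (I (y s)) s)
    have : 2 * (I (y 1) - s) * (I (y 1) - I (y s)) ≤
      2 * (I (y 1) - s) * (ω * (I (y 1) - s)) := by gcongr
    linarith
  have hb0 : 0 ≤ 2 * (I (y 1) - s) * (ω * (I (y 1) - s)) := by
    have := h0.trans h1; positivity
  refine (OP2.one_sub_ratio_le hE0 hb0 hb).trans ?_
  calc _ ≤ 2 * (I (y 1) - s) * (ω * (I (y 1) - s)) / (sin θ0 / 8 * (I (y 1) - s) ^ 2) := by gcongr
    _ = _ := by field_simp; ring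

end Profile

end

/-! ### Pointwise comparison of two solutions -/

section

lemma le_two_mul_of_contraction {ι : Type*} {f : ι → ℝ} {B₀ b : ℝ} (h₀ : ∀ i, f i ≤ B₀)
    (h : ∀ B, (∀ i, f i ≤ B) → ∀ i, f i ≤ B / 2 + b) (i : ι) : f i ≤ 2 * b := by
  have : Nonempty ι := ⟨i⟩
  have hb : BddAbove (range f) := ⟨B₀, by rintro _ ⟨j, rfl⟩; exact h₀ j⟩
  have h1 : ⨆ j, f j ≤ (⨆ j, f j) / 2 + b := ciSup_le (h _ fun j => le_ciSup hb j)
  have h2 := le_ciSup hb i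
  linarith

lemma abs_rpow_sub_rpow_le {a b γ : ℝ} (ha : 0 ≤ a) (hb : 0 ≤ b) (hm : 0 < max a b) (hγ : 0 < γ) :
    |a ^ γ - b ^ γ| ≤ (1 + γ) * (max a b) ^ (γ - 1) * |a - b| := by
  have key : ∀ {a b : ℝ}, 0 ≤ a → 0 < b → a ≤ b →
      |a ^ γ - b ^ γ| ≤ (1 + γ) * b ^ (γ - 1) * |a - b| := by
    intro a b ha hb hab
    have h1 : a ^ γ ≤ b ^ γ := by gcongr
    rw [abs_sub_comm, abs_of_nonneg (by linarith), abs_sub_comm, abs_of_nonneg (by linarith)]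
    have e1 : b ^ γ = b ^ (γ - 1) * b := by
      rw [rpow_sub_one hb.ne']; field_simp
    have e2 : a ^ γ = (a / b) ^ γ * b ^ γ := by
      rw [← mul_rpow (by positivity) hb.le]; congr 1; field_simp
    have ht0 : 0 ≤ a / b := by positivity
    have ht1 : a / b ≤ 1 := div_le_one_of_le₀ hab hb.le
    have h2 : 1 - (a / b) ^ γ ≤ (1 + γ) * (1 - a / b) := by
      rcases le_total 1 γ with h | h
      · have := one_add_mul_self_le_rpow_one_add (s := a / b - 1) (by linarith) h
        rw [add_sub_cancel] at this
        linarith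
      · have : a / b ≤ (a / b) ^ γ := by
          conv_lhs => rw [← rpow_one (a / b)]
          rcases ht0.eq_or_lt with h0 | h0
          · rw [← h0, zero_rpow hγ.ne', zero_rpow one_ne_zero]
          · exact rpow_le_rpow_of_exponent_ge h0 ht1 h
        nlinarith
    have h3 : 0 ≤ b ^ (γ - 1) * b := by positivity
    calc b ^ γ - a ^ γ = (b ^ (γ - 1) * b) * (1 - (a / b) ^ γ) := by rw [e2, e1]; ring
      _ ≤ (b ^ (γ - 1) * b) * ((1 + γ) * (1 - a / b)) := by gcongr
      _ = _ := by field_simp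
  rcases le_total a b with h | h
  · rw [max_eq_right h] at hm ⊢; exact key ha hm h
  · rw [max_eq_left h] at hm ⊢
    rw [abs_sub_comm, abs_sub_comm a]; exact key hb hm h

lemma rpow_le_of_mem_Icc {lo hi m q e : ℝ} (hlo : 0 < lo) (hhi : 0 < hi) (hq : 0 < q)
    (h1 : lo * q ≤ m) (h2 : m ≤ hi * q) : m ^ e ≤ (lo ^ e + hi ^ e) * q ^ e := by
  have hm : 0 < m := lt_of_lt_of_le (by positivity) h1
  have a1 : 0 < lo ^ e * q ^ e := by positivity
  have a2 : 0 < hi ^ e * q ^ e := by positivity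
  rcases le_total 0 e with h | h
  · have : m ^ e ≤ (hi * q) ^ e := by gcongr
    rw [mul_rpow hhi.le hq.le] at this
    linarith
  · have : m ^ e ≤ (lo * q) ^ e := rpow_le_rpow_of_nonpos (by positivity) h1 h
    rw [mul_rpow hlo.le hq.le] at this
    linarith

lemma integral_rpow_neg_le {p s w : ℝ} (hp0 : 0 < p) (hp : p < 1) (hs : 0 < s) (hsw : s ≤ w)
    (hw : 3 / 4 ≤ w) (hw1 : w ≤ 1) :
    ∫ r in s..w, r ^ (-p) ≤ (4 + 2 / (1 - p)) * (w - s) := by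
  have hp' : 0 < 1 - p := by linarith
  rcases le_or_gt (1 / 4) s with h | h
  · have : ∫ r in s..w, r ^ (-p) ≤ ∫ r in s..w, 4 := by
      refine intervalIntegral.integral_mono_on hsw
        (intervalIntegral.intervalIntegrable_rpow' (by linarith)) (by simp) fun r hr => ?_
      have hr0 : 1 / 4 ≤ r := h.trans hr.1
      calc r ^ (-p) ≤ (1 / 4) ^ (-p) := rpow_le_rpow_of_nonpos (by norm_num) hr0 (by linarith)
        _ = 4 ^ p := by rw [one_div, inv_rpow (by norm_num), rpow_neg (by norm_num), inv_inv]
        _ ≤ 4 ^ (1 : ℝ) := rpow_le_rpow_of_exponent_le (by norm_num) hp.le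
        _ = 4 := by norm_num
    rw [intervalIntegral.integral_const, smul_eq_mul] at this
    have : 0 ≤ 2 / (1 - p) * (w - s) := by
      have := sub_nonneg.2 hsw; positivity
    linarith
  · rw [integral_rpow (Or.inl (by linarith)), show -p + 1 = 1 - p by ring]
    have h1 : w ^ (1 - p) ≤ 1 := rpow_le_one (by linarith) hw1 hp'.le
    have h2 : 0 ≤ s ^ (1 - p) := by positivity
    calc (w ^ (1 - p) - s ^ (1 - p)) / (1 - p) ≤ 1 / (1 - p) := by gcongr; linarith
      _ = 2 / (1 - p) * (1 / 2) := by ring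
      _ ≤ (4 + 2 / (1 - p)) * (w - s) := by gcongr <;> linarith

/-- Two solutions of the optimality system, the first with the lower tip. -/
structure Pair (θ0 κ γ C β δ ω : ℝ) (I y₁ E₁ y₂ E₂ : ℝ → ℝ) : Prop where
  P : Params θ0 κ γ C β
  L : Light C β δ I
  hδ : δ ≤ 1 / 4
  h₁ : Profile θ0 κ γ I y₁ E₁
  h₂ : Profile θ0 κ γ I y₂ E₂
  ω₁ : ∀ s, s ≤ I (y₁ 1) → I (y₁ 1) - I (y₁ s) ≤ ω * (I (y₁ 1) - s)
  ω₂ : ∀ s, s ≤ I (y₂ 1) → I (y₂ 1) - I (y₂ s) ≤ ω * (I (y₂ 1) - s)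
  ω_nonneg : 0 ≤ ω
  ω_le : ω ≤ 1 / 2
  le : I (y₁ 1) ≤ I (y₂ 1)

namespace Pair

variable {θ0 κ γ C β δ ω s : ℝ} {I y₁ E₁ y₂ E₂ : ℝ → ℝ}

lemma exists_abs_light_sub_le (P : Params θ0 κ γ C β) : ∃ K > 0, ∀ δ ω I y₁ E₁ y₂ E₂,
    Pair θ0 κ γ C β δ ω I y₁ E₁ y₂ E₂ → ∀ s η, 0 < s → s ≤ 1 → |y₁ s - y₂ s| ≤ η →
      |I (y₁ s) - I (y₂ s)| ≤ K * s ^ (-β) * η := by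
  obtain ⟨hs0, hκ, hγ, hC, hβ, hβ1⟩ := P
  set a := κ * sin θ0 * (sin θ0 / 8) ^ γ / 4 with ha
  have ha0 : 0 < a := by positivity
  refine ⟨C * a ^ (-β), by positivity, fun δ ω I y₁ E₁ y₂ E₂ h s η hs hs1 hη => ?_⟩
  have b1 := h.h₁.le_y h.P h.L h.hδ ⟨hs.le, hs1⟩
  have b2 := h.h₂.le_y h.P h.L h.hδ ⟨hs.le, hs1⟩
  rw [← ha] at b1 b2
  have key : ∀ {p q : ℝ}, a * s ≤ p → p ≤ q → |p - q| ≤ η →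
      |I p - I q| ≤ C * a ^ (-β) * s ^ (-β) * η := by
    intro p q hp hpq hη
    have hp0 : 0 < a * s := by positivity
    rw [abs_sub_comm, abs_of_nonneg (sub_nonneg.2 hpq)] at hη
    rw [abs_sub_comm, abs_of_nonneg (sub_nonneg.2 (h.L.mono hpq))]
    refine (h.L.slope p q (hp0.trans_le hp) hpq).trans ?_
    have := sub_nonneg.2 hpq
    calc C * p ^ (-β) * (q - p) ≤ C * (a * s) ^ (-β) * η := by
          have := rpow_le_rpow_of_nonpos hp0 hp (by linarith : -β ≤ 0)
          gcongr
      _ = _ := by rw [mul_rpow ha0.le hs.le]; ring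
  rcases le_total (y₁ s) (y₂ s) with h' | h'
  · exact key b1 h' hη
  · rw [abs_sub_comm] at hη ⊢; exact key b2 h' hη

variable (h : Pair θ0 κ γ C β δ ω I y₁ E₁ y₂ E₂)
include h

lemma E₁_le (hs : 0 < s) (hsw : s < I (y₂ 1)) : E₁ s ≤ 2 * (I (y₂ 1) - s) ^ 2 := by
  rcases le_or_gt (I (y₁ 1)) s with h' | h'
  · rw [h.h₁.E_eq_zero h.P h.L h.hδ h' (hsw.le.trans (h.L.le_one _))]; positivity
  · refine (h.h₁.E_le_sq h.P h.L h.hδ hs h'.le).trans ?_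
    have := h.le
    have := sub_nonneg.2 h'.le
    gcongr

lemma abs_ratio_sub_le (hs : 0 < s) (hsw : s < I (y₁ 1)) :
    |ratio (capt (I (y₁ s)) s) (E₁ s) - ratio (capt (I (y₂ s)) s) (E₂ s)| ≤
      16 / sin θ0 * (|I (y₁ s) - I (y₂ s)| / (I (y₂ 1) - s)
        + |E₁ s - E₂ s| / (I (y₂ 1) - s) ^ 2) := by
  have hs0 := h.P.sin_pos
  have hx1 : 0 < I (y₁ 1) - s := by linarith
  have hx : 0 < I (y₂ 1) - s := by linarith [h.le]
  have hs1 : s ≤ 1 := hsw.le.trans (h.L.le_one _)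
  have e1 := h.h₁.sq_le_E h.P h.L h.hδ h.ω₁ h.ω_le hs.le hsw.le
  have e2 := h.h₂.sq_le_E h.P h.L h.hδ h.ω₂ h.ω_le hs.le (hsw.le.trans h.le)
  have p1 : 0 < E₁ s := lt_of_lt_of_le (by positivity) e1
  have p2 : 0 < E₂ s := lt_of_lt_of_le (by positivity) e2
  refine (OP2.abs_ratio_sub_le (capt_nonneg hs) p1 p2).trans ?_
  have c := abs_capt_sub_le hs (w := I (y₂ 1)) (x := I (y₁ s)) (x' := I (y₂ s))
    (by linarith [h.L.ge (y₂ 1), h.hδ]) (hsw.le.trans h.le)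
    ((h.h₁.I_le h.P h.L ⟨hs.le, hs1⟩).trans h.le) (h.h₂.I_le h.P h.L ⟨hs.le, hs1⟩)
  calc _ ≤ (2 * (I (y₂ 1) - s) * |I (y₁ s) - I (y₂ s)| + 2 * |E₁ s - E₂ s|) /
        (sin θ0 / 8 * (I (y₂ 1) - s) ^ 2) := by gcongr
    _ = _ := by field_simp; ring

/-- Pointwise comparison of the integrands of the cost. -/
lemma abs_cost_sub_le {ν : ℝ} (hν : 0 < ν) (hs : 0 < s) (hsw : s < I (y₂ 1)) :
    |cosOf θ0 (ratio (capt (I (y₁ s)) s) (E₁ s)) * ell (I (y₁ s)) s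
      - cosOf θ0 (ratio (capt (I (y₂ s)) s) (E₂ s)) * ell (I (y₂ s)) s| ≤
      ω * (512 * (4 + 2 / ν) / sin θ0 ^ 4) *
        ((|I (y₁ s) - I (y₂ s)| + |E₁ s - E₂ s| / (I (y₂ 1) - s)) * s ^ (-ν))
      + 2 * |I (y₁ s) - I (y₂ s)| := by
  have hs0 := h.P.sin_pos
  have hω := h.ω_nonneg
  have hx : 0 < I (y₂ 1) - s := by linarith
  have hs1 : s ≤ 1 := hsw.le.trans (h.L.le_one _)
  obtain ⟨r0, r1⟩ := h.h₁.ratio_mem hs hs1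
  obtain ⟨r0', r1'⟩ := h.h₂.ratio_mem hs hs1
  have g1 : 3 / 4 ≤ I (y₁ s) := by linarith [h.L.ge (y₁ s), h.hδ]
  have g2 : 3 / 4 ≤ I (y₂ s) := by linarith [h.L.ge (y₂ s), h.hδ]
  have g3 : 3 / 4 ≤ I (y₂ 1) := by linarith [h.L.ge (y₂ 1), h.hδ]
  have hk : 0 ≤ 2 / ν := by positivity
  have split : ∀ n₁ n₂ l₁ l₂ : ℝ, 0 ≤ l₁ → 0 ≤ n₂ →
      |n₁ * l₁ - n₂ * l₂| ≤ |n₁ - n₂| * l₁ + n₂ * |l₁ - l₂| := by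
    intro n₁ n₂ l₁ l₂ a b
    calc _ = |(n₁ - n₂) * l₁ + n₂ * (l₁ - l₂)| := by ring_nf
      _ ≤ |(n₁ - n₂) * l₁| + |n₂ * (l₁ - l₂)| := abs_add_le _ _
      _ = _ := by rw [abs_mul, abs_mul, abs_of_nonneg a, abs_of_nonneg b]
  refine (split _ _ _ _ ell_nonneg (hs0.le.trans (le_cosOf r0' r1'))).trans (add_le_add ?_ ?_)
  · rcases le_or_gt (I (y₁ 1)) s with h' | h'
    · have := h.h₁.I_le h.P h.L ⟨hs.le, hs1⟩
      rw [ell_eq_zero hs (by linarith) (this.trans h'), mul_zero]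
      positivity
    have b1 := abs_cosOf_sub_le hs0 r0 r1 r0' r1'
      (h.h₁.one_sub_ratio_le h.P h.L h.hδ h.ω₁ h.ω_le hs h')
      (h.h₂.one_sub_ratio_le h.P h.L h.hδ h.ω₂ h.ω_le hs hsw)
    have b2 := h.abs_ratio_sub_le hs h'
    have b3 := ell_le_rpow hν hs (by linarith) (h.L.le_one (y₁ s)) (w := I (y₂ 1))
      ((h.h₁.I_le h.P h.L ⟨hs.le, hs1⟩).trans h.le) g3 hsw.le hs1
    have b4 := ell_nonneg (x := I (y₁ s)) (s := s)
    calc _ ≤ (2 * (16 / sin θ0 * ω) / sin θ0 ^ 2 * (16 / sin θ0 *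
          (|I (y₁ s) - I (y₂ s)| / (I (y₂ 1) - s) + |E₁ s - E₂ s| / (I (y₂ 1) - s) ^ 2))) *
          ((4 + 2 / ν) * (I (y₂ 1) - s) * s ^ (-ν)) := by
          gcongr
          exact b1.trans (by gcongr)
      _ = _ := by field_simp; ring
  · have b1 := abs_ell_sub_le hs (x := I (y₁ s)) (x' := I (y₂ s)) (by linarith) (by linarith)
    have b2 := cosOf_le_one (θ0 := θ0) r0' r1'
    calc _ ≤ 1 * (2 * |I (y₁ s) - I (y₂ s)|) := by gcongr
      _ = _ := one_mul _

/-- Pointwise comparison of the integrands of the height. -/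
lemma abs_height_sub_le (hs : 0 < s) (hsw : s < I (y₂ 1)) :
    |κ * sinOf θ0 (ratio (capt (I (y₁ s)) s) (E₁ s)) * E₁ s ^ γ
      - κ * sinOf θ0 (ratio (capt (I (y₂ s)) s) (E₂ s)) * E₂ s ^ γ| ≤
      κ * (16 * 2 ^ γ / sin θ0 ^ 2 + (1 + γ) * ((sin θ0 / 8) ^ (γ - 1) + 2 ^ (γ - 1))) *
        (|I (y₁ s) - I (y₂ s)| * (I (y₂ 1) - s) ^ (2 * γ - 1)
          + |E₁ s - E₂ s| * (I (y₂ 1) - s) ^ (2 * γ - 2)) := by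
  have hs0 := h.P.sin_pos
  have hγ := h.P.γ_pos
  have hκ := h.P.κ_pos
  have hx : 0 < I (y₂ 1) - s := by linarith
  have hs1 : s ≤ 1 := hsw.le.trans (h.L.le_one _)
  obtain ⟨r0, r1⟩ := h.h₁.ratio_mem hs hs1
  obtain ⟨r0', r1'⟩ := h.h₂.ratio_mem hs hs1
  have E1 := h.h₁.E_nonneg s ⟨hs.le, hs1⟩
  have E2 := h.h₂.E_nonneg s ⟨hs.le, hs1⟩
  have U1 := h.E₁_le hs hsw
  have U2 := h.h₂.E_le_sq h.P h.L h.hδ hs hsw.le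
  have L2 := h.h₂.sq_le_E h.P h.L h.hδ h.ω₂ h.ω_le hs.le hsw.le
  set x := I (y₂ 1) - s with hxdef
  set d := |I (y₁ s) - I (y₂ s)| with hd
  set D := |E₁ s - E₂ s| with hD
  set σ₁ := sinOf θ0 (ratio (capt (I (y₁ s)) s) (E₁ s)) with hσ₁
  set σ₂ := sinOf θ0 (ratio (capt (I (y₂ s)) s) (E₂ s)) with hσ₂
  have d0 : 0 ≤ d := abs_nonneg _
  have D0 : 0 ≤ D := abs_nonneg _
  have σ2 : 0 ≤ σ₂ := sinOf_nonneg
  have σ2' : σ₂ ≤ 1 := sinOf_le_one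
  have px1 : x ^ (2 * γ - 1) = x ^ (2 * γ) / x := by rw [rpow_sub_one hx.ne']
  have px2 : x ^ (2 * γ - 2) = x ^ (2 * γ) / x ^ 2 := by
    rw [show 2 * γ - 2 = 2 * γ - (2 : ℕ) by norm_num, rpow_sub_natCast hx.ne']
  have pq : ∀ e : ℝ, (x ^ 2) ^ e = x ^ (2 * e) := fun e => by
    rw [← rpow_natCast, ← rpow_mul hx.le]; norm_num
  have t1 : |σ₁ - σ₂| * E₁ s ^ γ ≤
      16 * 2 ^ γ / sin θ0 ^ 2 * (d * x ^ (2 * γ - 1) + D * x ^ (2 * γ - 2)) := by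
    rcases le_or_gt (I (y₁ 1)) s with h' | h'
    · rw [h.h₁.E_eq_zero h.P h.L h.hδ h' hs1, zero_rpow hγ.ne', mul_zero]; positivity
    have b1 := abs_sinOf_sub_le hs0 r0 r1 r0' r1'
    have b2 := h.abs_ratio_sub_le hs h'
    rw [← hxdef, ← hd, ← hD] at b2
    rw [← hσ₁, ← hσ₂] at b1
    have b3 : E₁ s ^ γ ≤ 2 ^ γ * x ^ (2 * γ) := by
      calc E₁ s ^ γ ≤ (2 * x ^ 2) ^ γ := by gcongr
        _ = _ := by rw [mul_rpow (by norm_num) (by positivity), pq]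
    calc |σ₁ - σ₂| * E₁ s ^ γ
        ≤ (1 / sin θ0 * (16 / sin θ0 * (d / x + D / x ^ 2))) * (2 ^ γ * x ^ (2 * γ)) := by
          gcongr
          exact b1.trans (by gcongr)
      _ = _ := by rw [px1, px2]; field_simp
  have t2 : |E₁ s ^ γ - E₂ s ^ γ| ≤ (1 + γ) * ((sin θ0 / 8) ^ (γ - 1) + 2 ^ (γ - 1)) *
      (D * x ^ (2 * γ - 2)) := by
    have hx2 : 0 < x ^ 2 := by positivity
    have hm : 0 < max (E₁ s) (E₂ s) :=
      lt_of_lt_of_le (by positivity) (L2.trans (le_max_right _ _))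
    have b1 := abs_rpow_sub_rpow_le E1 E2 hm hγ
    have b2 := rpow_le_of_mem_Icc (e := γ - 1) (by positivity : 0 < sin θ0 / 8) two_pos hx2
      (L2.trans (le_max_right _ _)) (max_le U1 U2)
    rw [pq, show 2 * (γ - 1) = 2 * γ - 2 by ring] at b2
    calc _ ≤ (1 + γ) * max (E₁ s) (E₂ s) ^ (γ - 1) * D := b1
      _ ≤ (1 + γ) * (((sin θ0 / 8) ^ (γ - 1) + 2 ^ (γ - 1)) * x ^ (2 * γ - 2)) * D := by gcongr
      _ = _ := by ring
  have t3 : 0 ≤ (1 + γ) * ((sin θ0 / 8) ^ (γ - 1) + 2 ^ (γ - 1)) * (d * x ^ (2 * γ - 1)) := by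
    positivity
  calc |κ * σ₁ * E₁ s ^ γ - κ * σ₂ * E₂ s ^ γ|
      = κ * |(σ₁ - σ₂) * E₁ s ^ γ + σ₂ * (E₁ s ^ γ - E₂ s ^ γ)| := by
        rw [← abs_of_pos hκ, ← abs_mul, abs_of_pos hκ]; ring_nf
    _ ≤ κ * (|σ₁ - σ₂| * E₁ s ^ γ + 1 * |E₁ s ^ γ - E₂ s ^ γ|) := by
        gcongr
        refine (abs_add_le _ _).trans ?_
        rw [abs_mul, abs_mul, abs_of_nonneg σ2, abs_of_nonneg (by positivity : 0 ≤ E₁ s ^ γ)]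
        gcongr
    _ ≤ κ * (16 * 2 ^ γ / sin θ0 ^ 2 * (d * x ^ (2 * γ - 1) + D * x ^ (2 * γ - 2))
        + (1 + γ) * ((sin θ0 / 8) ^ (γ - 1) + 2 ^ (γ - 1)) * (D * x ^ (2 * γ - 2))
        + (1 + γ) * ((sin θ0 / 8) ^ (γ - 1) + 2 ^ (γ - 1)) * (d * x ^ (2 * γ - 1))) := by
        rw [one_mul, add_assoc]
        refine mul_le_mul_of_nonneg_left (add_le_add t1 ?_) hκ.le
        linarith
    _ = _ := by ring

end Pair

end

/-! ### Integrated comparison of two solutions -/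

section

namespace Pair

variable {θ0 κ γ C β δ ω s : ℝ} {I y₁ E₁ y₂ E₂ : ℝ → ℝ}

lemma abs_E_sub_le (h : Pair θ0 κ γ C β δ ω I y₁ E₁ y₂ E₂) {g : ℝ → ℝ} (hs : 0 ≤ s)
    (hsw : s ≤ I (y₂ 1)) (hg : IntervalIntegrable g volume s (I (y₂ 1)))
    (H : ∀ r ∈ Ioo s (I (y₂ 1)), |cosOf θ0 (ratio (capt (I (y₁ r)) r) (E₁ r)) * ell (I (y₁ r)) r
      - cosOf θ0 (ratio (capt (I (y₂ r)) r) (E₂ r)) * ell (I (y₂ r)) r| ≤ g r) :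
    |E₁ s - E₂ s| ≤ ∫ r in s..I (y₂ 1), g r := by
  have hw := h.L.le_one (y₂ 1)
  have key : ∀ {y E : ℝ → ℝ}, Profile θ0 κ γ I y E → I (y 1) ≤ I (y₂ 1) →
      E s = ∫ r in s..I (y₂ 1), cosOf θ0 (ratio (capt (I (y r)) r) (E r)) * ell (I (y r)) r := by
    intro y E hp hle
    rw [hp.E_eq s ⟨hs, hsw.trans hw⟩, ← intervalIntegral.integral_add_adjacent_intervals
      (hp.E_int.mono_Icc zero_le_one ⟨hs, hsw.trans hw⟩ ⟨hs.trans hsw, hw⟩)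
      (hp.E_int.mono_Icc zero_le_one ⟨hs.trans hsw, hw⟩ ⟨zero_le_one, le_rfl⟩),
      ← hp.E_eq _ ⟨hs.trans hsw, hw⟩, hp.E_eq_zero h.P h.L h.hδ hle hw, add_zero]
  rw [key h.h₁ h.le, key h.h₂ le_rfl, ← intervalIntegral.integral_sub]
  · rw [← Real.norm_eq_abs]
    refine intervalIntegral.norm_integral_le_of_norm_le hsw ?_ hg
    have : ∀ᵐ r, r ≠ I (y₂ 1) := by simp [ae_iff]
    filter_upwards [this] with r hr hr'
    exact H r ⟨hr'.1, lt_of_le_of_ne hr'.2 hr⟩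
  · exact h.h₁.E_int.mono_Icc zero_le_one ⟨hs, hsw.trans hw⟩ ⟨hs.trans hsw, hw⟩
  · exact h.h₂.E_int.mono_Icc zero_le_one ⟨hs, hsw.trans hw⟩ ⟨hs.trans hsw, hw⟩

lemma continuousOn_abs_light_sub (h : Pair θ0 κ γ C β δ ω I y₁ E₁ y₂ E₂) :
    ContinuousOn (fun s => |I (y₁ s) - I (y₂ s)|) (Icc 0 1) :=
  ((h.L.cont.comp_continuousOn h.h₁.y_cont).sub (h.L.cont.comp_continuousOn h.h₂.y_cont)).abs

lemma intervalIntegrable_abs_light_sub (h : Pair θ0 κ γ C β δ ω I y₁ E₁ y₂ E₂) {a b : ℝ}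
    (ha : a ∈ Icc (0 : ℝ) 1) (hb : b ∈ Icc (0 : ℝ) 1) :
    IntervalIntegrable (fun s => |I (y₁ s) - I (y₂ s)|) volume a b :=
  (h.continuousOn_abs_light_sub.intervalIntegrable_of_Icc zero_le_one).mono_Icc zero_le_one ha hb

/-- The transport costs differ by at most a multiple of the height difference, with a bound that
vanishes linearly at the tip. -/
lemma exists_abs_cost_sub_le_mul (P : Params θ0 κ γ C β) :
    ∃ K > 0, ∃ ε > 0, ∀ δ ω I y₁ E₁ y₂ E₂, Pair θ0 κ γ C β δ ω I y₁ E₁ y₂ E₂ → ω ≤ ε →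
      ∀ η, 0 ≤ η → (∀ s ∈ Icc (0 : ℝ) 1, |y₁ s - y₂ s| ≤ η) →
        ∀ s, 0 < s → s < I (y₂ 1) → |E₁ s - E₂ s| ≤ K * η * (I (y₂ 1) - s) := by
  obtain ⟨K2, hK2, H2⟩ := exists_abs_light_sub_le P
  obtain ⟨hs0, hκ, hγ, hC, hβ, hβ1⟩ := P
  obtain ⟨ν, hν⟩ : ∃ ν, ν = (1 - β) / 2 := ⟨_, rfl⟩
  obtain ⟨p, hp⟩ : ∃ p, p = (1 + β) / 2 := ⟨_, rfl⟩
  have hν0 : 0 < ν := by linarith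
  have hp0 : 0 < p := by linarith
  have hp1 : 0 < 1 - p := by linarith
  obtain ⟨K3, hK3⟩ : ∃ K3, K3 = 512 * (4 + 2 / ν) / sin θ0 ^ 4 := ⟨_, rfl⟩
  have hK30 : 0 < K3 := by rw [hK3]; positivity
  obtain ⟨K4, hK4⟩ : ∃ K4, K4 = 4 + 2 / (1 - p) := ⟨_, rfl⟩
  have hK40 : 0 < K4 := by rw [hK4]; positivity
  refine ⟨2 * (K2 / 2 + 2 * K4 * K2), by positivity, 1 / (2 * K3 * K4), by positivity, ?_⟩
  intro δ ω I y₁ E₁ y₂ E₂ h hω η hη hy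
  have hw := h.L.le_one (y₂ 1)
  have hw' : 3 / 4 ≤ I (y₂ 1) := by linarith [h.L.ge (y₂ 1), h.hδ]
  have hω0 := h.ω_nonneg
  have hωK : K4 * (ω * K3) ≤ 1 / 2 := by
    have := mul_le_mul_of_nonneg_right hω (by positivity : 0 ≤ K3 * K4)
    have e : 1 / (2 * K3 * K4) * (K3 * K4) = 1 / 2 := by field_simp
    linarith
  let f : Ioo (0 : ℝ) (I (y₂ 1)) → ℝ := fun s => |E₁ s - E₂ s| / (I (y₂ 1) - s)
  have bound := le_two_mul_of_contraction (f := f) (B₀ := 2)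
    (b := (K2 / 2 + 2 * K4 * K2) * η) ?_ ?_
  · intro s hs hsw
    have := bound ⟨s, hs, hsw⟩
    simp only [f] at this
    rw [div_le_iff₀ (by linarith)] at this
    linarith
  · rintro ⟨s, hs, hsw⟩
    simp only [f]
    have hx : 0 < I (y₂ 1) - s := by linarith
    rw [div_le_iff₀ hx]
    have a1 := h.E₁_le hs hsw
    have a2 := h.h₂.E_le_sq h.P h.L h.hδ hs hsw.le
    have a3 := h.h₁.E_nonneg s ⟨hs.le, hsw.le.trans hw⟩
    have a4 := h.h₂.E_nonneg s ⟨hs.le, hsw.le.trans hw⟩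
    have : (I (y₂ 1) - s) ^ 2 ≤ I (y₂ 1) - s := by nlinarith
    exact abs_le.2 ⟨by linarith, by linarith⟩
  · rintro B hB ⟨s, hs, hsw⟩
    simp only [f]
    have hx : 0 < I (y₂ 1) - s := by linarith
    have hB0 : 0 ≤ B := le_trans (by simp only [f]; positivity) (hB ⟨s, hs, hsw⟩)
    set M := ω * K3 * (K2 * η + B) + 2 * (K2 * η) with hM
    have hM0 : 0 ≤ M := by positivity
    have main := h.abs_E_sub_le hs.le hsw.le (g := fun r => M * r ^ (-p))
      ((intervalIntegral.intervalIntegrable_rpow' (by linarith)).const_mul M) fun r hr => by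
        have hr0 : 0 < r := hs.trans hr.1
        have hr1 : r ≤ 1 := hr.2.le.trans hw
        refine (h.abs_cost_sub_le hν0 hr0 hr.2).trans ?_
        rw [← hK3]
        have b1 := H2 _ _ _ _ _ _ _ h r η hr0 hr1 (hy r ⟨hr0.le, hr1⟩)
        have b2 : |E₁ r - E₂ r| / (I (y₂ 1) - r) ≤ B := hB ⟨r, hr0, hr.2⟩
        have q1 : r ^ (-β) * r ^ (-ν) = r ^ (-p) := by
          rw [← rpow_add hr0]; congr 1; rw [hp, hν]; ring
        have q2 : r ^ (-ν) ≤ r ^ (-p) :=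
          rpow_le_rpow_of_exponent_ge hr0 hr1 (by rw [hp, hν]; linarith)
        have q3 : r ^ (-β) ≤ r ^ (-p) :=
          rpow_le_rpow_of_exponent_ge hr0 hr1 (by rw [hp]; linarith)
        calc _ ≤ ω * K3 * ((K2 * r ^ (-β) * η + B) * r ^ (-ν)) + 2 * (K2 * r ^ (-β) * η) := by
              gcongr
          _ = ω * K3 * (K2 * η * (r ^ (-β) * r ^ (-ν)) + B * r ^ (-ν))
              + 2 * (K2 * η) * r ^ (-β) := by ring
          _ ≤ ω * K3 * (K2 * η * r ^ (-p) + B * r ^ (-p)) + 2 * (K2 * η) * r ^ (-p) := by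
              rw [q1]; gcongr
          _ = M * r ^ (-p) := by rw [hM]; ring
    rw [intervalIntegral.integral_const_mul] at main
    have i1 := integral_rpow_neg_le hp0 (by linarith) hs hsw.le hw' hw
    rw [← hK4] at i1
    rw [div_le_iff₀ hx]
    calc |E₁ s - E₂ s| ≤ M * (K4 * (I (y₂ 1) - s)) := main.trans (by gcongr)
      _ = (K4 * (ω * K3) * (K2 * η + B) + 2 * K4 * K2 * η) * (I (y₂ 1) - s) := by rw [hM]; ring
      _ ≤ (1 / 2 * (K2 * η + B) + 2 * K4 * K2 * η) * (I (y₂ 1) - s) := by gcongr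
      _ = _ := by ring

/-- The transport costs are close as soon as the light intensities are close in mean. -/
lemma exists_abs_cost_sub_le_add (P : Params θ0 κ γ C β) :
    ∃ K > 0, ∃ ε > 0, ∀ δ ω I y₁ E₁ y₂ E₂, Pair θ0 κ γ C β δ ω I y₁ E₁ y₂ E₂ → ω ≤ ε →
      ∀ η, 0 ≤ η → (∀ s ∈ Icc (0 : ℝ) 1, |y₁ s - y₂ s| ≤ η) →
        ∀ s, 0 < s → s < I (y₂ 1) →
          |E₁ s - E₂ s| ≤ K * ω * η + 2 * ∫ r in (0 : ℝ)..I (y₂ 1), |I (y₁ r) - I (y₂ r)| := by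
  obtain ⟨K2, hK2, H2⟩ := exists_abs_light_sub_le P
  obtain ⟨K5, hK5, ε, hε, H5⟩ := exists_abs_cost_sub_le_mul P
  obtain ⟨hs0, hκ, hγ, hC, hβ, hβ1⟩ := P
  obtain ⟨ν, hν⟩ : ∃ ν, ν = (1 - β) / 2 := ⟨_, rfl⟩
  obtain ⟨p, hp⟩ : ∃ p, p = (1 + β) / 2 := ⟨_, rfl⟩
  have hν0 : 0 < ν := by linarith
  have hp0 : 0 < p := by linarith
  have hp1 : 0 < 1 - p := by linarith
  obtain ⟨K3, hK3⟩ : ∃ K3, K3 = 512 * (4 + 2 / ν) / sin θ0 ^ 4 := ⟨_, rfl⟩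
  have hK30 : 0 < K3 := by rw [hK3]; positivity
  obtain ⟨K4, hK4⟩ : ∃ K4, K4 = 4 + 2 / (1 - p) := ⟨_, rfl⟩
  have hK40 : 0 < K4 := by rw [hK4]; positivity
  refine ⟨K3 * (K2 + K5) * K4, by positivity, ε, hε, ?_⟩
  intro δ ω I y₁ E₁ y₂ E₂ h hω η hη hy s hs hsw
  have hw := h.L.le_one (y₂ 1)
  have hw' : 3 / 4 ≤ I (y₂ 1) := by linarith [h.L.ge (y₂ 1), h.hδ]
  have hω0 := h.ω_nonneg
  set M := ω * K3 * (K2 * η + K5 * η) with hM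
  have hM0 : 0 ≤ M := by positivity
  have hsI : s ∈ Icc (0 : ℝ) 1 := ⟨hs.le, hsw.le.trans hw⟩
  have hwI : I (y₂ 1) ∈ Icc (0 : ℝ) 1 := ⟨hs.le.trans hsw.le, hw⟩
  have ir : IntervalIntegrable (fun r : ℝ => M * r ^ (-p)) volume s (I (y₂ 1)) :=
    (intervalIntegral.intervalIntegrable_rpow' (by linarith)).const_mul M
  have id := (h.intervalIntegrable_abs_light_sub hsI hwI).const_mul 2
  have main := h.abs_E_sub_le hs.le hsw.le
    (g := fun r => M * r ^ (-p) + 2 * |I (y₁ r) - I (y₂ r)|) (ir.add id) fun r hr => by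
      have hr0 : 0 < r := hs.trans hr.1
      have hr1 : r ≤ 1 := hr.2.le.trans hw
      refine (h.abs_cost_sub_le hν0 hr0 hr.2).trans ?_
      rw [← hK3]
      have b1 := H2 _ _ _ _ _ _ _ h r η hr0 hr1 (hy r ⟨hr0.le, hr1⟩)
      have b2 : |E₁ r - E₂ r| / (I (y₂ 1) - r) ≤ K5 * η := by
        rw [div_le_iff₀ (by linarith [hr.2])]
        exact H5 _ _ _ _ _ _ _ h hω η hη hy r hr0 hr.2
      have q1 : r ^ (-β) * r ^ (-ν) = r ^ (-p) := by
        rw [← rpow_add hr0]; congr 1; rw [hp, hν]; ring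
      have q2 : r ^ (-ν) ≤ r ^ (-p) :=
        rpow_le_rpow_of_exponent_ge hr0 hr1 (by rw [hp, hν]; linarith)
      gcongr ?_ + _
      calc _ ≤ ω * K3 * ((K2 * r ^ (-β) * η + K5 * η) * r ^ (-ν)) := by gcongr
        _ = ω * K3 * (K2 * η * (r ^ (-β) * r ^ (-ν)) + K5 * η * r ^ (-ν)) := by ring
        _ ≤ ω * K3 * (K2 * η * r ^ (-p) + K5 * η * r ^ (-p)) := by rw [q1]; gcongr
        _ = M * r ^ (-p) := by rw [hM]; ring
  rw [intervalIntegral.integral_add ir id, intervalIntegral.integral_const_mul,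
    intervalIntegral.integral_const_mul] at main
  have i1 := integral_rpow_neg_le hp0 (by linarith) hs hsw.le hw' hw
  rw [← hK4] at i1
  have i2 : ∫ r in s..I (y₂ 1), |I (y₁ r) - I (y₂ r)| ≤
      ∫ r in (0 : ℝ)..I (y₂ 1), |I (y₁ r) - I (y₂ r)| := by
    rw [← intervalIntegral.integral_add_adjacent_intervals (a := 0) (b := s)
      (h.intervalIntegrable_abs_light_sub (by simp) hsI)
      (h.intervalIntegrable_abs_light_sub hsI hwI)]
    have := intervalIntegral.integral_nonneg (μ := volume) hs.le
      (f := fun r => |I (y₁ r) - I (y₂ r)|) fun _ _ => abs_nonneg _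
    linarith
  calc |E₁ s - E₂ s| ≤ M * (K4 * 1) + 2 * ∫ r in (0 : ℝ)..I (y₂ 1), |I (y₁ r) - I (y₂ r)| := by
        refine main.trans ?_
        gcongr
        refine i1.trans ?_
        gcongr
        linarith
    _ = _ := by rw [hM]; ring

/-- The light intensities are close in mean. -/
lemma exists_integral_abs_light_sub_le (P : Params θ0 κ γ C β) :
    ∃ K > 0, ∀ μ, 0 < μ → μ ≤ 1 / 4 → ∃ δ₀ > 0, ∀ δ ω I y₁ E₁ y₂ E₂,
      Pair θ0 κ γ C β δ ω I y₁ E₁ y₂ E₂ → δ ≤ δ₀ →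
      ∀ η, 0 ≤ η → (∀ s ∈ Icc (0 : ℝ) 1, |y₁ s - y₂ s| ≤ η) →
        ∫ r in (0 : ℝ)..I (y₂ 1), |I (y₁ r) - I (y₂ r)| ≤ K * μ * η := by
  obtain ⟨K2, hK2, H2⟩ := exists_abs_light_sub_le P
  obtain ⟨hs0, hκ, hγ, hC, hβ, hβ1⟩ := P
  refine ⟨2 + 8 * K2, by positivity, fun μ hμ hμ1 => ?_⟩
  set m := κ * sin θ0 * (sin θ0 / 8 * μ ^ 2) ^ γ with hm
  have hm0 : 0 < m := by positivity
  refine ⟨min μ (m * μ), by positivity, ?_⟩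
  intro δ ω I y₁ E₁ y₂ E₂ h hδ η hη hy
  have hδ1 := hδ.trans (min_le_left _ _)
  have hδ2 := hδ.trans (min_le_right _ _)
  have hw := h.L.le_one (y₂ 1)
  have hw1 := h.L.ge (y₁ 1)
  have hle := h.le
  have hδ4 := h.hδ
  set S := I (y₁ 1) - μ with hS
  have hS1 : 1 / 2 ≤ S := by linarith
  have hSI : S ∈ Icc (0 : ℝ) 1 := ⟨by linarith, by linarith⟩
  have hwI : I (y₂ 1) ∈ Icc (0 : ℝ) 1 := ⟨by linarith, hw⟩
  rw [← intervalIntegral.integral_add_adjacent_intervals (a := 0) (b := S)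
    (h.intervalIntegrable_abs_light_sub (by simp) hSI)
    (h.intervalIntegrable_abs_light_sub hSI hwI)]
  have far := integral_abs_sub_comp_le h.L.mono h.L.ge (δ := δ) (y₁ := y₁) (y₂ := y₂)
    (fun t => by linarith [h.L.le_one t]) hm0 hη hSI.1 (fun r s hr hrs hs => by
      refine h.h₁.y_slope h.P (by positivity) hr hrs (hs.trans hSI.2) fun t ht => ?_
      refine le_trans ?_ (h.h₁.sq_le_E h.P h.L h.hδ h.ω₁ h.ω_le (hr.trans ht.1)
        (by linarith [ht.2]))
      gcongr
      linarith [ht.2]) (fun s hs => hy s ⟨hs.1, hs.2.trans hSI.2⟩)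
    (h.intervalIntegrable_abs_light_sub (by simp) hSI)
  have near : ∫ r in S..I (y₂ 1), |I (y₁ r) - I (y₂ r)| ≤ ∫ r in S..I (y₂ 1), 4 * K2 * η := by
    refine intervalIntegral.integral_mono_on (by linarith)
      (h.intervalIntegrable_abs_light_sub hSI hwI) (by simp) fun r hr => ?_
    have hr0 : 1 / 2 ≤ r := hS1.trans hr.1
    have hr1 : r ≤ 1 := hr.2.trans hw
    refine (H2 _ _ _ _ _ _ _ h r η (by linarith) hr1 (hy r ⟨by linarith, hr1⟩)).trans ?_
    have : r ^ (-β) ≤ 4 := by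
      calc r ^ (-β) ≤ (1 / 2) ^ (-β) := rpow_le_rpow_of_nonpos (by norm_num) hr0 (by linarith)
        _ = 2 ^ β := by rw [one_div, inv_rpow (by norm_num), rpow_neg (by norm_num), inv_inv]
        _ ≤ 2 ^ (1 : ℝ) := rpow_le_rpow_of_exponent_le (by norm_num) hβ1.le
        _ ≤ 4 := by norm_num
    calc K2 * r ^ (-β) * η ≤ K2 * 4 * η := by gcongr
      _ = _ := by ring
  rw [intervalIntegral.integral_const, smul_eq_mul] at near
  have f1 : 2 * (η / m) * δ ≤ 2 * μ * η := by
    calc 2 * (η / m) * δ ≤ 2 * (η / m) * (m * μ) := by gcongr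
      _ = _ := by field_simp
  have f2 : (I (y₂ 1) - S) * (4 * K2 * η) ≤ (2 * μ) * (4 * K2 * η) := by
    gcongr; linarith
  linarith

/-- The heights are close as soon as the light intensities are close in mean and the transport
costs are close. -/
lemma exists_abs_height_sub_le (P : Params θ0 κ γ C β) :
    ∃ K > 0, ∃ ε > 0, ∀ δ ω I y₁ E₁ y₂ E₂, Pair θ0 κ γ C β δ ω I y₁ E₁ y₂ E₂ → ω ≤ ε →
      ∀ η, 0 ≤ η → (∀ s ∈ Icc (0 : ℝ) 1, |y₁ s - y₂ s| ≤ η) →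
        ∀ τ e, 0 < τ → τ ≤ 1 / 4 → 0 ≤ e → (∀ s, 0 < s → s < I (y₂ 1) → |E₁ s - E₂ s| ≤ e) →
          ∀ s ∈ Icc (0 : ℝ) 1, |y₁ s - y₂ s| ≤ K * (τ ^ (2 * γ) * η
            + (∫ r in (0 : ℝ)..I (y₂ 1), |I (y₁ r) - I (y₂ r)|) / τ + e / τ ^ 2) := by
  obtain ⟨K2, hK2, H2⟩ := exists_abs_light_sub_le P
  obtain ⟨K5, hK5, ε, hε, H5⟩ := exists_abs_cost_sub_le_mul P
  obtain ⟨hs0, hκ, hγ, hC, hβ, hβ1⟩ := P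
  obtain ⟨K6, hK6⟩ : ∃ K6, K6 = κ * (16 * 2 ^ γ / sin θ0 ^ 2 +
    (1 + γ) * ((sin θ0 / 8) ^ (γ - 1) + 2 ^ (γ - 1))) := ⟨_, rfl⟩
  have hK60 : 0 < K6 := by rw [hK6]; positivity
  set A := (4 * K2 + K5) / (2 * γ) with hA
  have hA0 : 0 < A := by positivity
  refine ⟨K6 * (A + 1), by positivity, ε, hε, ?_⟩
  intro δ ω I y₁ E₁ y₂ E₂ h hω η hη hy τ e hτ hτ1 he hE s hs
  have hw := h.L.le_one (y₂ 1)
  have hw' : 3 / 4 ≤ I (y₂ 1) := by linarith [h.L.ge (y₂ 1), h.hδ]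
  set w := I (y₂ 1) with hwdef
  set d : ℝ → ℝ := fun r => |I (y₁ r) - I (y₂ r)| with hd
  set F : ℝ → ℝ := fun r => κ * sinOf θ0 (ratio (capt (I (y₁ r)) r) (E₁ r)) * E₁ r ^ γ
      - κ * sinOf θ0 (ratio (capt (I (y₂ r)) r) (E₂ r)) * E₂ r ^ γ with hF
  have hFi : IntervalIntegrable F volume 0 1 := h.h₁.y_int.sub h.h₂.y_int
  have z0 : (0 : ℝ) ∈ Icc (0 : ℝ) 1 := by simp
  have z1 : (1 : ℝ) ∈ Icc (0 : ℝ) 1 := by simp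
  have hwI : w ∈ Icc (0 : ℝ) 1 := ⟨by linarith, hw⟩
  have haI : w - τ ∈ Icc (0 : ℝ) 1 := ⟨by linarith, by linarith⟩
  have hFp : ∀ r, 0 < r → r < w → |F r| ≤
      K6 * (d r * (w - r) ^ (2 * γ - 1) + |E₁ r - E₂ r| * (w - r) ^ (2 * γ - 2)) := fun r a b => by
    rw [hK6]; exact h.abs_height_sub_le a b
  have e1 : |y₁ s - y₂ s| ≤ ∫ r in (0 : ℝ)..1, |F r| := by
    rw [h.h₁.y_eq s hs, h.h₂.y_eq s hs, ← intervalIntegral.integral_sub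
      (h.h₁.y_int.mono_Icc zero_le_one z0 hs) (h.h₂.y_int.mono_Icc zero_le_one z0 hs),
      ← intervalIntegral.integral_add_adjacent_intervals
      (hFi.abs.mono_Icc zero_le_one z0 hs) (hFi.abs.mono_Icc zero_le_one hs z1)]
    have a1 := intervalIntegral.abs_integral_le_integral_abs (f := F) (μ := volume) hs.1
    have a2 := intervalIntegral.integral_nonneg (μ := volume) hs.2
      (f := fun r => |F r|) fun _ _ => abs_nonneg _
    linarith
  have e2 : ∫ r in (0 : ℝ)..1, |F r| = (∫ r in (0 : ℝ)..(w - τ), |F r|)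
      + (∫ r in (w - τ)..w, |F r|) := by
    rw [← intervalIntegral.integral_add_adjacent_intervals (a := 0) (b := w) (c := 1)
      (hFi.abs.mono_Icc zero_le_one z0 hwI) (hFi.abs.mono_Icc zero_le_one hwI z1),
      ← intervalIntegral.integral_add_adjacent_intervals (a := 0) (b := w - τ) (c := w)
      (hFi.abs.mono_Icc zero_le_one z0 haI) (hFi.abs.mono_Icc zero_le_one haI hwI)]
    have : ∫ r in w..1, |F r| = 0 := by
      rw [intervalIntegral.integral_congr (g := fun _ => (0 : ℝ))]
      · simp
      intro r hr
      rw [uIcc_of_le hw] at hr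
      simp only [hF]
      rw [h.h₁.E_eq_zero h.P h.L h.hδ (h.le.trans hr.1) hr.2,
        h.h₂.E_eq_zero h.P h.L h.hδ hr.1 hr.2, zero_rpow hγ.ne']
      simp
    rw [this, add_zero]
  have far : ∫ r in (0 : ℝ)..(w - τ), |F r| ≤
      K6 * ((∫ r in (0 : ℝ)..w, d r) / τ + e / τ ^ 2) := by
    have i1 := h.intervalIntegrable_abs_light_sub z0 haI
    have i2 := h.intervalIntegrable_abs_light_sub haI hwI
    have i3 : IntervalIntegrable (fun r => K6 * (d r / τ + e / τ ^ 2)) volume 0 (w - τ) :=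
      ((i1.div_const τ).add (by simp)).const_mul K6
    have b1 : ∫ r in (0 : ℝ)..(w - τ), |F r| ≤
        ∫ r in (0 : ℝ)..(w - τ), K6 * (d r / τ + e / τ ^ 2) := by
      refine intervalIntegral.integral_mono_on_of_le_Ioo haI.1
        (hFi.abs.mono_Icc zero_le_one z0 haI) i3 fun r hr => ?_
      refine (hFp r hr.1 (by linarith [hr.2])).trans ?_
      have hx : τ ≤ w - r := by linarith [hr.2]
      have hx0 : 0 < w - r := by linarith
      have hx1 : w - r ≤ 1 := by linarith [hr.1]
      have q1 : (w - r) ^ (2 * γ - 1) ≤ 1 / τ := by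
        rw [rpow_sub_one hx0.ne']
        have := rpow_le_one hx0.le hx1 (by positivity : 0 ≤ 2 * γ)
        gcongr
      have q2 : (w - r) ^ (2 * γ - 2) ≤ 1 / τ ^ 2 := by
        rw [show 2 * γ - 2 = 2 * γ - (2 : ℕ) by norm_num, rpow_sub_natCast hx0.ne']
        have := rpow_le_one hx0.le hx1 (by positivity : 0 ≤ 2 * γ)
        gcongr
      have q3 := hE r hr.1 (by linarith)
      have q4 : 0 ≤ d r := abs_nonneg _
      calc _ ≤ K6 * (d r * (1 / τ) + e * (1 / τ ^ 2)) := by gcongr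
        _ = _ := by ring
    refine b1.trans ?_
    rw [intervalIntegral.integral_const_mul, intervalIntegral.integral_add (i1.div_const τ)
      (by simp), intervalIntegral.integral_div, intervalIntegral.integral_const, smul_eq_mul]
    gcongr
    · rw [← intervalIntegral.integral_add_adjacent_intervals i1 i2]
      have := intervalIntegral.integral_nonneg (μ := volume) (by linarith : w - τ ≤ w)
        (f := d) fun _ _ => abs_nonneg _
      linarith
    · have : 0 ≤ e / τ ^ 2 := by positivity
      nlinarith
  have near : ∫ r in (w - τ)..w, |F r| ≤ K6 * (A * (τ ^ (2 * γ) * η)) := by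
    have i3 : IntervalIntegrable (fun r => (w - r) ^ (2 * γ - 1)) volume (w - τ) w := by
      have := (intervalIntegral.intervalIntegrable_rpow' (a := τ) (b := 0)
        (r := 2 * γ - 1) (by linarith)).comp_sub_left w
      simpa using this
    have b1 : ∫ r in (w - τ)..w, |F r| ≤
        ∫ r in (w - τ)..w, K6 * ((4 * K2 + K5) * η) * (w - r) ^ (2 * γ - 1) := by
      refine intervalIntegral.integral_mono_on_of_le_Ioo (by linarith)
        (hFi.abs.mono_Icc zero_le_one haI hwI) (i3.const_mul _) fun r hr => ?_
      have hr0 : 1 / 4 ≤ r := by linarith [hr.1]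
      have hr1 : r ≤ 1 := by linarith [hr.2]
      have hx0 : 0 < w - r := by linarith [hr.2]
      refine (hFp r (by linarith) hr.2).trans ?_
      have q1 := H2 _ _ _ _ _ _ _ h r η (by linarith) hr1 (hy r ⟨by linarith, hr1⟩)
      have q2 := H5 _ _ _ _ _ _ _ h hω η hη hy r (by linarith) hr.2
      have q3 : r ^ (-β) ≤ 4 := by
        calc r ^ (-β) ≤ (1 / 4) ^ (-β) := rpow_le_rpow_of_nonpos (by norm_num) hr0 (by linarith)
          _ = 4 ^ β := by rw [one_div, inv_rpow (by norm_num), rpow_neg (by norm_num), inv_inv]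
          _ ≤ 4 ^ (1 : ℝ) := rpow_le_rpow_of_exponent_le (by norm_num) hβ1.le
          _ = 4 := by norm_num
      have q4 : d r ≤ K2 * 4 * η := q1.trans (by gcongr)
      have q5 : (w - r) * (w - r) ^ (2 * γ - 2) = (w - r) ^ (2 * γ - 1) := by
        rw [show 2 * γ - 1 = 1 + (2 * γ - 2) by ring, rpow_add hx0, rpow_one]
      calc _ ≤ K6 * ((K2 * 4 * η) * (w - r) ^ (2 * γ - 1)
            + (K5 * η * (w - r)) * (w - r) ^ (2 * γ - 2)) := by gcongr
        _ = K6 * ((K2 * 4 * η) * (w - r) ^ (2 * γ - 1)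
            + K5 * η * ((w - r) * (w - r) ^ (2 * γ - 2))) := by ring
        _ = _ := by rw [q5]; ring
    refine b1.trans (le_of_eq ?_)
    rw [intervalIntegral.integral_const_mul, intervalIntegral.integral_comp_sub_left
      (fun x => x ^ (2 * γ - 1)) w, sub_self, sub_sub_cancel, integral_rpow (Or.inl (by linarith)),
      show 2 * γ - 1 + 1 = 2 * γ by ring, zero_rpow (by positivity), hA]
    ring
  have hdn : 0 ≤ ∫ r in (0 : ℝ)..w, d r :=
    intervalIntegral.integral_nonneg hwI.1 fun _ _ => abs_nonneg _
  have p1 : 0 ≤ K6 * (τ ^ (2 * γ) * η) := by positivity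
  have p2 : 0 ≤ K6 * A * ((∫ r in (0 : ℝ)..w, d r) / τ + e / τ ^ 2) := by positivity
  have : K6 * (A + 1) * (τ ^ (2 * γ) * η + (∫ r in (0 : ℝ)..w, d r) / τ + e / τ ^ 2) =
    K6 * ((∫ r in (0 : ℝ)..w, d r) / τ + e / τ ^ 2) + K6 * (A * (τ ^ (2 * γ) * η))
    + K6 * (τ ^ (2 * γ) * η) + K6 * A * ((∫ r in (0 : ℝ)..w, d r) / τ + e / τ ^ 2) := by ring
  linarith

end Pair

end

/-! ### Uniqueness for the optimality system -/

section

variable {θ0 κ γ C β : ℝ}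

lemma Pair.exists_small (P : Params θ0 κ γ C β) : ∀ K1 > 0, ∃ μ > 0, ∃ δ₀ > 0,
    μ ≤ 1 / 4 ∧ μ + K1 * μ ^ (2 * γ) ≤ 1 / 2 ∧ ∀ δ I y₁ E₁ y₂ E₂,
      Pair θ0 κ γ C β δ (μ + K1 * μ ^ (2 * γ)) I y₁ E₁ y₂ E₂ → δ ≤ δ₀ →
      EqOn y₁ y₂ (Icc 0 1) ∧ ∀ s, 0 < s → s < I (y₂ 1) → E₁ s = E₂ s := by
  obtain ⟨K5, hK5, ε5, hε5, H5⟩ := exists_abs_cost_sub_le_mul P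
  obtain ⟨Ke, hKe, εe, hεe, He⟩ := exists_abs_cost_sub_le_add P
  obtain ⟨Kf, hKf, Hf⟩ := exists_integral_abs_light_sub_le P
  obtain ⟨K, hK, ε, hε, H⟩ := exists_abs_height_sub_le P
  have hγ := P.γ_pos
  intro K1 hK1
  have lim0 : Filter.Tendsto (fun τ : ℝ => τ ^ (2 * γ)) (nhdsWithin 0 (Ioi 0)) (nhds 0) := by
    have := (continuousAt_rpow_const 0 (2 * γ) (Or.inr (by positivity))).tendsto
    rw [zero_rpow (by positivity)] at this
    exact this.mono_left nhdsWithin_le_nhds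
  have lim1 : Filter.Tendsto (fun τ : ℝ => τ) (nhdsWithin 0 (Ioi 0)) (nhds 0) :=
    Filter.tendsto_id.mono_left nhdsWithin_le_nhds
  obtain ⟨τ, hτ1, hτ2, hτ0⟩ : ∃ τ : ℝ, K * τ ^ (2 * γ) < 1 / 4 ∧ τ < 1 / 4 ∧ 0 < τ := by
    have l1 := (lim0.const_mul K).eventually_lt_const (u := 1 / 4) (by norm_num)
    have l2 := lim1.eventually_lt_const (u := 1 / 4) (by norm_num)
    exact (l1.and (l2.and self_mem_nhdsWithin)).exists
  have limω : Filter.Tendsto (fun μ : ℝ => μ + K1 * μ ^ (2 * γ)) (nhdsWithin 0 (Ioi 0))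
      (nhds 0) := by
    simpa using lim1.add (lim0.const_mul K1)
  have lim2 : Filter.Tendsto (fun μ : ℝ => K * ((Kf * μ) / τ +
      (Ke * (μ + K1 * μ ^ (2 * γ)) + 2 * (Kf * μ)) / τ ^ 2)) (nhdsWithin 0 (Ioi 0)) (nhds 0) := by
    have := (((lim1.const_mul Kf).div_const τ).add
      (((limω.const_mul Ke).add ((lim1.const_mul Kf).const_mul 2)).div_const (τ ^ 2))).const_mul K
    simpa using this
  obtain ⟨μ, hμ1, hμ2, hμ3, hμ4, hμ5, hμ6, hμ0⟩ : ∃ μ : ℝ, K * ((Kf * μ) / τ +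
      (Ke * (μ + K1 * μ ^ (2 * γ)) + 2 * (Kf * μ)) / τ ^ 2) < 1 / 4 ∧ μ + K1 * μ ^ (2 * γ) < 1 / 2 ∧
      μ + K1 * μ ^ (2 * γ) < ε5 ∧ μ + K1 * μ ^ (2 * γ) < εe ∧ μ + K1 * μ ^ (2 * γ) < ε ∧
      μ < 1 / 4 ∧ 0 < μ := by
    have l1 := lim2.eventually_lt_const (u := 1 / 4) (by norm_num)
    have l2 := limω.eventually_lt_const (u := 1 / 2) (by norm_num)
    have l3 := limω.eventually_lt_const hε5
    have l4 := limω.eventually_lt_const hεe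
    have l5 := limω.eventually_lt_const hε
    have l6 := lim1.eventually_lt_const (u := 1 / 4) (by norm_num)
    exact (l1.and (l2.and (l3.and (l4.and (l5.and (l6.and self_mem_nhdsWithin)))))).exists
  obtain ⟨δ₀, hδ₀, Hδ⟩ := Hf μ hμ0 hμ6.le
  refine ⟨μ, hμ0, δ₀, hδ₀, hμ6.le, hμ2.le, ?_⟩
  intro δ I y₁ E₁ y₂ E₂ h hδ
  obtain ⟨t, ht, hmax⟩ := isCompact_Icc.exists_isMaxOn (nonempty_Icc.2 (zero_le_one' ℝ))
    (h.h₁.y_cont.sub h.h₂.y_cont).abs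
  set η := |y₁ t - y₂ t| with hη
  have hη0 : 0 ≤ η := abs_nonneg _
  have hy : ∀ s ∈ Icc (0 : ℝ) 1, |y₁ s - y₂ s| ≤ η := fun s hs => hmax hs
  have i1 := Hδ _ _ _ _ _ _ _ h hδ η hη0 hy
  have hω0 := h.ω_nonneg
  have a1 := H _ _ _ _ _ _ _ h hμ5.le η hη0 hy τ
    (Ke * (μ + K1 * μ ^ (2 * γ)) * η + 2 * (Kf * μ * η)) hτ0 hτ2.le (by positivity)
    (fun s h0 h1 => (He _ _ _ _ _ _ _ h hμ4.le η hη0 hy s h0 h1).trans (by gcongr)) t ht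
  rw [← hη] at a1
  have a2 : η ≤ (K * τ ^ (2 * γ) + K * ((Kf * μ) / τ +
      (Ke * (μ + K1 * μ ^ (2 * γ)) + 2 * (Kf * μ)) / τ ^ 2)) * η := by
    calc η ≤ _ := a1
      _ ≤ K * (τ ^ (2 * γ) * η + (Kf * μ * η) / τ
        + (Ke * (μ + K1 * μ ^ (2 * γ)) * η + 2 * (Kf * μ * η)) / τ ^ 2) := by gcongr
      _ = _ := by ring
  have a3 : η ≤ 1 / 2 * η := a2.trans (by gcongr; linarith)
  have η0 : η = 0 := by linarith
  refine ⟨fun s hs => ?_, fun s h0 h1 => ?_⟩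
  · have := hy s hs
    rw [η0] at this
    exact sub_eq_zero.1 (abs_nonpos_iff.1 this)
  · have := H5 _ _ _ _ _ _ _ h hμ3.le η hη0 hy s h0 h1
    rw [η0, mul_zero, zero_mul] at this
    exact sub_eq_zero.1 (abs_nonpos_iff.1 this)

/-- Uniqueness for the optimality system under nearly maximal light. -/
theorem Profile.exists_unique (P : Params θ0 κ γ C β) : ∃ δ > 0, ∀ I y₁ E₁ y₂ E₂,
    Light C β δ I → Profile θ0 κ γ I y₁ E₁ → Profile θ0 κ γ I y₂ E₂ →
      EqOn y₁ y₂ (Icc 0 1) ∧ EqOn E₁ E₂ (Icc 0 1) := by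
  obtain ⟨K1, hK1, H1⟩ := exists_deficit_le P
  obtain ⟨μ, hμ, δ₀, hδ₀, hμ1, hμ2, H2⟩ := Pair.exists_small P K1 hK1
  refine ⟨min (1 / 4) (min (μ ^ 2) δ₀), by positivity, ?_⟩
  have key : ∀ I y₁ E₁ y₂ E₂, Light C β (min (1 / 4) (min (μ ^ 2) δ₀)) I →
      Profile θ0 κ γ I y₁ E₁ → Profile θ0 κ γ I y₂ E₂ → I (y₁ 1) ≤ I (y₂ 1) →
      EqOn y₁ y₂ (Icc 0 1) ∧ EqOn E₁ E₂ (Icc 0 1) := by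
    intro I y₁ E₁ y₂ E₂ L h₁ h₂ hle
    have d1 : min (1 / 4) (min (μ ^ 2) δ₀) ≤ 1 / 4 := min_le_left _ _
    have d2 : min (1 / 4) (min (μ ^ 2) δ₀) ≤ μ ^ 2 := (min_le_right _ _).trans (min_le_left _ _)
    have d3 : min (1 / 4) (min (μ ^ 2) δ₀) ≤ δ₀ := (min_le_right _ _).trans (min_le_right _ _)
    have hp : Pair θ0 κ γ C β _ (μ + K1 * μ ^ (2 * γ)) I y₁ E₁ y₂ E₂ :=
      ⟨P, L, d1, h₁, h₂,
        fun s hs => deficit_le P L hK1 hμ hμ1 d2 (fun s h h' => H1 _ _ _ _ d1 L h₁ s h h') hs,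
        fun s hs => deficit_le P L hK1 hμ hμ1 d2 (fun s h h' => H1 _ _ _ _ d1 L h₂ s h h') hs,
        by positivity, hμ2, hle⟩
    obtain ⟨hy, hE⟩ := H2 _ _ _ _ _ _ hp d3
    have hE' : ∀ s, 0 < s → s ≤ 1 → E₁ s = E₂ s := by
      intro s h0 h1
      rcases lt_or_ge s (I (y₂ 1)) with h | h
      · exact hE s h0 h
      · rw [h₁.E_eq_zero P L d1 (hle.trans h) h1, h₂.E_eq_zero P L d1 h h1]
    refine ⟨hy, fun s hs => ?_⟩
    rcases hs.1.eq_or_lt with h0 | h0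
    · rw [h₁.E_eq s hs, h₂.E_eq s hs]
      refine intervalIntegral.integral_congr_ae (Filter.Eventually.of_forall fun r hr => ?_)
      rw [uIoc_of_le hs.2] at hr
      have hr0 : 0 < r := hs.1.trans_lt hr.1
      rw [hy ⟨hr0.le, hr.2⟩, hE' r hr0 hr.2]
    · exact hE' s h0 hs.2
  intro I y₁ E₁ y₂ E₂ L h₁ h₂
  rcases le_total (I (y₁ 1)) (I (y₂ 1)) with h | h
  · exact key _ _ _ _ _ L h₁ h₂ h
  · obtain ⟨a, b⟩ := key _ _ _ _ _ L h₂ h₁ h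
    exact ⟨a.symm, b.symm⟩

end

/-! ### Changes of the time variable -/

section

variable {ρ : ℝ → ℝ} {m : ℝ}

/-- `e` is the change of the time variable with speed `ρ`. -/
structure Clock (ρ : ℝ → ℝ) (e : ℝ ≃o ℝ) : Prop where
  meas : Measurable ρ
  locInt : LocallyIntegrable ρ
  nonneg : ∀ t, 0 ≤ ρ t
  eq : ∀ t, e t = ∫ s in (0 : ℝ)..t, ρ s

lemma exists_clock (hρ : Measurable ρ) (hρi : LocallyIntegrable ρ) (hm : 0 < m)
    (h : ∀ t, m ≤ ρ t) : ∃ e : ℝ ≃o ℝ, Clock ρ e := by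
  have hi : ∀ a b, IntervalIntegrable ρ volume a b := fun a b =>
    (hρi.integrableOn_isCompact isCompact_uIcc).intervalIntegrable
  have key : ∀ a b, a ≤ b → m * (b - a) ≤ (∫ s in (0 : ℝ)..b, ρ s) - ∫ s in (0 : ℝ)..a, ρ s := by
    intro a b hab
    rw [intervalIntegral.integral_interval_sub_left (hi _ _) (hi _ _)]
    have := intervalIntegral.integral_mono_on hab
      (intervalIntegrable_const (c := m)) (hi a b) (fun t _ => h t)
    simpa [mul_comm] using this
  have hmono : StrictMono (fun t => ∫ s in (0 : ℝ)..t, ρ s) := by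
    intro a b hab
    have := key a b hab.le
    have : 0 < m * (b - a) := mul_pos hm (sub_pos.2 hab)
    simp only
    linarith
  have hcont : Continuous (fun t => ∫ s in (0 : ℝ)..t, ρ s) :=
    intervalIntegral.continuous_primitive hi 0
  have htop : Filter.Tendsto (fun t => ∫ s in (0 : ℝ)..t, ρ s) Filter.atTop Filter.atTop := by
    refine Filter.tendsto_atTop_mono' _ ?_ (Filter.tendsto_id.const_mul_atTop hm)
    filter_upwards [Filter.eventually_ge_atTop 0] with t ht
    have := key 0 t ht
    simpa using this
  have hbot : Filter.Tendsto (fun t => ∫ s in (0 : ℝ)..t, ρ s) Filter.atBot Filter.atBot := by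
    refine Filter.tendsto_atBot_mono' _ ?_ (Filter.tendsto_id.const_mul_atBot hm)
    filter_upwards [Filter.eventually_le_atBot 0] with t ht
    have := key t 0 ht
    simp at this ⊢
    linarith
  refine ⟨hmono.orderIsoOfSurjective _ (hcont.surjective htop hbot), hρ, hρi,
    fun t => hm.le.trans (h t), fun t => rfl⟩

namespace Clock

variable {e : ℝ ≃o ℝ} (h : Clock ρ e)
include h

lemma zero : e 0 = 0 := by simp [h.eq]

lemma symm_zero : e.symm 0 = 0 := by
  rw [OrderIso.symm_apply_eq, h.zero]

lemma intervalIntegrable (a b : ℝ) : IntervalIntegrable ρ volume a b :=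
  (h.locInt.integrableOn_isCompact isCompact_uIcc).intervalIntegrable

lemma sub_eq (a b : ℝ) : e b - e a = ∫ s in a..b, ρ s := by
  rw [h.eq, h.eq, intervalIntegral.integral_interval_sub_left
    (h.intervalIntegrable _ _) (h.intervalIntegrable _ _)]

lemma map_withDensity : (volume.withDensity (fun t => ENNReal.ofReal (ρ t))).map
    e.toHomeomorph.toMeasurableEquiv = volume := by
  symm
  refine Measure.ext_of_Ioc _ _ fun a b hab => ?_
  have hpre : (e.toHomeomorph.toMeasurableEquiv) ⁻¹' (Ioc a b) = Ioc (e.symm a) (e.symm b) := by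
    ext t
    simp [OrderIso.symm_apply_lt, OrderIso.le_symm_apply]
  have hle : e.symm a ≤ e.symm b := e.symm.monotone hab.le
  rw [MeasurableEquiv.map_apply, hpre, withDensity_apply _ measurableSet_Ioc,
    ← ofReal_integral_eq_lintegral_ofReal
      ((intervalIntegrable_iff_integrableOn_Ioc_of_le hle).1 (h.intervalIntegrable _ _))
      (Filter.Eventually.of_forall h.nonneg),
    ← intervalIntegral.integral_of_le hle, ← h.sub_eq]
  simp

lemma setIntegral_eq (f : ℝ → ℝ) {A : Set ℝ} (hA : MeasurableSet A) :
    ∫ x in A, f x = ∫ t in e ⁻¹' A, ρ t * f (e t) := by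
  conv_lhs => rw [← h.map_withDensity]
  rw [setIntegral_map_equiv, setIntegral_withDensity_eq_setIntegral_toReal_smul
    h.meas.ennreal_ofReal (by simp) _ (e.toHomeomorph.toMeasurableEquiv.measurable hA)]
  refine setIntegral_congr_fun (e.toHomeomorph.toMeasurableEquiv.measurable hA) fun t _ => ?_
  simp [ENNReal.toReal_ofReal (h.nonneg t)]

lemma integrableOn_iff (f : ℝ → ℝ) {A : Set ℝ} (hA : MeasurableSet A) :
    IntegrableOn f A ↔ IntegrableOn (fun t => ρ t * f (e t)) (e ⁻¹' A) := by
  conv_lhs => rw [← h.map_withDensity]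
  rw [integrableOn_map_equiv, IntegrableOn,
    restrict_withDensity (e.toHomeomorph.toMeasurableEquiv.measurable hA),
    integrable_withDensity_iff_integrable_smul' h.meas.ennreal_ofReal (by simp)]
  refine integrable_congr (Filter.Eventually.of_forall fun t => ?_)
  simp [ENNReal.toReal_ofReal (h.nonneg t)]

omit h in
lemma preimage_Ioi (a : ℝ) : e ⁻¹' (Ioi (e a)) = Ioi a := by ext; simp

omit h in
lemma preimage_Ioc (a b : ℝ) : e ⁻¹' (Ioc (e a) (e b)) = Ioc a b := by ext; simp

lemma integral_Ioi (f : ℝ → ℝ) (a : ℝ) :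
    ∫ x in Ioi (e a), f x = ∫ t in Ioi a, ρ t * f (e t) := by
  rw [h.setIntegral_eq f measurableSet_Ioi, preimage_Ioi]

lemma integrableOn_Ioi (f : ℝ → ℝ) (a : ℝ) :
    IntegrableOn f (Ioi (e a)) ↔ IntegrableOn (fun t => ρ t * f (e t)) (Ioi a) := by
  rw [h.integrableOn_iff f measurableSet_Ioi, preimage_Ioi]

lemma integral_eq (f : ℝ → ℝ) (a b : ℝ) :
    ∫ x in (e a)..(e b), f x = ∫ t in a..b, ρ t * f (e t) := by
  rw [intervalIntegral, intervalIntegral, h.setIntegral_eq f measurableSet_Ioc,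
    h.setIntegral_eq f measurableSet_Ioc, preimage_Ioc, preimage_Ioc]

lemma intervalIntegrable_iff (f : ℝ → ℝ) (a b : ℝ) :
    IntervalIntegrable f volume (e a) (e b) ↔
      IntervalIntegrable (fun t => ρ t * f (e t)) volume a b := by
  rw [IntervalIntegrable, IntervalIntegrable, h.integrableOn_iff f measurableSet_Ioc,
    h.integrableOn_iff f measurableSet_Ioc, preimage_Ioc, preimage_Ioc]

end Clock

end

/-! ### The mass beyond a point of the stem -/

section

lemma _root_.LipschitzOnWith.comp_absolutelyContinuousOnInterval {f g : ℝ → ℝ} {a b : ℝ}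
    {s : Set ℝ} {K : NNReal} (hg : LipschitzOnWith K g s)
    (hf : AbsolutelyContinuousOnInterval f a b) (hs : MapsTo f (uIcc a b) s) :
    AbsolutelyContinuousOnInterval (fun x => g (f x)) a b := by
  rw [absolutelyContinuousOnInterval_iff] at hf ⊢
  intro ε hε
  obtain ⟨δ, hδ, H⟩ := hf (ε / (K + 1)) (by positivity)
  refine ⟨δ, hδ, fun E hE hE' => ?_⟩
  calc ∑ i ∈ Finset.range E.1, dist (g (f (E.2 i).1)) (g (f (E.2 i).2))
      ≤ ∑ i ∈ Finset.range E.1, K * dist (f (E.2 i).1) (f (E.2 i).2) :=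
        Finset.sum_le_sum fun i hi => hg.dist_le_mul _ (hs (hE.1 i hi).1) _ (hs (hE.1 i hi).2)
    _ = K * ∑ i ∈ Finset.range E.1, dist (f (E.2 i).1) (f (E.2 i).2) := by rw [Finset.mul_sum]
    _ ≤ K * (ε / (K + 1)) := by gcongr; exact (H E hE hE').le
    _ < ε := by
      rw [mul_div_assoc', div_lt_iff₀ (by positivity)]
      nlinarith

lemma integral_primitive_mul {f g : ℝ → ℝ} {a b : ℝ} (hf : IntervalIntegrable f volume a b)
    (hg : IntervalIntegrable g volume a b) :
    ∫ t in a..b, (∫ s in a..t, f s) * g t = ∫ t in a..b, f t * ∫ s in t..b, g s := by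
  have hF := hf.absolutelyContinuousOnInterval_intervalIntegral (c := a) (by simp)
  have hG := (hg.absolutelyContinuousOnInterval_intervalIntegral (c := b) (by simp)).neg
  have key := hF.integral_mul_deriv_eq_deriv_mul hG
  have e1 : ∫ t in a..b, (∫ s in a..t, f s) * deriv (fun t => -∫ s in b..t, g s) t =
      -∫ t in a..b, (∫ s in a..t, f s) * g t := by
    rw [← intervalIntegral.integral_neg]
    refine intervalIntegral.integral_congr_ae ?_
    filter_upwards [hg.ae_hasDerivAt_integral] with t ht hmem
    rw [(ht (uIoc_subset_uIcc hmem) b (by simp)).fun_neg.deriv]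
    ring
  have e2 : ∫ t in a..b, deriv (fun t => ∫ s in a..t, f s) t * (-∫ s in b..t, g s) =
      ∫ t in a..b, f t * ∫ s in t..b, g s := by
    refine intervalIntegral.integral_congr_ae ?_
    filter_upwards [hf.ae_hasDerivAt_integral] with t ht hmem
    rw [(ht (uIoc_subset_uIcc hmem) a (by simp)).deriv, intervalIntegral.integral_symm t b, neg_neg]
  have key' : ∫ t in a..b, (∫ s in a..t, f s) * deriv (fun t => -∫ s in b..t, g s) t =
      (∫ s in a..b, f s) * (-∫ s in b..b, g s) - (∫ s in a..a, f s) * (-∫ s in b..a, g s) -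
      ∫ t in a..b, deriv (fun t => ∫ s in a..t, f s) t * (-∫ s in b..t, g s) := key
  rw [e1, e2] at key'
  simp at key'
  linarith

/-- The mass of `u` to the right of `t`. -/
noncomputable def tail (u : ℝ → ℝ) (t : ℝ) : ℝ := ∫ s in Ioi t, u s

section tail

variable {u : ℝ → ℝ} {a b t : ℝ}

lemma tail_sub (hu : Integrable u) (a b : ℝ) : tail u a - tail u b = ∫ s in a..b, u s :=
  intervalIntegral.integral_Ioi_sub_Ioi' hu.integrableOn hu.integrableOn

lemma continuous_tail (hu : Integrable u) : Continuous (tail u) := by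
  have : tail u = fun t => tail u 0 - ∫ s in (0 : ℝ)..t, u s := by
    ext t; rw [← tail_sub hu]; ring
  rw [this]
  exact continuous_const.sub
    (intervalIntegral.continuous_primitive (fun _ _ => hu.intervalIntegrable) 0)

lemma tail_nonneg (h0 : ∀ t, 0 ≤ u t) (t : ℝ) : 0 ≤ tail u t :=
  integral_nonneg h0

lemma tail_antitone (hu : Integrable u) (h0 : ∀ t, 0 ≤ u t) : Antitone (tail u) := by
  intro a b hab
  have := tail_sub hu a b
  have := intervalIntegral.integral_nonneg (μ := volume) hab (fun t _ => h0 t)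
  linarith

lemma tail_add {v : ℝ → ℝ} (hu : Integrable u) (hv : Integrable v) (t : ℝ) :
    tail (fun s => u s + v s) t = tail u t + tail v t :=
  integral_add hu.integrableOn hv.integrableOn

lemma tail_eq_zero_iff (hu : Integrable u) (h0 : ∀ t, 0 ≤ u t) :
    tail u a = 0 ↔ ∀ᵐ s, a < s → u s = 0 := by
  rw [tail, integral_eq_zero_iff_of_nonneg h0 hu.integrableOn]
  exact ae_restrict_iff' measurableSet_Ioi

lemma ae_hasDerivAt_tail (hu : Integrable u) : ∀ᵐ t, HasDerivAt (tail u) (-u t) t := by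
  have : tail u = fun t => tail u 0 - ∫ s in (0 : ℝ)..t, u s := by
    ext t; rw [← tail_sub hu]; ring
  filter_upwards [LocallyIntegrable.ae_hasDerivAt_integral hu.locallyIntegrable] with t ht
  rw [this]
  exact (ht 0).const_sub _

lemma absolutelyContinuousOnInterval_tail (hu : Integrable u) (a b : ℝ) :
    AbsolutelyContinuousOnInterval (tail u) a b := by
  have h := (hu.intervalIntegrable (a := a) (b := b)
    ).absolutelyContinuousOnInterval_intervalIntegral (c := b) (by simp)
  rw [absolutelyContinuousOnInterval_iff] at h ⊢
  intro ε hε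
  obtain ⟨δ, hδ, H⟩ := h ε hε
  refine ⟨δ, hδ, fun E hE hE' => ?_⟩
  refine lt_of_eq_of_lt (Finset.sum_congr rfl fun i _ => ?_) (H E hE hE')
  rw [dist_eq, dist_eq, tail_sub hu, intervalIntegral.integral_interval_sub_left
    hu.intervalIntegrable hu.intervalIntegrable, intervalIntegral.integral_symm, abs_neg]

lemma abs_rpow_sub_rpow_le_mul {α m x y : ℝ} (hα0 : 0 ≤ α) (hα : α ≤ 1) (hm : 0 < m) (hx : m ≤ x)
    (hy : m ≤ y) : |x ^ α - y ^ α| ≤ α * m ^ (α - 1) * |x - y| := by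
  have key := (convex_Ici m).norm_image_sub_le_of_norm_hasDerivWithin_le
    (f := fun t => t ^ α) (f' := fun t => α * t ^ (α - 1)) (C := α * m ^ (α - 1))
    (fun t ht => (hasDerivAt_rpow_const (Or.inl (hm.trans_le ht).ne')).hasDerivWithinAt)
    (fun t ht => ?_) (show y ∈ Ici m from hy) (show x ∈ Ici m from hx)
  · simpa using key
  · have ht' : 0 < t := hm.trans_le ht
    rw [norm_of_nonneg (by positivity)]
    exact mul_le_mul_of_nonneg_left (rpow_le_rpow_of_nonpos hm ht (by linarith)) hα0

lemma integral_rpow_tail_mul {α : ℝ} (hα0 : 0 < α) (hα : α < 1) (hu : Integrable u)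
    (h0 : ∀ t, 0 ≤ u t) (hab : a ≤ b) (hb : 0 < tail u b) :
    ∫ s in a..b, α * tail u s ^ (α - 1) * u s = tail u a ^ α - tail u b ^ α := by
  have hanti := tail_antitone hu h0
  have hlip : LipschitzOnWith (α * tail u b ^ (α - 1)).toNNReal (fun x => x ^ α)
      (Ici (tail u b)) := by
    refine LipschitzOnWith.of_dist_le_mul fun x hx y hy => ?_
    rw [coe_toNNReal _ (by positivity)]
    exact abs_rpow_sub_rpow_le_mul hα0.le hα.le hb hx hy
  have hac := hlip.comp_absolutelyContinuousOnInterval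
    (absolutelyContinuousOnInterval_tail hu a b)
    (fun t ht => hanti (by rw [uIcc_of_le hab] at ht; exact ht.2))
  have key := hac.integral_deriv_eq_sub
  rw [← neg_inj, ← intervalIntegral.integral_neg, neg_sub, ← key]
  refine intervalIntegral.integral_congr_ae ?_
  filter_upwards [ae_hasDerivAt_tail hu] with t ht hmem
  have htb : 0 < tail u t := hb.trans_le (hanti (by rw [uIoc_of_le hab] at hmem; exact hmem.2))
  rw [(ht.rpow_const (Or.inl htb.ne')).deriv]
  ring

end tail

end

/-! ### Optimal pairs have positive payoff -/

section

/-- The standing assumptions. -/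
structure Model (θ0 α c : ℝ) (I : ℝ → ℝ) : Prop where
  θ_pos : 0 < θ0
  θ_lt : θ0 < π / 2
  α_pos : 0 < α
  α_lt : α < 1
  c_pos : 0 < c
  mono : Monotone I
  cont : Continuous I
  le_one : ∀ y, I y ≤ 1
  half_le : ∀ y, 1 / 2 ≤ I y

/-- The height reached by the stem at arc length `t`. -/
noncomputable def height (θ : ℝ → ℝ) (t : ℝ) : ℝ := ∫ s in (0 : ℝ)..t, sin (θ s)

/-- An optimal pair of controls, normalised to vanish on the negative axis. -/
structure Optimal (θ0 α c : ℝ) (I θ u : ℝ → ℝ) : Prop where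
  adm : Adm2 θ0 θ u
  zero : ∀ t ≤ 0, u t = 0
  optimal : ∀ θ' u', Adm2 θ0 θ' u' → Payoff θ0 α c I θ' u' ≤ Payoff θ0 α c I θ u

lemma payoff_eq (θ0 α c : ℝ) (I θ u : ℝ → ℝ) : Payoff θ0 α c I θ u =
    ∫ t in Ioi (0 : ℝ), (I (height θ t) * G2 θ0 (θ t) (u t) - c * tail u t ^ α) := rfl

variable {θ0 α c : ℝ} {I θ u : ℝ → ℝ}

namespace Model

variable (M : Model θ0 α c I) {q v : ℝ}
include M

lemma sin_pos : 0 < sin θ0 := sin_pos_of_pos_of_lt_pi M.θ_pos (by linarith [M.θ_lt, pi_pos])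

lemma cos_pos : 0 < cos θ0 :=
  cos_pos_of_mem_Ioo ⟨by linarith [M.θ_pos, pi_pos], M.θ_lt⟩

lemma sin_le (hq : q ∈ Icc θ0 (π / 2)) : sin θ0 ≤ sin q :=
  sin_le_sin_of_le_of_le_pi_div_two (by linarith [M.θ_pos, pi_pos]) hq.2 hq.1

lemma sin_le_cos (hq : q ∈ Icc θ0 (π / 2)) : sin θ0 ≤ cos (q - θ0) := by
  rw [← cos_pi_div_two_sub]
  exact cos_le_cos_of_nonneg_of_le_pi (by linarith [hq.1]) (by linarith [M.θ_pos, pi_pos])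
    (by linarith [hq.2])

lemma cos_sub_pos (hq : q ∈ Icc θ0 (π / 2)) : 0 < cos (q - θ0) :=
  M.sin_pos.trans_le (M.sin_le_cos hq)

lemma G2_nonneg (hq : q ∈ Icc θ0 (π / 2)) (hv : 0 ≤ v) : 0 ≤ G2 θ0 q v := by
  have h := M.cos_sub_pos hq
  refine mul_nonneg ?_ h.le
  rw [sub_nonneg, exp_le_one_iff]
  exact div_nonpos_of_nonpos_of_nonneg (by linarith) h.le

lemma G2_le (hq : q ∈ Icc θ0 (π / 2)) : G2 θ0 q v ≤ v := by
  have h := M.cos_sub_pos hq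
  have := add_one_le_exp (-v / cos (q - θ0))
  calc G2 θ0 q v ≤ (v / cos (q - θ0)) * cos (q - θ0) := by
        refine mul_le_mul_of_nonneg_right ?_ h.le
        rw [neg_div] at this ⊢
        linarith
    _ = v := div_mul_cancel₀ _ h.ne'

end Model

lemma intervalIntegrable_sin (hθ : Measurable θ) (a b : ℝ) :
    IntervalIntegrable (fun t => sin (θ t)) volume a b :=
  (intervalIntegrable_const (c := (1 : ℝ))).mono_fun hθ.sin.aestronglyMeasurable
    (Filter.Eventually.of_forall fun t => by simpa using abs_sin_le_one (θ t))

lemma continuous_height (hθ : Measurable θ) : Continuous (height θ) :=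
  intervalIntegral.continuous_primitive (fun a b => intervalIntegrable_sin hθ a b) 0

lemma height_mono (M : Model θ0 α c I) (hθ : Measurable θ) (h : ∀ t, θ t ∈ Icc θ0 (π / 2)) :
    Monotone (height θ) := by
  intro a b hab
  have h1 : height θ b - height θ a = ∫ s in a..b, sin (θ s) :=
    intervalIntegral.integral_interval_sub_left (intervalIntegrable_sin hθ _ _)
      (intervalIntegrable_sin hθ _ _)
  have := intervalIntegral.integral_nonneg (μ := volume) hab
    (fun t _ => M.sin_pos.le.trans (M.sin_le (h t)))
  linarith

lemma measurable_G2 (hθ : Measurable θ) (hu : Measurable u) :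
    Measurable (fun t => G2 θ0 (θ t) (u t)) := by
  unfold G2
  fun_prop

lemma measurable_gain (M : Model θ0 α c I) (hθ : Measurable θ) (hu : Measurable u) :
    Measurable (fun t => I (height θ t) * G2 θ0 (θ t) (u t)) :=
  (M.cont.comp (continuous_height hθ)).measurable.mul (measurable_G2 hθ hu)

lemma integrableOn_gain (M : Model θ0 α c I) (h : Adm2 θ0 θ u) :
    IntegrableOn (fun t => I (height θ t) * G2 θ0 (θ t) (u t)) (Ioi 0) := by
  obtain ⟨hθ, hu, hθm, hu0, hui⟩ := h
  refine Integrable.mono hui (measurable_gain M hθ hu).aestronglyMeasurable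
    (Filter.Eventually.of_forall fun t => ?_)
  have h1 := M.G2_nonneg (hθm t) (hu0 t)
  have h2 := M.half_le (height θ t)
  rw [norm_of_nonneg (by positivity), norm_of_nonneg (hu0 t)]
  calc I (height θ t) * G2 θ0 (θ t) (u t) ≤ 1 * G2 θ0 (θ t) (u t) :=
        mul_le_mul_of_nonneg_right (M.le_one _) h1
    _ ≤ u t := by rw [one_mul]; exact M.G2_le (hθm t)

lemma integrableOn_payoff (M : Model θ0 α c I) (h : Adm2 θ0 θ u)
    (hc : IntegrableOn (fun t => tail u t ^ α) (Ioi 0)) :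
    IntegrableOn (fun t => I (height θ t) * G2 θ0 (θ t) (u t) - c * tail u t ^ α) (Ioi 0) :=
  (integrableOn_gain M h).sub (hc.const_mul c)

/-- Planting a short vertical strip of leaves gives a positive payoff. -/
lemma exists_payoff_pos (M : Model θ0 α c I) : ∃ θ u, Adm2 θ0 θ u ∧ 0 < Payoff θ0 α c I θ u := by
  obtain ⟨ε, hε, hcε⟩ : ∃ ε > 0, c * ε ^ α ≤ 1 / 8 := by
    refine ⟨(1 / (8 * c)) ^ (1 / α), by have := M.c_pos; positivity, ?_⟩
    have := M.c_pos
    rw [← rpow_mul (by positivity), one_div_mul_cancel M.α_pos.ne', rpow_one]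
    field_simp
    norm_num
  have hθ0 : θ0 ∈ Icc θ0 (π / 2) := ⟨le_rfl, M.θ_lt.le⟩
  set u : ℝ → ℝ := (Ioc 0 ε).indicator fun _ => 1 with hu_def
  have hu0 : ∀ t, 0 ≤ u t := fun t => indicator_nonneg (fun _ _ => zero_le_one) t
  have hui : Integrable u := by
    rw [hu_def, integrable_indicator_iff measurableSet_Ioc]
    simp
  have hadm : Adm2 θ0 (fun _ => θ0) u := ⟨measurable_const,
    measurable_const.indicator measurableSet_Ioc, fun _ => hθ0, hu0, hui.integrableOn⟩
  refine ⟨fun _ => θ0, u, hadm, ?_⟩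
  have htail : ∀ t, 0 < t → tail u t ≤ ε := by
    intro t ht
    have h1 := tail_antitone hui hu0 ht.le
    have h2 : tail u 0 = ε := by
      rw [tail, hu_def, setIntegral_indicator measurableSet_Ioc]
      simp [inter_eq_self_of_subset_right (Ioc_subset_Ioi_self), hε.le]
    linarith
  have htail0 : ∀ t, ε ≤ t → tail u t = 0 := by
    intro t ht
    refine setIntegral_eq_zero_of_forall_eq_zero fun s hs => indicator_of_notMem ?_ _
    exact fun h => not_le.2 (show t < s from hs) (h.2.trans ht)
  rw [payoff_eq]
  have hsplit : ∀ t ∈ Ioi (0 : ℝ), (Ioc 0 ε).indicator (fun _ => (1 / 8 : ℝ)) t ≤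
      I (height (fun _ => θ0) t) * G2 θ0 θ0 (u t) - c * tail u t ^ α := by
    intro t ht
    by_cases hmem : t ∈ Ioc 0 ε
    · rw [indicator_of_mem hmem, hu_def, indicator_of_mem hmem, ← hu_def]
      have h1 : tail u t ^ α ≤ ε ^ α :=
        rpow_le_rpow (tail_nonneg hu0 t) (htail t ht) M.α_pos.le
      have h2 : (1 / 2 : ℝ) ≤ G2 θ0 θ0 1 := by
        have h3 : exp (-1) ≤ 1 / 2 := by
          rw [exp_neg, inv_le_comm₀ (exp_pos _) (by norm_num)]
          linarith [add_one_le_exp (1 : ℝ)]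
        simp [G2]
        linarith
      have h4 := M.half_le (height (fun _ => θ0) t)
      have h5 : 1 / 4 ≤ I (height (fun _ => θ0) t) * G2 θ0 θ0 1 := by nlinarith
      have h6 : c * tail u t ^ α ≤ 1 / 8 :=
        (mul_le_mul_of_nonneg_left h1 M.c_pos.le).trans hcε
      linarith
    · have : ε ≤ t := by
        by_contra hlt
        exact hmem ⟨ht, (not_le.1 hlt).le⟩
      rw [indicator_of_notMem hmem, hu_def, indicator_of_notMem hmem, ← hu_def, htail0 t this,
        zero_rpow M.α_pos.ne']
      simp [G2]
  have hint : IntegrableOn (fun t => tail u t ^ α) (Ioi 0) := by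
    have : IntegrableOn (fun t => (Ioc 0 ε).indicator (fun t => tail u t ^ α) t) (Ioi 0) := by
      refine (integrable_indicator_iff measurableSet_Ioc).2 ?_ |>.integrableOn
      exact ((continuous_tail hui).rpow_const
        (fun _ => Or.inr M.α_pos.le)).integrableOn_Icc.mono_set
        Ioc_subset_Icc_self
    refine this.congr_fun (fun t ht => ?_) measurableSet_Ioi
    by_cases hmem : t ∈ Ioc 0 ε
    · simp [hmem]
    · simp only
      rw [indicator_of_notMem hmem, htail0 t (by
        by_contra hlt
        exact hmem ⟨ht, (not_le.1 hlt).le⟩), zero_rpow M.α_pos.ne']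
  calc (0 : ℝ) < ∫ t in Ioi (0 : ℝ), (Ioc 0 ε).indicator (fun _ => (1 / 8 : ℝ)) t := by
        rw [setIntegral_indicator measurableSet_Ioc,
          inter_eq_self_of_subset_right Ioc_subset_Ioi_self]
        simp [hε.le, hε]
    _ ≤ _ := setIntegral_mono_on
        ((integrable_indicator_iff measurableSet_Ioc).2 (by simp)).integrableOn
        ((integrableOn_gain M hadm).sub (hint.const_mul c)) measurableSet_Ioi hsplit

namespace Optimal

variable (M : Model θ0 α c I) (h : Optimal θ0 α c I θ u)
include M h

omit M in
lemma integrable : Integrable u := by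
  have := (integrable_indicator_iff measurableSet_Ioi).2 h.adm.2.2.2.2
  refine this.congr (Filter.Eventually.of_forall fun t => ?_)
  by_cases ht : 0 < t
  · simp [ht]
  · simp [ht, h.zero t (not_lt.1 ht)]

lemma payoff_pos : 0 < Payoff θ0 α c I θ u := by
  obtain ⟨θ', u', h1, h2⟩ := exists_payoff_pos M
  exact h2.trans_le (h.optimal θ' u' h1)

lemma integrableOn_cost : IntegrableOn (fun t => tail u t ^ α) (Ioi 0) := by
  by_contra hn
  have hpos := h.payoff_pos M
  rw [payoff_eq, integral_undef] at hpos
  · exact lt_irrefl _ hpos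
  · intro hi
    have h1 := (integrableOn_gain M h.adm).sub hi
    refine hn ((h1.const_mul c⁻¹).congr (Filter.Eventually.of_forall fun t => ?_))
    have := M.c_pos.ne'
    simp [this]

lemma not_ae_zero : ¬ ∀ᵐ t, 0 < t → u t = 0 := by
  intro h0
  have hpos := h.payoff_pos M
  rw [payoff_eq] at hpos
  refine hpos.not_ge (setIntegral_nonpos_ae measurableSet_Ioi ?_)
  filter_upwards [h0] with t ht htpos
  have : (0:ℝ) ≤ tail u t ^ α := rpow_nonneg (tail_nonneg h.adm.2.2.2.1 t) _
  have := M.c_pos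
  rw [ht htpos]
  simp only [G2, neg_zero, zero_div, exp_zero, sub_self, zero_mul, mul_zero, zero_sub, neg_nonpos]
  positivity

lemma tail_zero_pos : 0 < tail u 0 := by
  refine lt_of_le_of_ne (tail_nonneg h.adm.2.2.2.1 0) fun h0 => ?_
  exact h.not_ae_zero M ((tail_eq_zero_iff h.integrable h.adm.2.2.2.1).1 h0.symm)

end Optimal

end

/-! ### Variations of the density -/

section

/-- The marginal transport cost of a unit of leaf density at arc length `t`. -/
noncomputable def mult (α c : ℝ) (u : ℝ → ℝ) (t : ℝ) : ℝ :=
  ∫ s in (0 : ℝ)..t, c * α * tail u s ^ (α - 1)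

variable {θ0 α c : ℝ} {I θ u : ℝ → ℝ}

lemma rpow_le_rpow_add {x y : ℝ} (hα0 : 0 ≤ α) (hα : α ≤ 1) (hx : 0 < x) (hy : 0 ≤ y) :
    y ^ α ≤ x ^ α + α * x ^ (α - 1) * (y - x) := by
  have h := rpow_one_add_le_one_add_mul_self (s := y / x - 1) (by
    have : 0 ≤ y / x := by positivity
    linarith) hα0 hα
  rw [add_sub_cancel, div_rpow hy hx.le, div_le_iff₀ (by positivity)] at h
  refine h.trans_eq ?_
  rw [rpow_sub_one hx.ne']
  field_simp

lemma continuous_mult_deriv (hu : Integrable u) {T : ℝ} (hT : 0 < tail u T) :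
    Continuous (fun s => c * α * max (tail u s) (tail u T) ^ (α - 1)) :=
  (((continuous_tail hu).max continuous_const).rpow_const
    (fun _ => Or.inl (hT.trans_le (le_max_right _ _)).ne')).const_mul _

lemma mult_eq (hu : Integrable u) (h0 : ∀ t, 0 ≤ u t) {t T : ℝ} (ht0 : 0 ≤ t) (ht : t ≤ T) :
    mult α c u t = ∫ s in (0 : ℝ)..t, c * α * max (tail u s) (tail u T) ^ (α - 1) := by
  refine intervalIntegral.integral_congr fun s hs => ?_
  rw [uIcc_of_le ht0] at hs
  rw [max_eq_left (tail_antitone hu h0 (hs.2.trans ht))]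

namespace Optimal

variable (M : Model θ0 α c I) (h : Optimal θ0 α c I θ u)
include M h

lemma density_variation {T q : ℝ} (hT0 : 0 < T) (hT : 0 < tail u T) (hq : 0 ≤ q) :
    ∀ᵐ t, t ∈ Ioc 0 T → I (height θ t) * G2 θ0 (θ t) q - mult α c u t * q ≤
      I (height θ t) * G2 θ0 (θ t) (u t) - mult α c u t * u t := by
  obtain ⟨hθ, hu, hθm, hu0, -⟩ := id h.adm
  have hui := h.integrable
  have hα0 := M.α_pos
  have hc := M.c_pos
  have hanti := tail_antitone hui hu0
  have hw := continuous_mult_deriv (α := α) (c := c) hui hT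
  set w : ℝ → ℝ := fun s => c * α * max (tail u s) (tail u T) ^ (α - 1) with hw_def
  set l : ℝ → ℝ := fun t => ∫ s in (0 : ℝ)..t, w s with hl_def
  have hl : Continuous l :=
    intervalIntegral.continuous_primitive (fun _ _ => hw.intervalIntegrable _ _) 0
  set g : ℝ → ℝ := fun t => I (height θ t) * (G2 θ0 (θ t) q - G2 θ0 (θ t) (u t)) - l t * (q - u t)
    with hg
  have hgm : Measurable g := by
    refine ((M.cont.comp (continuous_height hθ)).measurable.mul
      ((measurable_G2 hθ measurable_const).sub (measurable_G2 hθ hu))).sub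
      (hl.measurable.mul (measurable_const.sub hu))
  set B : Set ℝ := Ioc 0 T ∩ {t | 0 < g t} with hB_def
  have hB : MeasurableSet B := measurableSet_Ioc.inter (measurableSet_lt measurable_const hgm)
  have hBT : B ⊆ Ioc 0 T := inter_subset_left
  have hBfin : volume B < ⊤ := (measure_mono hBT).trans_lt (by simp)
  suffices hB0 : volume B = 0 by
    have : ∀ᵐ t, t ∉ B := measure_eq_zero_iff_ae_notMem.1 hB0
    filter_upwards [this] with t ht htT
    have h1 : g t ≤ 0 := by
      by_contra hlt
      exact ht ⟨htT, not_le.1 hlt⟩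
    rw [mult_eq hui hu0 htT.1.le htT.2]
    have h2 : g t = I (height θ t) * (G2 θ0 (θ t) q - G2 θ0 (θ t) (u t)) - l t * (q - u t) := rfl
    have h3 : (∫ s in (0 : ℝ)..t, c * α * max (tail u s) (tail u T) ^ (α - 1)) = l t := rfl
    rw [h3]
    linarith
  set d : ℝ → ℝ := B.indicator fun t => q - u t with hd_def
  have hdi : Integrable d :=
    (integrable_indicator_iff hB).2 ((integrableOn_const hBfin.ne).sub hui.integrableOn)
  set v : ℝ → ℝ := fun t => u t + d t with hv_def
  have hvB : ∀ t ∈ B, v t = q := fun t ht => by simp [hv_def, hd_def, ht]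
  have hvB' : ∀ t ∉ B, v t = u t := fun t ht => by simp [hv_def, hd_def, ht]
  have hv0 : ∀ t, 0 ≤ v t := fun t => by
    by_cases ht : t ∈ B
    · rwa [hvB t ht]
    · rw [hvB' t ht]; exact hu0 t
  have hvi : Integrable v := hui.add hdi
  have hadm : Adm2 θ0 θ v :=
    ⟨hθ, hu.add ((measurable_const.sub hu).indicator hB), hθm, hv0, hvi.integrableOn⟩
  have htv : ∀ t, tail v t = tail u t + tail d t := tail_add hui hdi
  have htd : ∀ t, T ≤ t → tail d t = 0 := fun t ht =>
    setIntegral_eq_zero_of_forall_eq_zero fun s hs =>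
      indicator_of_notMem (fun hsB => not_le.2 (show t < s from hs) ((hBT hsB).2.trans ht)) _
  have htd' : ∀ t, tail d t = ∫ s in t..T, d s := fun t => by
    rw [← tail_sub hdi, htd T le_rfl, sub_zero]
  have hcostu := h.integrableOn_cost M
  have hcostv : IntegrableOn (fun t => tail v t ^ α) (Ioi 0) := by
    rw [← Ioc_union_Ioi_eq_Ioi hT0.le]
    refine IntegrableOn.union ?_ ?_
    · exact (((continuous_tail hvi).rpow_const (fun _ => Or.inr hα0.le)).integrableOn_Icc).mono_set
        Ioc_subset_Icc_self
    · refine (hcostu.mono_set (Ioi_subset_Ioi hT0.le)).congr_fun (fun t ht => ?_) measurableSet_Ioi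
      simp only
      rw [htv, htd t (le_of_lt ht), add_zero]
  have hgd : IntegrableOn (fun t => l t * d t) (Ioc 0 T) := by
    have := (hdi.intervalIntegrable (a := 0) (b := T)).continuousOn_mul hl.continuousOn
    rwa [intervalIntegrable_iff_integrableOn_Ioc_of_le hT0.le] at this
  have hwd : IntegrableOn (fun t => w t * tail d t) (Ioc 0 T) :=
    ((hw.mul (continuous_tail hdi)).integrableOn_Icc).mono_set Ioc_subset_Icc_self
  have hgB : IntegrableOn g B := by
    have h1 := (integrableOn_gain M hadm).mono_set (hBT.trans Ioc_subset_Ioi_self)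
    have h2 := (integrableOn_gain M h.adm).mono_set (hBT.trans Ioc_subset_Ioi_self)
    refine ((h1.sub h2).sub (hgd.mono_set hBT)).congr_fun (fun t ht => ?_) hB
    simp only [Pi.sub_apply, hvB t ht, hg, hd_def, indicator_of_mem ht]
    ring
  have hgwd : IntegrableOn (fun t => l t * d t - w t * tail d t) (Ioc 0 T) := hgd.sub hwd
  have hzero : ∫ t in Ioc 0 T, (l t * d t - w t * tail d t) = 0 := by
    rw [integral_sub hgd hwd, ← intervalIntegral.integral_of_le hT0.le,
      ← intervalIntegral.integral_of_le hT0.le,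
      integral_primitive_mul (hw.intervalIntegrable _ _) hdi.intervalIntegrable]
    simp only [htd', sub_self]
  have hle := h.optimal θ v hadm
  have hsub : (∫ t in Ioi (0 : ℝ), (Ioc 0 T).indicator
      (fun t => B.indicator g t + (l t * d t - w t * tail d t)) t) ≤
      Payoff θ0 α c I θ v - Payoff θ0 α c I θ u := by
    have i1 := integrableOn_payoff M hadm hcostv
    have i2 := integrableOn_payoff M h.adm hcostu
    rw [payoff_eq, payoff_eq, ← integral_sub i1 i2]
    refine setIntegral_mono_on ?_ (i1.sub i2) measurableSet_Ioi fun t ht => ?_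
    · refine ((integrable_indicator_iff measurableSet_Ioc).2 ?_).integrableOn
      exact ((integrable_indicator_iff hB).2 hgB).integrableOn.add (hgd.sub hwd)
    · by_cases htT : t ∈ Ioc 0 T
      · rw [indicator_of_mem htT]
        have hpos : 0 < tail u t := hT.trans_le (hanti htT.2)
        have key := rpow_le_rpow_add (y := tail v t) hα0.le M.α_lt.le hpos (tail_nonneg hv0 t)
        have hwt : w t = c * α * tail u t ^ (α - 1) := by
          simp only [hw_def, max_eq_left (hanti htT.2)]
        have key2 : c * tail v t ^ α ≤ c * tail u t ^ α + w t * tail d t := by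
          rw [hwt]
          have := mul_le_mul_of_nonneg_left key hc.le
          have e : tail v t - tail u t = tail d t := by rw [htv]; ring
          rw [e] at this
          linarith
        have key3 : B.indicator g t + l t * d t =
            I (height θ t) * (G2 θ0 (θ t) (v t) - G2 θ0 (θ t) (u t)) := by
          by_cases hb : t ∈ B
          · simp only [indicator_of_mem hb, hg, hd_def, hvB t hb]
            ring
          · simp [indicator_of_notMem hb, hd_def, hvB' t hb]
        linarith
      · have ht' : T < t := by
          by_contra hlt
          exact htT ⟨ht, not_lt.1 hlt⟩
        rw [indicator_of_notMem htT, hvB' t (fun hb => htT (hBT hb)), htv, htd t ht'.le, add_zero]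
        simp
  have hfin : ∫ t in B, g t ≤ 0 := by
    rw [setIntegral_indicator measurableSet_Ioc, inter_eq_self_of_subset_right Ioc_subset_Ioi_self,
      integral_add ((integrable_indicator_iff hB).2 hgB).integrableOn hgwd, hzero,
      setIntegral_indicator hB, inter_eq_self_of_subset_right hBT] at hsub
    linarith
  by_contra hne
  have := (setIntegral_pos_iff_support_of_nonneg_ae
    ((ae_restrict_iff' hB).2 (Filter.Eventually.of_forall fun t ht => le_of_lt ht.2)) hgB).2 (by
      have : Function.support g ∩ B = B := inter_eq_right.2 fun t ht => (ne_of_lt ht.2).symm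
      rw [this]; exact pos_iff_ne_zero.2 hne)
  linarith

end Optimal

end

/-! ### The density law and the length of the stem -/

section

variable {θ0 α c : ℝ} {I θ u : ℝ → ℝ}

/-- The maximiser of `q ↦ w (1 - e^{-q/K}) K - l q` over `q ≥ 0`. -/
lemma eq_mul_ell {w K l U : ℝ} (hw : 0 < w) (hK : 0 < K) (hl : 0 < l) (hU : 0 ≤ U)
    (h : ∀ q : ℚ, (0 : ℝ) ≤ q → w * ((1 - exp (-(q : ℝ) / K)) * K) - l * q ≤
      w * ((1 - exp (-U / K)) * K) - l * U) : U = K * ell w l := by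
  have hreal : ∀ q : ℝ, 0 ≤ q → w * ((1 - exp (-q / K)) * K) - l * q ≤
      w * ((1 - exp (-U / K)) * K) - l * U := by
    have hc : Continuous fun q : ℝ => w * ((1 - exp (-q / K)) * K) - l * q := by fun_prop
    have hclosed := isClosed_le hc (continuous_const (y := w * ((1 - exp (-U / K)) * K) - l * U))
    intro q hq
    rcases hq.eq_or_lt with rfl | hq
    · simpa using h 0 (by simp)
    by_contra! hlt
    obtain ⟨ε, hε, hb⟩ := Metric.mem_nhds_iff.1 (hc.continuousAt.eventually (lt_mem_nhds hlt))
    obtain ⟨r, hr1, hr2⟩ := exists_rat_btwn (show q < q + ε by linarith)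
    have : (r : ℝ) ∈ Metric.ball q ε := by
      rw [Metric.mem_ball, dist_eq, abs_lt]
      constructor <;> linarith
    exact not_lt.2 (h r (by linarith)) (hb this)
  obtain ⟨p, hp⟩ : ∃ p, p = U / K := ⟨_, rfl⟩
  have hUp : U = K * p := by rw [hp]; field_simp
  have hp0 : 0 ≤ p := by rw [hp]; positivity
  have key := hreal (K * ell w l) (mul_nonneg hK.le ell_nonneg)
  rw [hUp, neg_div, neg_div, mul_div_cancel_left₀ _ hK.ne', mul_div_cancel_left₀ _ hK.ne'] at key
  rw [hUp]
  congr 1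
  have key2 : w * (1 - exp (-ell w l)) - l * ell w l ≤ w * (1 - exp (-p)) - l * p := by
    have : K * (w * (1 - exp (-ell w l)) - l * ell w l) ≤ K * (w * (1 - exp (-p)) - l * p) := by
      linarith
    exact le_of_mul_le_mul_left this hK
  by_contra hne
  rcases le_or_gt w l with hwl | hwl
  · rw [ell_eq_zero hl hw.le hwl] at key2 hne
    have h1 := add_one_lt_exp (neg_ne_zero.2 hne)
    simp only [neg_zero, exp_zero, sub_self, mul_zero] at key2
    have h2 : w * (1 - exp (-p)) < w * p := mul_lt_mul_of_pos_left (by linarith) hw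
    have h3 : w * p ≤ l * p := mul_le_mul_of_nonneg_right hwl hp0
    linarith
  · have hell : ell w l = log (w / l) :=
      max_eq_right (log_nonneg (by rw [le_div_iff₀ hl]; linarith))
    have hexp : exp (-ell w l) = l / w := by
      rw [hell, exp_neg, exp_log (by positivity), inv_div]
    have h1 := add_one_lt_exp (sub_ne_zero.2 (Ne.symm hne))
    have h2 : exp (ell w l - p) = w / l * exp (-p) := by
      rw [sub_eq_add_neg, exp_add, hell, exp_log (by positivity)]
    rw [hexp] at key2
    rw [h2] at h1
    have h3 := mul_lt_mul_of_pos_left h1 hl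
    have h4 : l * (w / l * exp (-p)) = w * exp (-p) := by field_simp
    have h5 : w * (1 - l / w) = w - l := by field_simp
    rw [h4] at h3
    rw [h5] at key2
    linarith

lemma ae_eq_zero_of_tail_eq_zero (hu : Integrable u) (h0 : ∀ t, 0 ≤ u t) :
    ∀ᵐ t, tail u t = 0 → u t = 0 := by
  filter_upwards [ae_hasDerivAt_tail hu] with t ht htu
  have : IsLocalMin (tail u) t :=
    Filter.Eventually.of_forall fun s => by rw [htu]; exact tail_nonneg h0 s
  simpa using this.hasDerivAt_eq_zero ht

lemma mult_sub (hu : Integrable u) (h0 : ∀ t, 0 ≤ u t) {s t : ℝ} (hs : 0 ≤ s) (hst : s ≤ t)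
    (ht : 0 < tail u t) :
    mult α c u t - mult α c u s = ∫ r in s..t, c * α * tail u r ^ (α - 1) := by
  have hi : ∀ a b, a ≤ t → b ≤ t →
      IntervalIntegrable (fun s => c * α * tail u s ^ (α - 1)) volume a b := fun a b ha hb => by
    refine ((continuous_mult_deriv (α := α) (c := c) hu ht).intervalIntegrable a b).congr
      fun r hr => ?_
    have hr' : r ≤ t := hr.2.trans (max_le ha hb)
    simp only [max_eq_left (tail_antitone hu h0 hr')]
  exact intervalIntegral.integral_interval_sub_left (hi _ _ (hs.trans hst) le_rfl)
    (hi _ _ (hs.trans hst) hst)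

lemma le_mult_sub (hα : 0 < α) (hα1 : α < 1) (hc : 0 < c) (hu : Integrable u) (h0 : ∀ t, 0 ≤ u t)
    {s t : ℝ} (hs : 0 ≤ s) (hst : s ≤ t)
    (ht : 0 < tail u t) :
    c * α * tail u 0 ^ (α - 1) * (t - s) ≤ mult α c u t - mult α c u s := by
  rw [mult_sub hu h0 hs hst ht]
  have hi : IntervalIntegrable (fun s => c * α * tail u s ^ (α - 1)) volume s t := by
    refine ((continuous_mult_deriv (α := α) (c := c) hu ht).intervalIntegrable s t).congr
      fun r hr => ?_
    have hr' : r ≤ t := hr.2.trans (max_le hst le_rfl)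
    simp only [max_eq_left (tail_antitone hu h0 hr')]
  have := intervalIntegral.integral_mono_on hst
    (intervalIntegrable_const (c := c * α * tail u 0 ^ (α - 1))) hi (fun r hr => by
      refine mul_le_mul_of_nonneg_left ?_ (by positivity)
      exact rpow_le_rpow_of_nonpos (ht.trans_le (tail_antitone hu h0 hr.2))
        (tail_antitone hu h0 (hs.trans hr.1)) (by linarith))
  rw [intervalIntegral.integral_const, smul_eq_mul] at this
  linarith

lemma mult_zero : mult α c u 0 = 0 := by simp [mult]

namespace Optimal

variable (M : Model θ0 α c I) (h : Optimal θ0 α c I θ u)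
include M h

lemma mult_pos {t : ℝ} (ht : 0 < t) (htu : 0 < tail u t) : 0 < mult α c u t := by
  have h1 := le_mult_sub M.α_pos M.α_lt M.c_pos h.integrable h.adm.2.2.2.1 le_rfl ht.le htu
  have h2 := h.tail_zero_pos M
  have := M.α_pos
  have := M.c_pos
  rw [mult_zero, sub_zero, sub_zero] at h1
  exact lt_of_lt_of_le (by positivity) h1

lemma density_eq : ∀ᵐ t, 0 < t → 0 < tail u t →
    u t = cos (θ t - θ0) * ell (I (height θ t)) (mult α c u t) := by
  have h1 : ∀ q T : ℚ, ∀ᵐ t : ℝ, (0 : ℝ) < T → 0 < tail u T → (0 : ℝ) ≤ q → t ∈ Ioc (0 : ℝ) T →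
      I (height θ t) * G2 θ0 (θ t) q - mult α c u t * q ≤
      I (height θ t) * G2 θ0 (θ t) (u t) - mult α c u t * u t := by
    intro q T
    by_cases hT : (0 : ℝ) < T ∧ 0 < tail u T ∧ (0 : ℝ) ≤ q
    · filter_upwards [h.density_variation M hT.1 hT.2.1 hT.2.2] with t ht _ _ _ using ht
    · exact Filter.Eventually.of_forall fun t a b c => absurd ⟨a, b, c⟩ hT
  filter_upwards [ae_all_iff.2 fun q => ae_all_iff.2 (h1 q)] with t ht ht0 htu
  obtain ⟨ε, hε, hb⟩ := Metric.mem_nhds_iff.1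
    ((continuous_tail h.integrable).continuousAt.eventually (lt_mem_nhds htu))
  obtain ⟨T, hT1, hT2⟩ := exists_rat_btwn (show t < t + ε by linarith)
  have hTu : 0 < tail u T := hb (by
    rw [Metric.mem_ball, dist_eq, abs_lt]; constructor <;> linarith)
  exact eq_mul_ell (by linarith [M.half_le (height θ t)]) (M.cos_sub_pos (h.adm.2.2.1 t))
    (h.mult_pos M ht0 htu) (h.adm.2.2.2.1 t)
    fun q hq => ht q T (ht0.trans hT1) hTu hq ⟨ht0, hT1.le⟩

lemma mult_lt_one {t : ℝ} (ht : 0 ≤ t) (htu : 0 < tail u t) : mult α c u t < 1 := by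
  by_contra! hle
  refine htu.ne' ((tail_eq_zero_iff h.integrable h.adm.2.2.2.1).2 ?_)
  filter_upwards [h.density_eq M, ae_eq_zero_of_tail_eq_zero h.integrable h.adm.2.2.2.1]
    with s hs hs' hts
  by_cases hsu : 0 < tail u s
  · have hmult := le_mult_sub M.α_pos M.α_lt M.c_pos h.integrable h.adm.2.2.2.1 ht hts.le hsu
    have : 0 ≤ c * α * tail u 0 ^ (α - 1) * (s - t) := by
      have := M.α_pos
      have := M.c_pos
      have := h.tail_zero_pos M
      have : 0 ≤ s - t := by linarith
      positivity
    rw [hs (ht.trans_lt hts) hsu, ell_eq_zero (by linarith)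
      (by linarith [M.half_le (height θ s)]) (by linarith [M.le_one (height θ s)]), mul_zero]
  · exact hs' (le_antisymm (not_lt.1 hsu) (tail_nonneg h.adm.2.2.2.1 s))

/-- The stem has a finite positive length. -/
lemma exists_length : ∃ T > 0, (∀ t < T, 0 < tail u t) ∧ ∀ t ≥ T, tail u t = 0 := by
  have hu := h.integrable
  have hu0 := h.adm.2.2.2.1
  have hα := M.α_pos
  have hc := M.c_pos
  have hz := h.tail_zero_pos M
  have hanti := tail_antitone hu hu0
  set S : Set ℝ := {t | 0 ≤ t ∧ tail u t = 0} with hS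
  have hclosed : IsClosed S :=
    isClosed_Ici.inter (isClosed_eq (continuous_tail hu) continuous_const)
  have hbdd : BddBelow S := ⟨0, fun t ht => ht.1⟩
  have hne : S.Nonempty := by
    by_contra hempty
    obtain ⟨t, ht, ht1⟩ : ∃ t : ℝ, 0 ≤ t ∧ c * α * tail u 0 ^ (α - 1) * t = 1 :=
      ⟨(c * α * tail u 0 ^ (α - 1))⁻¹, by positivity, mul_inv_cancel₀ (by positivity)⟩
    have htu : 0 < tail u t := lt_of_le_of_ne (tail_nonneg hu0 t) fun h0 =>
      hempty ⟨t, ht, h0.symm⟩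
    have h1 := le_mult_sub hα M.α_lt hc hu hu0 le_rfl ht htu
    rw [mult_zero, sub_zero, sub_zero] at h1
    linarith [h.mult_lt_one M ht htu]
  have hmem := hclosed.csInf_mem hne hbdd
  refine ⟨sInf S, lt_of_le_of_ne hmem.1 fun h0 => hz.ne' ?_, fun t ht => ?_, fun t ht => ?_⟩
  · have := hmem.2
    rwa [← h0] at this
  · refine lt_of_le_of_ne (tail_nonneg hu0 t) fun h0 => ?_
    rcases le_or_gt 0 t with htpos | htneg
    · exact not_le.2 ht (csInf_le hbdd ⟨htpos, h0.symm⟩)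
    · exact absurd (hanti htneg.le) (by rw [← h0]; exact not_le.2 hz)
  · exact le_antisymm ((hanti ht).trans_eq hmem.2) (tail_nonneg hu0 t)

lemma integrableOn_rpow_tail {T : ℝ} (hT0 : 0 < T) (hT : ∀ t < T, 0 < tail u t) :
    IntegrableOn (fun s => c * α * tail u s ^ (α - 1)) (Ioc 0 T) := by
  have hu := h.integrable
  have hu0 := h.adm.2.2.2.1
  have hα := M.α_pos
  have hc := M.c_pos
  have hnn : ∀ s, 0 ≤ c * α * tail u s ^ (α - 1) := fun s => by
    have := tail_nonneg hu0 s
    positivity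
  have hb : ∀ n : ℕ, T - T / (n + 1) < T ∧ 0 ≤ T - T / (n + 1) := fun n => by
    have h1 : 0 < T / ((n : ℝ) + 1) := by positivity
    have h2 : T / ((n : ℝ) + 1) ≤ T := div_le_self hT0.le (by linarith [n.cast_nonneg (α := ℝ)])
    constructor <;> linarith
  refine integrableOn_Ioc_of_intervalIntegral_norm_bounded_right (I := 1) (l := Filter.atTop)
    (b := fun n : ℕ => T - T / (n + 1)) (fun n => ?_) ?_ (Filter.Eventually.of_forall fun n => ?_)
  · refine (continuous_mult_deriv (α := α) (c := c) hu (hT _ (hb n).1)).integrableOn_Icc.mono_set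
      Ioc_subset_Icc_self |>.congr_fun (fun t ht => ?_) measurableSet_Ioc
    simp only [max_eq_left (tail_antitone hu hu0 ht.2)]
  · simpa using (tendsto_const_div_atTop_nhds_zero_nat T).comp (Filter.tendsto_add_atTop_nat 1)
      |>.const_sub T
  · simp only [norm_of_nonneg (hnn _)]
    have := (h.mult_lt_one M (hb n).2 (hT _ (hb n).1)).le
    rwa [mult, intervalIntegral.integral_of_le (hb n).2] at this

end Optimal

end

/-! ### Variations at the tip -/

section

variable {θ0 α c : ℝ} {I θ u : ℝ → ℝ}

lemma exp_neg_le_quadratic {p : ℝ} (hp : 0 ≤ p) : exp (-p) ≤ 1 - p + p ^ 2 / 2 := by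
  have h1 := quadratic_le_exp_of_nonneg hp
  have h2 : 0 < 1 + p + p ^ 2 / 2 := by positivity
  rw [exp_neg]
  calc (exp p)⁻¹ ≤ (1 + p + p ^ 2 / 2)⁻¹ := inv_anti₀ h2 h1
    _ ≤ 1 - p + p ^ 2 / 2 := by
      rw [inv_le_iff_one_le_mul₀ h2]
      nlinarith [sq_nonneg (p ^ 2)]

lemma Model.le_G2 (M : Model θ0 α c I) {q a : ℝ} (hq : q ∈ Icc θ0 (π / 2)) (ha : 0 ≤ a) :
    a - a ^ 2 / (2 * sin θ0) ≤ G2 θ0 q a := by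
  have h1 := M.sin_le_cos hq
  have h0 := M.sin_pos
  have hK : 0 < cos (q - θ0) := h0.trans_le h1
  have h2 := exp_neg_le_quadratic (p := a / cos (q - θ0)) (by positivity)
  have h3 : (a / cos (q - θ0) - (a / cos (q - θ0)) ^ 2 / 2) * cos (q - θ0) ≤ G2 θ0 q a := by
    refine mul_le_mul_of_nonneg_right ?_ hK.le
    rw [neg_div]; linarith
  refine le_trans ?_ h3
  have h4 : (a / cos (q - θ0) - (a / cos (q - θ0)) ^ 2 / 2) * cos (q - θ0) =
      a - a ^ 2 / (2 * cos (q - θ0)) := by field_simp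
  rw [h4]
  gcongr

namespace Optimal

variable (M : Model θ0 α c I) (h : Optimal θ0 α c I θ u)
include M h

/-- Extending the tip of the stem by a strip of length `ε` and density `a` does not pay off. -/
lemma strip_gain_le {T a ε : ℝ} (hT0 : 0 < T) (hT : ∀ t < T, 0 < tail u t)
    (hT' : ∀ t ≥ T, tail u t = 0) (ha : 0 < a) (hε : 0 < ε) :
    ε * (I (height θ T) * (a - a ^ 2 / (2 * sin θ0)) - c * (a * ε) ^ α) ≤
      a * ε * mult α c u T := by
  obtain ⟨hθ, hu, hθm, hu0, -⟩ := id h.adm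
  have hui := h.integrable
  have hα0 := M.α_pos
  have hc := M.c_pos
  have hw := h.integrableOn_rpow_tail M hT0 hT
  set d : ℝ → ℝ := (Ioc T (T + ε)).indicator fun _ => a with hd_def
  have hdi : Integrable d := (integrable_indicator_iff measurableSet_Ioc).2 (by simp)
  have hd0 : ∀ t, 0 ≤ d t := fun t => indicator_nonneg (fun _ _ => ha.le) t
  have htd : ∀ t ≤ T, tail d t = a * ε := fun t ht => by
    rw [tail, hd_def, setIntegral_indicator measurableSet_Ioc,
      inter_eq_self_of_subset_right
        (show Ioc T (T + ε) ⊆ Ioi t from fun s hs => ht.trans_lt hs.1)]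
    simp [hε.le, mul_comm]
  have htd1 : ∀ t, T ≤ t → tail d t ≤ a * ε := fun t ht =>
    (tail_antitone hdi hd0 ht).trans_eq (htd T le_rfl)
  have htd2 : ∀ t, T + ε ≤ t → tail d t = 0 := fun t ht =>
    setIntegral_eq_zero_of_forall_eq_zero fun s hs =>
      indicator_of_notMem (fun hsB => not_le.2 (show t < s from hs) (hsB.2.trans ht)) _
  set v : ℝ → ℝ := fun t => u t + d t with hv_def
  have hvi : Integrable v := hui.add hdi
  have hv0 : ∀ t, 0 ≤ v t := fun t => add_nonneg (hu0 t) (hd0 t)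
  have hadm : Adm2 θ0 θ v :=
    ⟨hθ, hu.add (measurable_const.indicator measurableSet_Ioc), hθm, hv0, hvi.integrableOn⟩
  have htv : ∀ t, tail v t = tail u t + tail d t := tail_add hui hdi
  have hcostu := h.integrableOn_cost M
  have hTε : 0 ≤ T + ε := by positivity
  have hcostv : IntegrableOn (fun t => tail v t ^ α) (Ioi 0) := by
    rw [← Ioc_union_Ioi_eq_Ioi hTε]
    refine IntegrableOn.union ?_ ?_
    · exact (((continuous_tail hvi).rpow_const (fun _ => Or.inr hα0.le)).integrableOn_Icc).mono_set
        Ioc_subset_Icc_self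
    · refine (hcostu.mono_set (Ioi_subset_Ioi hTε)).congr_fun (fun t ht => ?_) measurableSet_Ioi
      simp only
      rw [htv, htd2 t (le_of_lt ht), add_zero]
  set k : ℝ := I (height θ T) * (a - a ^ 2 / (2 * sin θ0)) - c * (a * ε) ^ α with hk
  have j1 : IntegrableOn (fun t => c * α * tail u t ^ (α - 1) * (a * ε)) (Ioc 0 T) :=
    hw.mul_const _
  have i1 := integrableOn_payoff M hadm hcostv
  have i2 := integrableOn_payoff M h.adm hcostu
  have hle := h.optimal θ v hadm
  have hsub : ∫ t in Ioi (0 : ℝ), ((Ioc T (T + ε)).indicator (fun _ => k) t -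
      (Ioc 0 T).indicator (fun t => c * α * tail u t ^ (α - 1) * (a * ε)) t) ≤
      Payoff θ0 α c I θ v - Payoff θ0 α c I θ u := by
    rw [payoff_eq, payoff_eq, ← integral_sub i1 i2]
    have hne : ∀ᵐ t : ℝ, t ≠ T := by simp [ae_iff, measure_singleton]
    refine setIntegral_mono_ae_restrict ?_ (i1.sub i2) ((ae_restrict_iff' measurableSet_Ioi).2 ?_)
    · refine Integrable.integrableOn (Integrable.sub ?_ ?_)
      · exact (integrable_indicator_iff measurableSet_Ioc).2 (by simp)
      · exact (integrable_indicator_iff measurableSet_Ioc).2 j1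
    filter_upwards [hne, ae_eq_zero_of_tail_eq_zero hui hu0] with t htT hut ht0
    rcases lt_or_gt_of_ne htT with hlt | hlt
    · have hpos := hT t hlt
      have hdt : d t = 0 := indicator_of_notMem (fun hm => not_lt.2 hlt.le hm.1) _
      have hvt : v t = u t := by simp [hv_def, hdt]
      have hmem : t ∈ Ioc 0 T := ⟨ht0, hlt.le⟩
      rw [indicator_of_notMem (fun hm => not_lt.2 hlt.le hm.1), indicator_of_mem hmem, hvt]
      have key := rpow_le_rpow_add (y := tail v t) hα0.le M.α_lt.le hpos (tail_nonneg hv0 t)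
      have e : tail v t - tail u t = a * ε := by rw [htv, htd t hlt.le]; ring
      rw [e] at key
      have := mul_le_mul_of_nonneg_left key hc.le
      linarith
    · have hut0 := hut (hT' t hlt.le)
      have hzero : t ∉ Ioc 0 T := fun hm => not_lt.2 hm.2 hlt
      rw [indicator_of_notMem hzero, hut0, hT' t hlt.le, zero_rpow hα0.ne']
      have hG0 : G2 θ0 (θ t) 0 = 0 := by simp [G2]
      rw [hG0, htv, hT' t hlt.le]
      by_cases hm : t ∈ Ioc T (T + ε)
      · have hvt : v t = a := by simp [hv_def, hut0, hd_def, hm]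
        rw [indicator_of_mem hm, hvt]
        have h1 : tail d t ^ α ≤ (a * ε) ^ α :=
          rpow_le_rpow (tail_nonneg hd0 t) (htd1 t hlt.le) hα0.le
        have h2 : I (height θ T) * (a - a ^ 2 / (2 * sin θ0)) ≤ I (height θ t) * G2 θ0 (θ t) a := by
          have h3 := M.mono (height_mono M hθ hθm hlt.le)
          have h4 := M.half_le (height θ T)
          calc _ ≤ I (height θ T) * G2 θ0 (θ t) a :=
                mul_le_mul_of_nonneg_left (M.le_G2 (hθm t) ha.le) (by linarith)
            _ ≤ _ := mul_le_mul_of_nonneg_right h3 (M.G2_nonneg (hθm t) ha.le)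
        have h5 := mul_le_mul_of_nonneg_left h1 hc.le
        rw [zero_add, hk]
        linarith
      · have hvt : v t = 0 := by simp [hv_def, hut0, hd_def, hm]
        have : T + ε ≤ t := by
          by_contra hcon
          exact hm ⟨hlt, (not_le.1 hcon).le⟩
        rw [indicator_of_notMem hm, hvt, hG0, htd2 t this]
        simp [zero_rpow hα0.ne']
  have k1 : IntegrableOn ((Ioc T (T + ε)).indicator fun _ => k) (Ioi 0) :=
    Integrable.integrableOn ((integrable_indicator_iff measurableSet_Ioc).2 (by simp))
  have k2 : IntegrableOn ((Ioc 0 T).indicator fun t => c * α * tail u t ^ (α - 1) * (a * ε))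
      (Ioi 0) := Integrable.integrableOn ((integrable_indicator_iff measurableSet_Ioc).2 j1)
  rw [integral_sub k1 k2,
    setIntegral_indicator measurableSet_Ioc, setIntegral_indicator measurableSet_Ioc,
    inter_eq_self_of_subset_right (show Ioc 0 T ⊆ Ioi 0 from Ioc_subset_Ioi_self),
    inter_eq_self_of_subset_right (show Ioc T (T + ε) ⊆ Ioi 0 from fun s hs => hT0.trans hs.1),
    integral_mul_const, setIntegral_const] at hsub
  have hmult : mult α c u T = ∫ t in Ioc 0 T, c * α * tail u t ^ (α - 1) := by
    rw [mult, intervalIntegral.integral_of_le hT0.le]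
  rw [← hmult] at hsub
  simp [hε.le] at hsub
  linarith

/-- The marginal cost at the tip is at least the light intensity there. -/
lemma light_tip_le {T : ℝ} (hT0 : 0 < T) (hT : ∀ t < T, 0 < tail u t)
    (hT' : ∀ t ≥ T, tail u t = 0) : I (height θ T) ≤ mult α c u T := by
  have hα0 := M.α_pos
  have hc := M.c_pos
  have hs := M.sin_pos
  have key : ∀ a : ℝ, 0 < a → I (height θ T) * (1 - a / (2 * sin θ0)) - c * a ≤ mult α c u T := by
    intro a ha
    obtain ⟨ε, hε, hεa⟩ : ∃ ε, 0 < ε ∧ (a * ε) ^ α = a ^ 2 := by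
      refine ⟨(a ^ 2) ^ (1 / α) / a, by positivity, ?_⟩
      rw [mul_div_cancel₀ _ ha.ne', ← rpow_mul (by positivity), one_div_mul_cancel hα0.ne',
        rpow_one]
    have h1 := h.strip_gain_le M hT0 hT hT' ha hε
    rw [hεa] at h1
    have h2 : a * ε * (I (height θ T) * (1 - a / (2 * sin θ0)) - c * a) ≤
        a * ε * mult α c u T := by
      refine le_trans (le_of_eq ?_) h1
      ring
    exact le_of_mul_le_mul_left h2 (by positivity)
  refine le_of_forall_pos_le_add fun η hη => ?_
  have hD : 0 < 1 / (2 * sin θ0) + c := by positivity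
  have h1 := key (η / (1 / (2 * sin θ0) + c)) (by positivity)
  have h2 : I (height θ T) * (η / (1 / (2 * sin θ0) + c) / (2 * sin θ0)) ≤
      1 * (η / (1 / (2 * sin θ0) + c) / (2 * sin θ0)) :=
    mul_le_mul_of_nonneg_right (M.le_one _) (by positivity)
  have h3 : 1 * (η / (1 / (2 * sin θ0) + c) / (2 * sin θ0)) +
      c * (η / (1 / (2 * sin θ0) + c)) = η := by
    field_simp
  linarith

end Optimal

end

/-! ### Variations of the angle -/

section

variable {θ0 α c : ℝ} {I θ u : ℝ → ℝ}

namespace Optimal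

variable (M : Model θ0 α c I) (h : Optimal θ0 α c I θ u)
include M h

lemma angle_variation {q : ℝ} (hq : q ∈ Icc θ0 (π / 2)) : ∀ᵐ t, 0 < t →
    (I (height θ t) * G2 θ0 q (u t / (sin (θ t) / sin q)) - c * tail u t ^ α) *
      (sin (θ t) / sin q) ≤ I (height θ t) * G2 θ0 (θ t) (u t) - c * tail u t ^ α := by
  obtain ⟨hθ, hu, hθm, hu0, -⟩ := id h.adm
  have hui := h.integrable
  have hs := M.sin_pos
  have hsq := hs.trans_le (M.sin_le hq)
  have hsθ : ∀ t, 0 < sin (θ t) := fun t => hs.trans_le (M.sin_le (hθm t))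
  set F : ℝ → ℝ := fun t => I (height θ t) * G2 θ0 (θ t) (u t) - c * tail u t ^ α with hF
  set F' : ℝ → ℝ := fun t =>
    (I (height θ t) * G2 θ0 q (u t / (sin (θ t) / sin q)) - c * tail u t ^ α) *
      (sin (θ t) / sin q) with hF'
  have hcm : Measurable fun t => c * tail u t ^ α :=
    ((continuous_tail hui).rpow_const fun _ => Or.inr M.α_pos.le).measurable.const_mul c
  have hFm : Measurable F := (measurable_gain M hθ hu).sub hcm
  have hF'm : Measurable F' :=
    (((M.cont.comp (continuous_height hθ)).measurable.mul
      (measurable_G2 measurable_const (hu.div (hθ.sin.div_const _)))).sub hcm).mul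
      (hθ.sin.div_const _)
  set B : Set ℝ := Ioi 0 ∩ {t | F t < F' t} with hB_def
  have hB : MeasurableSet B := measurableSet_Ioi.inter (measurableSet_lt hFm hF'm)
  suffices hB0 : volume B = 0 by
    filter_upwards [measure_eq_zero_iff_ae_notMem.1 hB0] with t ht ht0
    by_contra hlt
    exact ht ⟨ht0, not_le.1 hlt⟩
  classical
  set ψ : ℝ → ℝ := B.piecewise (fun _ => q) θ with hψ
  set ρ : ℝ → ℝ := B.piecewise (fun t => sin (θ t) / sin q) 1 with hρ
  have hψm : Measurable ψ := measurable_const.piecewise hB hθ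
  have hρm : Measurable ρ := (hθ.sin.div_const _).piecewise hB measurable_const
  have hψI : ∀ t, ψ t ∈ Icc θ0 (π / 2) := fun t => by
    by_cases ht : t ∈ B
    · simpa [hψ, ht] using hq
    · simpa [hψ, ht] using hθm t
  have hρl : ∀ t, sin θ0 ≤ ρ t := fun t => by
    by_cases ht : t ∈ B
    · simp only [hρ, piecewise_eq_of_mem _ _ _ ht]
      rw [le_div_iff₀ hsq]
      nlinarith [M.sin_le (hθm t), sin_le_one q]
    · simpa [hρ, ht] using sin_le_one θ0
  have hρu : ∀ t, ρ t ≤ 1 / sin θ0 := fun t => by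
    by_cases ht : t ∈ B
    · simp only [hρ, piecewise_eq_of_mem _ _ _ ht]
      gcongr
      · exact sin_le_one _
      · exact M.sin_le hq
    · simpa [hρ, ht] using (one_le_inv₀ hs).2 (sin_le_one θ0)
  have hρ0 : ∀ t, 0 < ρ t := fun t => hs.trans_le (hρl t)
  have hρsin : ∀ t, ρ t * sin (ψ t) = sin (θ t) := fun t => by
    by_cases ht : t ∈ B
    · simp only [hρ, hψ, piecewise_eq_of_mem _ _ _ ht]
      exact div_mul_cancel₀ _ hsq.ne'
    · simp [hρ, hψ, ht]
  have hρi : LocallyIntegrable ρ :=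
    (locallyIntegrable_const (1 / sin θ0)).mono hρm.aestronglyMeasurable
      (Filter.Eventually.of_forall fun t => by
        rw [norm_of_nonneg (hρ0 t).le, norm_of_nonneg (by positivity)]
        exact hρu t)
  obtain ⟨e, he⟩ := exists_clock hρm hρi hs hρl
  have hes : Measurable e.symm := e.symm.toHomeomorph.continuous.measurable
  set v : ℝ → ℝ := fun x => u (e.symm x) / ρ (e.symm x) with hv
  have hve : ∀ t, ρ t * v (e t) = u t := fun t => by
    simp only [hv, OrderIso.symm_apply_apply]
    exact mul_div_cancel₀ _ (hρ0 t).ne'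
  have hadm : Adm2 θ0 (fun x => ψ (e.symm x)) v := by
    refine ⟨hψm.comp hes, (hu.comp hes).div (hρm.comp hes), fun t => hψI _,
      fun t => div_nonneg (hu0 _) (hρ0 _).le, ?_⟩
    rw [← he.zero, he.integrableOn_Ioi]
    simp only [hve]
    exact hui.integrableOn
  have hheight : ∀ t, height (fun x => ψ (e.symm x)) (e t) = height θ t := fun t => by
    rw [height, height]
    conv_lhs => rw [← he.zero]
    rw [he.integral_eq]
    simp only [OrderIso.symm_apply_apply, hρsin]
  have htail : ∀ t, tail v (e t) = tail u t := fun t => by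
    rw [tail, tail, he.integral_Ioi]
    simp only [hve]
  have hcostu := h.integrableOn_cost M
  have hcostv : IntegrableOn (fun t => tail v t ^ α) (Ioi 0) := by
    rw [← he.zero, he.integrableOn_Ioi]
    simp only [htail]
    refine Integrable.bdd_mul (c := 1 / sin θ0) hcostu hρm.aestronglyMeasurable
      (Filter.Eventually.of_forall fun t => ?_)
    rw [norm_of_nonneg (hρ0 t).le]
    exact hρu t
  have i1 := integrableOn_payoff M hadm hcostv
  have i2 := integrableOn_payoff M h.adm hcostu
  have hle := h.optimal _ _ hadm
  have hint : ∀ t, ρ t * (I (height (fun x => ψ (e.symm x)) (e t)) *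
      G2 θ0 (ψ (e.symm (e t))) (v (e t)) - c * tail v (e t) ^ α) = B.piecewise F' F t := fun t => by
    rw [hheight, htail]
    simp only [hv, OrderIso.symm_apply_apply]
    by_cases ht : t ∈ B
    · simp only [hρ, hψ, hF', piecewise_eq_of_mem _ _ _ ht]
      ring
    · simp [hρ, hψ, hF, ht]
  rw [payoff_eq, payoff_eq] at hle
  rw [← he.zero, he.integrableOn_Ioi] at i1
  conv at hle => enter [1]; rw [← he.zero]
  rw [he.integral_Ioi] at hle
  simp only [hint] at hle i1
  have hnn : ∀ t, 0 ≤ B.piecewise F' F t - F t := fun t => by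
    by_cases ht : t ∈ B
    · simpa [ht] using le_of_lt ht.2
    · simp [ht]
  have hz : ∫ t in Ioi (0 : ℝ), (B.piecewise F' F t - F t) = 0 := by
    refine le_antisymm ?_ (integral_nonneg hnn)
    rw [integral_sub i1 i2]
    linarith
  rw [integral_eq_zero_iff_of_nonneg hnn (i1.sub i2)] at hz
  have hz' := (ae_restrict_iff' measurableSet_Ioi).1 hz
  rw [measure_eq_zero_iff_ae_notMem]
  filter_upwards [hz'] with t ht hmem
  have h1 := ht hmem.1
  simp only [piecewise_eq_of_mem _ _ _ hmem, Pi.zero_apply] at h1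
  have h2 : F t < F' t := hmem.2
  linarith

lemma ae_angle_variation : ∀ᵐ t, 0 < t → ∀ q ∈ Icc θ0 (π / 2),
    (I (height θ t) * G2 θ0 q (u t / (sin (θ t) / sin q)) - c * tail u t ^ α) *
      (sin (θ t) / sin q) ≤ I (height θ t) * G2 θ0 (θ t) (u t) - c * tail u t ^ α := by
  have hclip : ∀ r : ℝ, max θ0 (min r (π / 2)) ∈ Icc θ0 (π / 2) := fun r =>
    ⟨le_max_left _ _, max_le M.θ_lt.le (min_le_right _ _)⟩
  have h1 : ∀ r : ℚ, ∀ᵐ t, 0 < t →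
      (I (height θ t) * G2 θ0 (max θ0 (min (r : ℝ) (π / 2)))
        (u t / (sin (θ t) / sin (max θ0 (min (r : ℝ) (π / 2))))) - c * tail u t ^ α) *
      (sin (θ t) / sin (max θ0 (min (r : ℝ) (π / 2)))) ≤
      I (height θ t) * G2 θ0 (θ t) (u t) - c * tail u t ^ α := fun r =>
    h.angle_variation M (hclip r)
  filter_upwards [ae_all_iff.2 h1] with t ht ht0 q hq
  have hsθ : 0 < sin (θ t) := M.sin_pos.trans_le (M.sin_le (h.adm.2.2.1 t))
  set f : ℝ → ℝ := fun r => (I (height θ t) * G2 θ0 (max θ0 (min r (π / 2)))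
        (u t / (sin (θ t) / sin (max θ0 (min r (π / 2))))) - c * tail u t ^ α) *
      (sin (θ t) / sin (max θ0 (min r (π / 2)))) with hf
  have hsr : ∀ r : ℝ, sin (max θ0 (min r (π / 2))) ≠ 0 := fun r =>
    (M.sin_pos.trans_le (M.sin_le (hclip r))).ne'
  have hcr : ∀ r : ℝ, cos (max θ0 (min r (π / 2)) - θ0) ≠ 0 := fun r =>
    (M.cos_sub_pos (hclip r)).ne'
  have hfc : Continuous f := by
    simp only [hf, G2]
    fun_prop (disch := intros; first
      | exact hsr _ | exact hcr _ | exact div_ne_zero hsθ.ne' (hsr _))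
  have hall : ∀ r : ℝ, f r ≤ I (height θ t) * G2 θ0 (θ t) (u t) - c * tail u t ^ α := fun r =>
    (isClosed_le hfc continuous_const).closure_subset_iff.2
      (by rintro _ ⟨r, rfl⟩; exact ht r ht0) (Rat.denseRange_cast r)
  have := hall q
  simpa [hf, min_eq_left hq.2, max_eq_right hq.1] using this

end Optimal

lemma hasDerivAt_angle {w U E q : ℝ} (hq : 0 < sin q) (hK : 0 < cos (q - θ0)) :
    HasDerivAt (fun x => (w * G2 θ0 x (U / (sin q / sin x)) - E) * (sin q / sin x))
      ((E * cos q - cos θ0 * (w * (1 - exp (-(U / cos (q - θ0))) -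
        U / cos (q - θ0) * exp (-(U / cos (q - θ0)))))) / sin q) q := by
  have hs : HasDerivAt sin (cos q) q := hasDerivAt_sin q
  have hc : HasDerivAt (fun x => cos (x - θ0)) (-sin (q - θ0)) q := by
    simpa using ((hasDerivAt_id' q).sub_const θ0).cos
  have hr : HasDerivAt (fun x => sin q / sin x) (-(cos q / sin q)) q := by
    refine ((hasDerivAt_const q (sin q)).fun_div hs hq.ne').congr_deriv ?_
    field_simp
    ring
  have hU : HasDerivAt (fun x => U / (sin q / sin x)) (U * cos q / sin q) q := by
    refine ((hasDerivAt_const q U).fun_div hr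
      (by rw [div_self hq.ne']; exact one_ne_zero)).congr_deriv ?_
    field_simp
    ring
  have hG := ((((hU.fun_neg.fun_div hc hK.ne').exp).const_sub 1).fun_mul hc)
  refine (((hG.const_mul w).sub_const E).fun_mul hr).congr_deriv ?_
  have e1 : U / (sin q / sin q) = U := by rw [div_self hq.ne', div_one]
  have e2 : cos θ0 = cos q * cos (q - θ0) + sin q * sin (q - θ0) := by
    rw [← cos_sub]; congr 1; ring
  simp only [e1, e2]
  rw [show -U / cos (q - θ0) = -(U / cos (q - θ0)) by ring]
  field_simp
  ring

end

/-! ### The angle law -/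

section

variable {θ0 α c : ℝ} {I θ u : ℝ → ℝ}

lemma capt_eq {x s : ℝ} (hx0 : 0 ≤ x) (hs : 0 < s) :
    capt x s = x * (1 - exp (-ell x s) - ell x s * exp (-ell x s)) := by
  rcases le_total x s with hxs | hxs
  · rw [capt_eq_zero hs hxs]
    have : ell x s = 0 := ell_eq_zero hs hx0 hxs
    simp [this]
  · have hx : 0 < x := hs.trans_le hxs
    have he : ell x s = log (x / s) := max_eq_right (log_nonneg ((one_le_div hs).2 hxs))
    have hexp : exp (-ell x s) = s / x := by
      rw [he, exp_neg, exp_log (by positivity), inv_div]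
    rw [hexp, capt, max_eq_left hxs, he]
    field_simp

lemma Model.angle_eq (M : Model θ0 α c I) {w U E q l : ℝ} (hq : q ∈ Icc θ0 (π / 2)) (hE : 0 < E)
    (hw : 0 ≤ w) (hl : 0 < l) (hU : U = cos (q - θ0) * ell w l)
    (h : ∀ x ∈ Icc θ0 (π / 2), (w * G2 θ0 x (U / (sin q / sin x)) - E) * (sin q / sin x) ≤
      w * G2 θ0 q U - E) : cos q = cos θ0 * ratio (capt w l) E := by
  have hS := M.sin_pos.trans_le (M.sin_le hq)
  have hK := M.cos_sub_pos hq
  have hd := hasDerivAt_angle (w := w) (U := U) (E := E) hS hK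
  have hp : U / cos (q - θ0) = ell w l := by rw [hU, mul_div_cancel_left₀ _ hK.ne']
  rw [hp, ← capt_eq hw hl] at hd
  have hA := capt_nonneg (x := w) hl
  set A := capt w l
  have hc0 := M.cos_pos
  have hmax : IsLocalMaxOn (fun x => (w * G2 θ0 x (U / (sin q / sin x)) - E) * (sin q / sin x))
      (Icc θ0 (π / 2)) q := by
    refine IsMaxOn.localize fun x hx => ?_
    have := h x hx
    simpa [div_self hS.ne'] using this
  have hfd := hd.hasDerivWithinAt.hasFDerivWithinAt (s := Icc θ0 (π / 2))
  have hdir : ∀ x ∈ Icc θ0 (π / 2), (x - q) * (E * cos q - cos θ0 * A) ≤ 0 := fun x hx => by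
    have := hmax.hasFDerivWithinAt_nonpos hfd
      (sub_mem_posTangentConeAt_of_segment_subset ((convex_Icc _ _).segment_subset hq hx))
    simp only [ContinuousLinearMap.toSpanSingleton_apply, smul_eq_mul, mul_div_assoc'] at this
    exact (div_le_iff₀ hS).1 this |>.trans_eq (zero_mul _)
  have h1 := hdir θ0 ⟨le_rfl, M.θ_lt.le⟩
  have h2 := hdir (π / 2) ⟨M.θ_lt.le, le_rfl⟩
  have hcos : cos q ≤ cos θ0 := cos_le_cos_of_nonneg_of_le_pi M.θ_pos.le
    (by linarith [hq.2, pi_pos]) hq.1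
  rw [ratio, mul_div_assoc', eq_div_iff hE.ne']
  rcases hq.1.eq_or_lt with h0 | h0
  · subst h0
    have hlt := M.θ_lt
    have : E ≤ A := by
      by_contra! hcon
      nlinarith [mul_pos (sub_pos.2 hlt) (mul_pos hc0 (sub_pos.2 hcon))]
    rw [min_eq_left this]
  · have h3 : cos θ0 * A ≤ E * cos q := by nlinarith
    rcases hq.2.eq_or_lt with h4 | h4
    · rw [h4, cos_pi_div_two, mul_zero] at h3
      have : A = 0 := le_antisymm (nonpos_of_mul_nonpos_right h3 hc0) hA
      rw [this, min_eq_right hE.le, h4, cos_pi_div_two]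
      simp
    · have h5 : E * cos q ≤ cos θ0 * A := by nlinarith
      have h6 : E * cos q = cos θ0 * A := le_antisymm h5 h3
      have : A ≤ E := by nlinarith
      rw [min_eq_right this, ← h6]
      ring

lemma sin_eq_sinOf {q R : ℝ} (hq : 0 ≤ sin q) (h : cos q = cos θ0 * R) : sin q = sinOf θ0 R := by
  rw [sinOf, show 1 - R ^ 2 * cos θ0 ^ 2 = sin q ^ 2 by rw [sin_sq, h]; ring, sqrt_sq hq]

lemma cos_eq_cosOf {q R : ℝ} (hq : 0 ≤ sin q) (h : cos q = cos θ0 * R) :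
    cos (q - θ0) = cosOf θ0 R := by
  rw [cos_sub, cosOf, h, sin_eq_sinOf hq h]
  ring

namespace Optimal

variable (M : Model θ0 α c I) (h : Optimal θ0 α c I θ u)
include M h

/-- The ratio which determines the angle at arc length `t`. -/
lemma ae_control_eq : ∀ᵐ t, 0 < t → 0 < tail u t →
    cos (θ t) = cos θ0 *
      ratio (capt (I (height θ t)) (mult α c u t)) (c * tail u t ^ α) ∧
    sin (θ t) = sinOf θ0
      (ratio (capt (I (height θ t)) (mult α c u t)) (c * tail u t ^ α)) ∧
    u t = cosOf θ0 (ratio (capt (I (height θ t)) (mult α c u t)) (c * tail u t ^ α)) *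
      ell (I (height θ t)) (mult α c u t) := by
  filter_upwards [h.density_eq M, h.ae_angle_variation M] with t h1 h2 ht htu
  have hq := h.adm.2.2.1 t
  have hS := M.sin_pos.trans_le (M.sin_le hq)
  have hc := M.c_pos
  have hU := h1 ht htu
  have hcos := M.angle_eq hq (E := c * tail u t ^ α) (by positivity)
    (by linarith [M.half_le (height θ t)]) (h.mult_pos M ht htu) hU (h2 ht)
  exact ⟨hcos, sin_eq_sinOf hS.le hcos, by rw [← cos_eq_cosOf hS.le hcos]; exact hU⟩

end Optimal

end

/-! ### The multiplier as time variable -/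

section

variable {θ0 α c T : ℝ} {I θ u : ℝ → ℝ}

/-- The derivative of the multiplier along a stem of length `T`, extended by `1`. -/
noncomputable def speed (α c : ℝ) (u : ℝ → ℝ) (T t : ℝ) : ℝ :=
  if 0 < t ∧ t < T then c * α * tail u t ^ (α - 1) else 1

/-- The height as a function of the multiplier. -/
noncomputable def heightAt (θ : ℝ → ℝ) (T : ℝ) (e : ℝ ≃o ℝ) (s : ℝ) : ℝ :=
  height θ (min (e.symm s) T)

/-- The transport cost as a function of the multiplier. -/
noncomputable def costAt (α c : ℝ) (u : ℝ → ℝ) (e : ℝ ≃o ℝ) (s : ℝ) : ℝ :=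
  c * tail u (e.symm s) ^ α

lemma const_mul_cost_rpow (hα : 0 < α) (hc : 0 < c) {x : ℝ} (hx : 0 < x) :
    c * α * x ^ (α - 1) * (1 / (c * α * c ^ ((1 - α) / α)) * (c * x ^ α) ^ ((1 - α) / α)) = 1 := by
  rw [mul_rpow hc.le (by positivity), ← rpow_mul hx.le, mul_div_cancel₀ _ hα.ne']
  have h1 : x ^ (α - 1) * x ^ (1 - α) = 1 := by
    rw [← rpow_add hx]; simp
  have h2 : c ^ ((1 - α) / α) ≠ 0 := by positivity
  field_simp
  linarith

namespace Optimal

variable (M : Model θ0 α c I) (h : Optimal θ0 α c I θ u) (hT0 : 0 < T)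
  (hT : ∀ t < T, 0 < tail u t) (hT' : ∀ t ≥ T, tail u t = 0)
include M h hT0 hT

lemma exists_clock_speed : ∃ e : ℝ ≃o ℝ, Clock (speed α c u T) e := by
  have hui := h.integrable
  have hu0 := h.adm.2.2.2.1
  have hα := M.α_pos
  have hc := M.c_pos
  have hN := h.tail_zero_pos M
  have hset : MeasurableSet {t : ℝ | 0 < t ∧ t < T} := measurableSet_Ioo
  have hm : Measurable (speed α c u T) :=
    Measurable.ite hset (((continuous_tail hui).measurable.pow_const _).const_mul _)
      measurable_const
  have hi : LocallyIntegrable (speed α c u T) := by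
    have h1 : Integrable ((Ioo 0 T).indicator fun s => c * α * tail u s ^ (α - 1)) :=
      (integrable_indicator_iff measurableSet_Ioo).2
        ((h.integrableOn_rpow_tail M hT0 hT).mono_set Ioo_subset_Ioc_self)
    refine (h1.locallyIntegrable.add (locallyIntegrable_const (1 : ℝ))).mono
      hm.aestronglyMeasurable (Filter.Eventually.of_forall fun t => ?_)
    simp only [Pi.add_apply]
    by_cases ht : 0 < t ∧ t < T
    · have := hT t ht.2
      rw [indicator_of_mem (show t ∈ Ioo 0 T from ht), speed, if_pos ht,
        norm_of_nonneg (by positivity), norm_of_nonneg (by positivity)]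
      linarith
    · rw [indicator_of_notMem (show t ∉ Ioo 0 T from ht), speed, if_neg ht, zero_add]
  refine exists_clock (m := min (c * α * tail u 0 ^ (α - 1)) 1) hm hi
    (lt_min (by positivity) one_pos) fun t => ?_
  rw [speed]
  split_ifs with ht
  · refine (min_le_left _ _).trans (mul_le_mul_of_nonneg_left ?_ (by positivity))
    exact rpow_le_rpow_of_nonpos (hT t ht.2) (tail_antitone hui hu0 ht.1.le) (by linarith [M.α_lt])
  · exact min_le_right _ _

end Optimal

namespace Clock

variable {e : ℝ ≃o ℝ} (he : Clock (speed α c u T) e)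
include he

lemma eq_mult {t : ℝ} (ht : t ∈ Icc 0 T) : e t = mult α c u t := by
  rw [he.eq, mult]
  refine intervalIntegral.integral_congr_Ioo_of_le ht.1 fun s hs => ?_
  simp only [speed]
  rw [if_pos ⟨hs.1, hs.2.trans_le ht.2⟩]

end Clock

namespace Optimal

variable {e : ℝ ≃o ℝ} (M : Model θ0 α c I) (h : Optimal θ0 α c I θ u) (hT0 : 0 < T)
  (hT : ∀ t < T, 0 < tail u t) (hT' : ∀ t ≥ T, tail u t = 0) (he : Clock (speed α c u T) e)
include M h hT0 hT he

omit hT0 in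
lemma clock_le_one : e T ≤ 1 := by
  by_contra! hlt
  have h1 : e.symm 1 < T := by rwa [OrderIso.symm_apply_lt]
  have h0 : 0 ≤ e.symm 1 := by rw [OrderIso.le_symm_apply, he.zero]; exact zero_le_one
  have := h.mult_lt_one M h0 (hT _ h1)
  rw [← he.eq_mult ⟨h0, h1.le⟩] at this
  simp at this

include hT'

lemma light_le_clock : I (height θ T) ≤ e T := by
  rw [he.eq_mult ⟨hT0.le, le_rfl⟩]
  exact h.light_tip_le M hT0 hT hT'

omit he
lemma integral_marginal_cost {t : ℝ} (ht : t ≤ T) :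
    IntegrableOn (fun s => c * α * tail u s ^ (α - 1) * u s) (Ioc t T) ∧
      ∫ s in t..T, c * α * tail u s ^ (α - 1) * u s = c * tail u t ^ α := by
  have hui := h.integrable
  have hu0 := h.adm.2.2.2.1
  have hα := M.α_pos
  have hc := M.c_pos
  have hval : ∀ b, t ≤ b → b < T → ∫ s in t..b, c * α * tail u s ^ (α - 1) * u s =
      c * tail u t ^ α - c * tail u b ^ α := fun b hb hbT => by
    rw [← mul_sub, ← integral_rpow_tail_mul hα M.α_lt hui hu0 hb (hT b hbT),
      ← intervalIntegral.integral_const_mul]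
    simp only [mul_assoc]
  have hi : ∀ b < T, IntegrableOn (fun s => c * α * tail u s ^ (α - 1) * u s) (Ioc t b) :=
    fun b hbT => by
    rcases le_total t b with hb | hb
    · rw [← intervalIntegrable_iff_integrableOn_Ioc_of_le hb]
      refine hui.intervalIntegrable.continuousOn_mul fun s hs => ?_
      rw [uIcc_of_le hb] at hs
      exact (((continuous_tail hui).continuousAt.rpow_const
        (Or.inl (hT s (hs.2.trans_lt hbT)).ne')).const_mul _).continuousWithinAt
    · simp [hb]
  have hint : IntegrableOn (fun s => c * α * tail u s ^ (α - 1) * u s) (Ioc t T) := by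
    refine integrableOn_Ioc_of_intervalIntegral_norm_bounded_right (I := c * tail u t ^ α)
      (l := Filter.atTop) (b := fun n : ℕ => T - 1 / ((n : ℝ) + 1))
      (fun n => hi _ (sub_lt_self _ (by positivity))) ?_ (Filter.Eventually.of_forall fun n => ?_)
    · simpa using tendsto_const_nhds.sub (tendsto_one_div_add_atTop_nhds_zero_nat (𝕜 := ℝ))
    · have hbT : T - 1 / ((n : ℝ) + 1) < T := sub_lt_self _ (by positivity)
      have hnn : 0 ≤ c * tail u t ^ α := mul_nonneg hc.le (rpow_nonneg (tail_nonneg hu0 t) _)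
      rcases le_total t (T - 1 / ((n : ℝ) + 1)) with hb | hb
      · have : ∀ s, ‖c * α * tail u s ^ (α - 1) * u s‖ =
            c * α * tail u s ^ (α - 1) * u s := fun s => by
          have := rpow_nonneg (tail_nonneg hu0 s) (α - 1)
          have := hu0 s
          exact norm_of_nonneg (by positivity)
        simp only [this]
        rw [← intervalIntegral.integral_of_le hb, hval _ hb hbT]
        have := mul_nonneg hc.le (rpow_nonneg (tail_nonneg hu0 (T - 1 / ((n : ℝ) + 1))) α)
        linarith
      · rw [Ioc_eq_empty (not_lt.2 hb)]
        simpa using hnn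
  refine ⟨hint, ?_⟩
  rcases ht.eq_or_lt with rfl | hlt
  · simp [hT' t le_rfl, zero_rpow hα.ne']
  have h1 : ContinuousOn (fun b => ∫ s in t..b, c * α * tail u s ^ (α - 1) * u s) (Icc t T) := by
    have := intervalIntegral.continuousOn_primitive_interval' (a := t)
      ((intervalIntegrable_iff_integrableOn_Ioc_of_le ht).2 hint) left_mem_uIcc
    rwa [uIcc_of_le ht] at this
  have h2 : ContinuousOn (fun b => c * tail u t ^ α - c * tail u b ^ α) (Icc t T) :=
    (continuous_const.sub (((continuous_tail hui).rpow_const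
      fun _ => Or.inr hα.le).const_mul c)).continuousOn
  have h3 := Set.EqOn.of_subset_closure (s := Ico t T) (t := Icc t T)
    (fun b hb => hval b hb.1 hb.2) h1 h2 Ico_subset_Icc_self
    (by rw [closure_Ico hlt.ne])
  have h4 := h3 (right_mem_Icc.2 ht)
  simpa [hT' T le_rfl, zero_rpow hα.ne'] using h4

end Optimal

end

/-! ### Optimal pairs solve the optimality system -/

section

variable {θ0 α c T : ℝ} {I θ u : ℝ → ℝ}

lemma setIntegral_Ioc_inter_Iio (f : ℝ → ℝ) (a b d : ℝ) :
    ∫ t in Ioc a b ∩ Iio d, f t = ∫ t in Ioc a (min b d), f t := by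
  rw [← Ioc_inter_Iic]
  exact setIntegral_congr_set ((Filter.EventuallyEq.refl _ _).inter Iio_ae_eq_Iic)

namespace Optimal

variable {e : ℝ ≃o ℝ} (M : Model θ0 α c I) (h : Optimal θ0 α c I θ u) (hT0 : 0 < T)
  (hT : ∀ t < T, 0 < tail u t) (hT' : ∀ t ≥ T, tail u t = 0) (he : Clock (speed α c u T) e)
include M h hT0 hT hT' he

omit hT0 in
lemma ae_speed_mul_height : ∀ᵐ t, 0 < t →
    speed α c u T t * (1 / (c * α * c ^ ((1 - α) / α)) *
      sinOf θ0 (ratio (capt (I (heightAt θ T e (e t))) (e t)) (costAt α c u e (e t))) *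
      costAt α c u e (e t) ^ ((1 - α) / α)) = (Iio T).indicator (fun t => sin (θ t)) t := by
  have hα := M.α_pos
  have hγ : (1 - α) / α ≠ 0 := (div_pos (by linarith [M.α_lt]) hα).ne'
  filter_upwards [h.ae_control_eq M] with t ht ht0
  rcases lt_or_ge t T with hlt | hge
  · have hmem : t ∈ Iio T := hlt
    rw [indicator_of_mem hmem, (ht ht0 (hT t hlt)).2.1, speed, if_pos ⟨ht0, hlt⟩, heightAt, costAt,
      OrderIso.symm_apply_apply, min_eq_left hlt.le, he.eq_mult ⟨ht0.le, hlt.le⟩]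
    linear_combination sinOf θ0 (ratio (capt (I (height θ t)) (mult α c u t)) (c * tail u t ^ α)) *
      const_mul_cost_rpow hα M.c_pos (hT t hlt)
  · have hmem : t ∉ Iio T := not_lt.2 hge
    rw [indicator_of_notMem hmem]
    simp [costAt, hT' t hge, zero_rpow hα.ne', zero_rpow hγ]

lemma ae_speed_mul_cost : ∀ᵐ t, 0 < t →
    speed α c u T t *
      (cosOf θ0 (ratio (capt (I (heightAt θ T e (e t))) (e t)) (costAt α c u e (e t))) *
        ell (I (heightAt θ T e (e t))) (e t)) =
      (Iio T).indicator (fun t => c * α * tail u t ^ (α - 1) * u t) t := by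
  filter_upwards [h.ae_control_eq M] with t ht ht0
  rcases lt_or_ge t T with hlt | hge
  · have hmem : t ∈ Iio T := hlt
    rw [indicator_of_mem hmem, heightAt, costAt, OrderIso.symm_apply_apply, min_eq_left hlt.le,
      he.eq_mult ⟨ht0.le, hlt.le⟩, ← (ht ht0 (hT t hlt)).2.2, speed, if_pos ⟨ht0, hlt⟩]
  · have hmem : t ∉ Iio T := not_lt.2 hge
    have h1 := h.light_le_clock M hT0 hT hT' he
    have h2 := M.half_le (height θ T)
    have h3 : e T ≤ e t := e.monotone hge
    rw [indicator_of_notMem hmem, heightAt, OrderIso.symm_apply_apply, min_eq_right hge,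
      ell_eq_zero (by linarith) (by linarith) (by linarith)]
    simp

lemma profile : Profile θ0 (1 / (c * α * c ^ ((1 - α) / α))) ((1 - α) / α) I
    (heightAt θ T e) (costAt α c u e) := by
  have hui := h.integrable
  have hu0 := h.adm.2.2.2.1
  have hα := M.α_pos
  have hc := M.c_pos
  have hes : Continuous e.symm := e.symm.toHomeomorph.continuous
  have hT1 : T ≤ e.symm 1 := by
    rw [OrderIso.le_symm_apply]; exact h.clock_le_one M hT he
  have hy := h.ae_speed_mul_height M hT hT' he
  have hE := h.ae_speed_mul_cost M hT0 hT hT' he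
  have hsin := intervalIntegrable_sin h.adm.1
  have hmc := fun t ht => h.integral_marginal_cost M hT0 hT hT' (t := t) ht
  have hyi : IntervalIntegrable ((Iio T).indicator fun t => sin (θ t)) volume 0 (e.symm 1) := by
    rw [intervalIntegrable_iff]
    exact ((intervalIntegrable_iff.1 (hsin _ _))).indicator measurableSet_Iio
  have hEi : IntervalIntegrable
      ((Iio T).indicator fun t => c * α * tail u t ^ (α - 1) * u t) volume 0 (e.symm 1) := by
    rw [intervalIntegrable_iff_integrableOn_Ioc_of_le (hT0.le.trans hT1), IntegrableOn,
      integrable_indicator_iff measurableSet_Iio, IntegrableOn,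
      Measure.restrict_restrict measurableSet_Iio]
    exact (hmc 0 hT0.le).1.mono_set fun s hs => ⟨hs.2.1, (show s < T from hs.1).le⟩
  have hmem : ∀ s ∈ Icc (0 : ℝ) 1, e.symm s ∈ Icc 0 (e.symm 1) := fun s hs =>
    ⟨by rw [← he.symm_zero]; exact e.symm.monotone hs.1, e.symm.monotone hs.2⟩
  refine ⟨fun s _ => ?_, ?_, ?_, ?_, fun s hs => ?_, fun s hs => ?_⟩
  · exact mul_nonneg hc.le (rpow_nonneg (tail_nonneg hu0 _) _)
  · exact ((continuous_height h.adm.1).comp (hes.min continuous_const)).continuousOn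
  · have := he.intervalIntegrable_iff (fun r => 1 / (c * α * c ^ ((1 - α) / α)) *
      sinOf θ0 (ratio (capt (I (heightAt θ T e r)) r) (costAt α c u e r)) *
      costAt α c u e r ^ ((1 - α) / α)) 0 (e.symm 1)
    rw [he.zero, OrderIso.apply_symm_apply] at this
    refine this.2 (hyi.congr_ae ?_)
    rw [uIoc_of_le (hT0.le.trans hT1)]
    refine (ae_restrict_iff' measurableSet_Ioc).2 ?_
    filter_upwards [hy] with t ht htm
    exact (ht htm.1).symm
  · have := he.intervalIntegrable_iff (fun r =>
      cosOf θ0 (ratio (capt (I (heightAt θ T e r)) r) (costAt α c u e r)) *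
        ell (I (heightAt θ T e r)) r) 0 (e.symm 1)
    rw [he.zero, OrderIso.apply_symm_apply] at this
    refine this.2 (hEi.congr_ae ?_)
    rw [uIoc_of_le (hT0.le.trans hT1)]
    refine (ae_restrict_iff' measurableSet_Ioc).2 ?_
    filter_upwards [hE] with t ht htm
    exact (ht htm.1).symm
  · obtain ⟨ht0, ht1⟩ := hmem s hs
    have := he.integral_eq (fun r => 1 / (c * α * c ^ ((1 - α) / α)) *
      sinOf θ0 (ratio (capt (I (heightAt θ T e r)) r) (costAt α c u e r)) *
      costAt α c u e r ^ ((1 - α) / α)) 0 (e.symm s)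
    rw [he.zero, OrderIso.apply_symm_apply] at this
    rw [this, intervalIntegral.integral_congr_ae (g := (Iio T).indicator fun t => sin (θ t))]
    · rw [intervalIntegral.integral_of_le ht0, setIntegral_indicator measurableSet_Iio, heightAt,
        height, intervalIntegral.integral_of_le (le_min ht0 hT0.le), setIntegral_Ioc_inter_Iio]
    · rw [uIoc_of_le ht0]
      filter_upwards [hy] with t ht htm
      exact ht htm.1
  · obtain ⟨ht0, ht1⟩ := hmem s hs
    have := he.integral_eq (fun r =>
      cosOf θ0 (ratio (capt (I (heightAt θ T e r)) r) (costAt α c u e r)) *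
        ell (I (heightAt θ T e r)) r) (e.symm s) (e.symm 1)
    rw [OrderIso.apply_symm_apply, OrderIso.apply_symm_apply] at this
    rw [this, intervalIntegral.integral_congr_ae
      (g := (Iio T).indicator fun t => c * α * tail u t ^ (α - 1) * u t)]
    · rw [intervalIntegral.integral_of_le ht1, setIntegral_indicator measurableSet_Iio, costAt,
        setIntegral_Ioc_inter_Iio, min_eq_right hT1]
      rcases le_total (e.symm s) T with hle | hle
      · rw [← (hmc _ hle).2, intervalIntegral.integral_of_le hle]
      · simp [hT' _ hle, zero_rpow hα.ne', Ioc_eq_empty (not_lt.2 hle)]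
    · rw [uIoc_of_le ht1]
      filter_upwards [hE] with t ht htm
      exact ht (ht0.trans_lt htm.1)

end Optimal

end

/-! ### Recovering the controls -/

section

variable {θ0 α c T T₁ T₂ : ℝ} {I θ u θ₁ u₁ θ₂ u₂ : ℝ → ℝ} {e e₁ e₂ : ℝ ≃o ℝ}

lemma costAt_pos_iff (hα : 0 < α) (hc : 0 < c) (hT : ∀ t < T, 0 < tail u t)
    (hT' : ∀ t ≥ T, tail u t = 0) {s : ℝ} : 0 < costAt α c u e s ↔ s < e T := by
  rw [← OrderIso.symm_apply_lt, costAt]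
  rcases lt_or_ge (e.symm s) T with h | h
  · have := hT _ h
    exact ⟨fun _ => h, fun _ => by positivity⟩
  · simp [hT' _ h, zero_rpow hα.ne', h]

lemma clock_le_clock (hα : 0 < α) (hc : 0 < c) (hT₁ : ∀ t < T₁, 0 < tail u₁ t)
    (hT₁' : ∀ t ≥ T₁, tail u₁ t = 0) (hT₂ : ∀ t < T₂, 0 < tail u₂ t)
    (hT₂' : ∀ t ≥ T₂, tail u₂ t = 0) (h1 : e₂ T₂ ∈ Icc (0 : ℝ) 1)
    (hE : EqOn (costAt α c u₁ e₁) (costAt α c u₂ e₂) (Icc 0 1)) : e₁ T₁ ≤ e₂ T₂ := by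
  by_contra! hlt
  have := (costAt_pos_iff (e := e₁) hα hc hT₁ hT₁').2 hlt
  rw [hE h1, costAt_pos_iff hα hc hT₂ hT₂'] at this
  exact lt_irrefl _ this

lemma tail_eq_of_costAt_eq (hα : 0 < α) (hc : 0 < c) (h₁ : ∀ t, 0 ≤ u₁ t) (h₂ : ∀ t, 0 ≤ u₂ t)
    {s : ℝ} (h : costAt α c u₁ e₁ s = costAt α c u₂ e₂ s) :
    tail u₁ (e₁.symm s) = tail u₂ (e₂.symm s) :=
  (rpow_left_inj (tail_nonneg h₁ _) (tail_nonneg h₂ _) hα.ne').1 (mul_left_cancel₀ hc.ne' h)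

lemma Clock.symm_eq (hα : 0 < α) (hc : 0 < c) (hT : ∀ t < T, 0 < tail u t)
    (he : Clock (speed α c u T) e) {s : ℝ} (hs : s ∈ Icc 0 (e T)) :
    e.symm s = ∫ r in (0 : ℝ)..s, 1 / (c * α * tail u (e.symm r) ^ (α - 1)) := by
  have h1 := he.integral_eq (fun r => 1 / (c * α * tail u (e.symm r) ^ (α - 1))) 0 (e.symm s)
  rw [he.zero, OrderIso.apply_symm_apply] at h1
  have h0 : 0 ≤ e.symm s := by rw [OrderIso.le_symm_apply, he.zero]; exact hs.1
  have hle : e.symm s ≤ T := by rw [OrderIso.symm_apply_le]; exact hs.2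
  rw [h1, intervalIntegral.integral_congr_Ioo_of_le (g := fun _ => (1 : ℝ)) h0]
  · simp
  · intro t ht
    have hlt := ht.2.trans_le hle
    have := hT t hlt
    simp only [speed, OrderIso.symm_apply_apply]
    rw [if_pos ⟨ht.1, hlt⟩]
    field_simp

namespace Optimal

lemma ae_eq_of_eqOn (M : Model θ0 α c I) (h₁ : Optimal θ0 α c I θ₁ u₁) (h₂ : Optimal θ0 α c I θ₂ u₂)
    (hT₁0 : 0 < T₁) (hT₁ : ∀ t < T₁, 0 < tail u₁ t) (hT₁' : ∀ t ≥ T₁, tail u₁ t = 0)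
    (he₁ : Clock (speed α c u₁ T₁) e₁)
    (hT₂0 : 0 < T₂) (hT₂ : ∀ t < T₂, 0 < tail u₂ t) (hT₂' : ∀ t ≥ T₂, tail u₂ t = 0)
    (he₂ : Clock (speed α c u₂ T₂) e₂)
    (hy : EqOn (heightAt θ₁ T₁ e₁) (heightAt θ₂ T₂ e₂) (Icc 0 1))
    (hE : EqOn (costAt α c u₁ e₁) (costAt α c u₂ e₂) (Icc 0 1)) :
    ∀ᵐ t, 0 < t → u₁ t = u₂ t ∧ (0 < u₁ t → θ₁ t = θ₂ t) := by
  have hα := M.α_pos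
  have hc := M.c_pos
  have hΛ₁ := h₁.clock_le_one M hT₁ he₁
  have hΛ₂ := h₂.clock_le_one M hT₂ he₂
  have hΛ₁0 : 0 ≤ e₁ T₁ := by rw [← he₁.zero]; exact e₁.monotone hT₁0.le
  have hΛ₂0 : 0 ≤ e₂ T₂ := by rw [← he₂.zero]; exact e₂.monotone hT₂0.le
  have hΛ : e₁ T₁ = e₂ T₂ := le_antisymm
    (clock_le_clock hα hc hT₁ hT₁' hT₂ hT₂' ⟨hΛ₂0, hΛ₂⟩ hE)
    (clock_le_clock hα hc hT₂ hT₂' hT₁ hT₁' ⟨hΛ₁0, hΛ₁⟩ hE.symm)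
  have htail : ∀ s ∈ Icc (0 : ℝ) 1, tail u₁ (e₁.symm s) = tail u₂ (e₂.symm s) := fun s hs =>
    tail_eq_of_costAt_eq hα hc h₁.adm.2.2.2.1 h₂.adm.2.2.2.1 (hE hs)
  have hsymm : ∀ s ∈ Icc 0 (e₁ T₁), e₁.symm s = e₂.symm s := fun s hs => by
    rw [he₁.symm_eq hα hc hT₁ hs, he₂.symm_eq hα hc hT₂ (hΛ ▸ hs)]
    refine intervalIntegral.integral_congr fun r hr => ?_
    rw [uIcc_of_le hs.1] at hr
    rw [htail r ⟨hr.1, hr.2.trans (hs.2.trans hΛ₁)⟩]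
  have hT : T₁ = T₂ := by
    have := hsymm (e₁ T₁) ⟨hΛ₁0, le_rfl⟩
    rwa [hΛ, OrderIso.symm_apply_apply, ← hΛ, OrderIso.symm_apply_apply] at this
  subst hT
  have hmem : ∀ t ∈ Icc 0 T₁, e₁ t ∈ Icc 0 (e₁ T₁) := fun t ht =>
    ⟨by rw [← he₁.zero]; exact e₁.monotone ht.1, e₁.monotone ht.2⟩
  have he : ∀ t ∈ Icc 0 T₁, e₁ t = e₂ t := fun t ht => by
    have := hsymm (e₁ t) (hmem t ht)
    rwa [OrderIso.symm_apply_apply, OrderIso.eq_symm_apply, eq_comm] at this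
  filter_upwards [h₁.ae_control_eq M, h₂.ae_control_eq M,
    ae_eq_zero_of_tail_eq_zero h₁.integrable h₁.adm.2.2.2.1,
    ae_eq_zero_of_tail_eq_zero h₂.integrable h₂.adm.2.2.2.1] with t c1 c2 z1 z2 ht0
  rcases lt_or_ge t T₁ with hlt | hge
  · have htm : t ∈ Icc 0 T₁ := ⟨ht0.le, hlt.le⟩
    have hm1 : e₁ t ∈ Icc (0 : ℝ) 1 := ⟨(hmem t htm).1, (hmem t htm).2.trans hΛ₁⟩
    have e1 : tail u₁ t = tail u₂ t := by
      have := htail _ hm1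
      rwa [OrderIso.symm_apply_apply, he t htm, OrderIso.symm_apply_apply] at this
    have e2 : mult α c u₁ t = mult α c u₂ t := by
      rw [← he₁.eq_mult htm, ← he₂.eq_mult htm, he t htm]
    have e3 : height θ₁ t = height θ₂ t := by
      have := hy hm1
      rwa [heightAt, heightAt, OrderIso.symm_apply_apply, he t htm, OrderIso.symm_apply_apply,
        min_eq_left hlt.le] at this
    obtain ⟨a1, -, b1⟩ := c1 ht0 (hT₁ t hlt)
    obtain ⟨a2, -, b2⟩ := c2 ht0 (hT₂ t hlt)
    rw [e1, e2, e3] at a1 b1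
    refine ⟨b1.trans b2.symm, fun _ => ?_⟩
    have hr1 := h₁.adm.2.2.1 t
    have hr2 := h₂.adm.2.2.1 t
    have := M.θ_pos
    have := pi_pos
    exact injOn_cos ⟨by linarith [hr1.1], by linarith [hr1.2]⟩
      ⟨by linarith [hr2.1], by linarith [hr2.2]⟩ (a1.trans a2.symm)
  · rw [z1 (hT₁' t hge), z2 (hT₂' t hge)]
    exact ⟨rfl, fun h => absurd h (lt_irrefl _)⟩

end Optimal

/-- Two optimal pairs coincide when the light is close to full intensity. -/
lemma exists_optimal_unique (θ0 α c C β : ℝ) (hθ0 : θ0 ∈ Ioo 0 (π / 2)) (hα : α ∈ Ioo (0 : ℝ) 1)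
    (hc : 0 < c) (hC : 0 < C) (hβ : β ∈ Ioo (0 : ℝ) 1) : ∃ δ > 0, ∀ I θ₁ u₁ θ₂ u₂ : ℝ → ℝ,
      Light C β δ I → Optimal θ0 α c I θ₁ u₁ → Optimal θ0 α c I θ₂ u₂ →
      ∀ᵐ t, 0 < t → u₁ t = u₂ t ∧ (0 < u₁ t → θ₁ t = θ₂ t) := by
  have hα0 := hα.1
  have hα1 := hα.2
  have P : Params θ0 (1 / (c * α * c ^ ((1 - α) / α))) ((1 - α) / α) C β :=
    ⟨sin_pos_of_pos_of_lt_pi hθ0.1 (by linarith [hθ0.2, pi_pos]), by positivity,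
      div_pos (by linarith) hα0, hC, hβ.1, hβ.2⟩
  obtain ⟨δ, hδ, h⟩ := Profile.exists_unique P
  refine ⟨min δ (1 / 2), lt_min hδ (by norm_num), fun I θ₁ u₁ θ₂ u₂ L h₁ h₂ => ?_⟩
  have M : Model θ0 α c I := ⟨hθ0.1, hθ0.2, hα0, hα1, hc, L.mono, L.cont, L.le_one, fun y => by
    linarith [L.ge y, min_le_right δ (1 / 2)]⟩
  have L' : Light C β δ I := ⟨L.mono, L.cont, L.le_one,
    fun y => by linarith [L.ge y, min_le_left δ (1 / 2)], L.slope⟩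
  obtain ⟨T₁, a1, b1, c1⟩ := h₁.exists_length M
  obtain ⟨T₂, a2, b2, c2⟩ := h₂.exists_length M
  obtain ⟨e₁, he₁⟩ := h₁.exists_clock_speed M a1 b1
  obtain ⟨e₂, he₂⟩ := h₂.exists_clock_speed M a2 b2
  obtain ⟨hy, hE⟩ := h I _ _ _ _ L' (h₁.profile M a1 b1 c1 he₁) (h₂.profile M a2 b2 c2 he₂)
  exact Optimal.ae_eq_of_eqOn M h₁ h₂ a1 b1 c1 he₁ a2 b2 c2 he₂ hy hE

end

/-! ### The light intensity on the half-line -/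

section

variable {θ0 α c C β δ : ℝ} {I I' θ u : ℝ → ℝ}

lemma light_of_integral (hC : 0 < C) (hβ : 0 < β) (hI' : LocallyIntegrable I')
    (hI : ∀ y ≥ (0 : ℝ), I y = I 0 + ∫ s in (0 : ℝ)..y, I' s)
    (hb : ∀ᵐ y, 0 < y → 0 ≤ I' y ∧ I' y ≤ C * y ^ (-β))
    (h01 : ∀ y ∈ Ici (0 : ℝ), I y ∈ Icc (0 : ℝ) 1) (hm : MonotoneOn I (Ici 0))
    (hδ : 1 - δ ≤ I 0) : Light C β δ fun y => I (max y 0) := by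
  have hi : ∀ a b, IntervalIntegrable I' volume a b := fun a b =>
    (hI'.integrableOn_isCompact isCompact_uIcc).intervalIntegrable
  refine ⟨fun a b hab => hm (mem_Ici.2 (le_max_right a 0))
    (mem_Ici.2 (le_max_right b 0)) (max_le_max_right _ hab), ?_,
    fun y => (h01 _ (mem_Ici.2 (le_max_right y 0))).2, fun y => hδ.trans
      (hm (mem_Ici.2 le_rfl) (mem_Ici.2 (le_max_right y 0)) (le_max_right _ _)),
    fun a b ha hab => ?_⟩
  · have : (fun y => I (max y 0)) = fun y => I 0 + ∫ s in (0 : ℝ)..(max y 0), I' s :=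
      funext fun y => hI _ (le_max_right _ _)
    rw [this]
    exact continuous_const.add ((intervalIntegral.continuous_primitive hi 0).comp
      (continuous_id.max continuous_const))
  · simp only [max_eq_left ha.le, max_eq_left (ha.le.trans hab)]
    rw [hI a ha.le, hI b (ha.le.trans hab), add_sub_add_left_eq_sub,
      intervalIntegral.integral_interval_sub_left (hi _ _) (hi _ _)]
    calc ∫ s in a..b, I' s ≤ ∫ _ in a..b, C * a ^ (-β) := by
          refine intervalIntegral.integral_mono_ae_restrict hab (hi _ _) (by simp) ?_
          refine (ae_restrict_iff' measurableSet_Icc).2 ?_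
          filter_upwards [hb] with y hy hya
          refine (hy (ha.trans_le hya.1)).2.trans (mul_le_mul_of_nonneg_left ?_ hC.le)
          exact rpow_le_rpow_of_nonpos ha hya.1 (by linarith)
      _ = C * a ^ (-β) * (b - a) := by
          rw [intervalIntegral.integral_const, smul_eq_mul, mul_comm]

lemma payoff_congr_light (hθ0 : θ0 ∈ Ioo 0 (π / 2)) (hθ : ∀ t, θ t ∈ Icc θ0 (π / 2)) :
    Payoff θ0 α c (fun y => I (max y 0)) θ u = Payoff θ0 α c I θ u := by
  refine setIntegral_congr_fun measurableSet_Ioi fun t ht => ?_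
  have : 0 ≤ ∫ s in (0 : ℝ)..t, sin (θ s) :=
    intervalIntegral.integral_nonneg (le_of_lt ht) fun s _ =>
      sin_nonneg_of_nonneg_of_le_pi (by linarith [(hθ s).1, hθ0.1])
        (by linarith [(hθ s).2, pi_pos])
  simp only [max_eq_left this]

lemma payoff_congr_density : Payoff θ0 α c I θ ((Ioi 0).indicator u) = Payoff θ0 α c I θ u := by
  refine setIntegral_congr_fun measurableSet_Ioi fun t ht => ?_
  have : ∫ s in Ioi t, (Ioi 0).indicator u s = ∫ s in Ioi t, u s :=
    setIntegral_congr_fun measurableSet_Ioi fun s hs =>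
      indicator_of_mem (show s ∈ Ioi 0 from lt_trans (mem_Ioi.1 ht) hs) _
  simp only [this, indicator_of_mem ht]

lemma Optimal.of_isMax (hθ0 : θ0 ∈ Ioo 0 (π / 2)) (hadm : Adm2 θ0 θ u)
    (h : ∀ θ' u', Adm2 θ0 θ' u' → Payoff θ0 α c I θ' u' ≤ Payoff θ0 α c I θ u) :
    Optimal θ0 α c (fun y => I (max y 0)) θ ((Ioi 0).indicator u) := by
  obtain ⟨hθ, hu, hθm, hu0, hui⟩ := id hadm
  refine ⟨⟨hθ, hu.indicator measurableSet_Ioi, hθm, fun t => indicator_nonneg (fun s _ => hu0 s) t,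
    ((integrable_indicator_iff measurableSet_Ioi).2 hui).integrableOn⟩,
    fun t ht => indicator_of_notMem (not_lt.2 ht) _, fun θ' u' h' => ?_⟩
  rw [payoff_congr_density, payoff_congr_light hθ0 h'.2.2.1, payoff_congr_light hθ0 hθm]
  exact h θ' u' h'

end

end OP2

/-- Uniqueness of the optimal stem configuration: there is `δ > 0`, depending only on
`θ0, α, c, C, β`, such that for every absolutely continuous nondecreasing intensity `I`
with `I' ≤ C·y^{−β}` a.e. and `I(0) ≥ 1 − δ`, any two optimal solutions of (OP2)
coincide a.e. (the densities agree a.e., and the angles agree a.e. where the density is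
positive). -/
theorem op2_unique (θ0 α c C β : ℝ) (hθ0 : θ0 ∈ Set.Ioo 0 (π / 2))
    (hα : α ∈ Set.Ioo (0 : ℝ) 1) (hc : 0 < c) (hC : 0 < C) (hβ : β ∈ Set.Ioo (0 : ℝ) 1) :
    ∃ δ > (0 : ℝ),
      ∀ (I I' : ℝ → ℝ), Measurable I' → LocallyIntegrable I' →
        (∀ y ≥ (0 : ℝ), I y = I 0 + ∫ s in (0 : ℝ)..y, I' s) →
        (∀ᵐ y, 0 < y → 0 ≤ I' y ∧ I' y ≤ C * y ^ (-β)) →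
        (∀ y ∈ Set.Ici (0 : ℝ), I y ∈ Set.Icc (0 : ℝ) 1) →
        MonotoneOn I (Set.Ici 0) →
        1 - δ ≤ I 0 →
        ∀ θ1 u1 θ2 u2 : ℝ → ℝ, Adm2 θ0 θ1 u1 → Adm2 θ0 θ2 u2 →
          (∀ θ u : ℝ → ℝ, Adm2 θ0 θ u → Payoff θ0 α c I θ u ≤ Payoff θ0 α c I θ1 u1) →
          (∀ θ u : ℝ → ℝ, Adm2 θ0 θ u → Payoff θ0 α c I θ u ≤ Payoff θ0 α c I θ2 u2) →
          (∀ᵐ t ∂(volume.restrict (Set.Ioi (0 : ℝ))), u1 t = u2 t) ∧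
          (∀ᵐ t ∂(volume.restrict (Set.Ioi (0 : ℝ))), 0 < u1 t → θ1 t = θ2 t) := by
  obtain ⟨δ, hδ, key⟩ := OP2.exists_optimal_unique θ0 α c C β hθ0 hα hc hC hβ
  refine ⟨δ, hδ, fun I I' _ hI' hI hb h01 hm h0 θ1 u1 θ2 u2 ha1 ha2 hmax1 hmax2 => ?_⟩
  have h := key _ θ1 _ θ2 _ (OP2.light_of_integral hC hβ.1 hI' hI hb h01 hm h0)
    (OP2.Optimal.of_isMax hθ0 ha1 hmax1) (OP2.Optimal.of_isMax hθ0 ha2 hmax2)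
  replace h := (ae_restrict_iff' (measurableSet_Ioi (a := (0 : ℝ)))).2 h
  have hmem := ae_restrict_mem (μ := volume) (measurableSet_Ioi (a := (0 : ℝ)))
  constructor
  · filter_upwards [h, hmem] with t ht hpos
    simpa [Set.indicator_of_mem hpos] using ht.1
  · filter_upwards [h, hmem] with t ht hpos
    simpa [Set.indicator_of_mem hpos] using ht.2
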